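/- arXiv:2605.00697 — 2 statements merged into one kernel-verified Lean document; each statement's English description precedes it below -/
import Mathlib

section
/- Let T be a complete arithmetically definable theory in a countable arithmetically definable language with no finite models. Then: (i) for every nonzero arithmetic degree D there exists an arithmetically extendible model M ⊨ T whose domain has arithmetic degree D; (ii) for every arithmetically decidable model M₀ ⊨ T and every nonzero arithmetic degree D, there exists an arithmetically extendible model M ⊨ T with M₀ ≼ M and deg_ar(M) = D. -/
open FirstOrder FirstOrder.Language

namespace ArMorley

/-! ## Arithmetical sets and arithmetic reducibility -/

/-- Function symbols of the language of arithmetic: `0`, `1`, `+`, `·`. -/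
inductive ArFunc : ℕ → Type
  | zero : ArFunc 0
  | one : ArFunc 0
  | add : ArFunc 2
  | mul : ArFunc 2

/-- Relation symbols: `<` and a unary oracle predicate. -/
inductive ArRel : ℕ → Type
  | lt : ArRel 2
  | mem : ArRel 1

/-- The language `(+, ·, 0, 1, <, Y)` of arithmetic with a unary oracle predicate. -/
def arithLang : FirstOrder.Language := ⟨ArFunc, ArRel⟩

/-- The standard structure on `ℕ`, with the oracle predicate interpreted by `Y`. -/
def arithStructure (Y : Set ℕ) : arithLang.Structure ℕ where
  funMap := fun {n} f =>
    match f with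
    | ArFunc.zero => fun _ => 0
    | ArFunc.one => fun _ => 1
    | ArFunc.add => fun v => v 0 + v 1
    | ArFunc.mul => fun v => v 0 * v 1
  RelMap := fun {n} r =>
    match r with
    | ArRel.lt => fun v => v 0 < v 1
    | ArRel.mem => fun v => v 0 ∈ Y

/-- `X ≤_ar Y` : `X` is definable without parameters in `(ℕ, +, ·, 0, 1, <, Y)`. -/
def ArReducible (X Y : Set ℕ) : Prop :=
  letI := arithStructure Y
  ∃ φ : arithLang.Formula (Fin 1), X = { n : ℕ | φ.Realize (fun _ => n) }

/-- `X` is arithmetical: definable without parameters in `(ℕ, +, ·, 0, 1, <)`. -/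
def IsArithmetical (X : Set ℕ) : Prop := ArReducible X ∅

/-- `X` and `Y` have the same arithmetic degree. -/
def ArEquiv (X Y : Set ℕ) : Prop := ArReducible X Y ∧ ArReducible Y X

/-! ## Coding conventions -/

/-- Code of a list of naturals. -/
def listCode (l : List ℕ) : ℕ := Encodable.encode l

/-- Code of a finite tuple of naturals. -/
def tupleCode {n : ℕ} (v : Fin n → ℕ) : ℕ := listCode (List.ofFn v)

/-- The subset of `ℕ` corresponding to a set of elements of a coded domain. -/
def subCode {A : Set ℕ} (S : Set ↥A) : Set ℕ := Subtype.val '' S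

/-- Code of a set of `n`-tuples from a coded domain as a subset of `ℕ`. -/
def tupleSetCode {A : Set ℕ} {n : ℕ} (X : Set (Fin n → ↥A)) : Set ℕ :=
  { c : ℕ | ∃ v ∈ X, c = tupleCode (fun i => ((v i : ℕ))) }

/-- Code of the graph of a function between coded domains. -/
def graphCode {A B : Set ℕ} (f : ↥A → ↥B) : Set ℕ :=
  { c : ℕ | ∃ a : ↥A, c = Nat.pair (a : ℕ) ((f a : ℕ)) }

/-! ## Gödel coded languages -/

/-- A fixed Gödel coding of the symbols of a countable first-order language. -/
structure GoedelCoding (L : FirstOrder.Language) where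
  encFun : ∀ n, L.Functions n → ℕ
  encFun_inj : ∀ n, Function.Injective (encFun n)
  encRel : ∀ n, L.Relations n → ℕ
  encRel_inj : ∀ n, Function.Injective (encRel n)

variable {L : FirstOrder.Language}

/-- The set of codes of the symbols of `L`. -/
def symbolCodes (g : GoedelCoding L) : Set ℕ :=
  { c | (∃ (n : ℕ) (f : L.Functions n), c = Nat.pair 0 (Nat.pair n (g.encFun n f))) ∨
        (∃ (n : ℕ) (R : L.Relations n), c = Nat.pair 1 (Nat.pair n (g.encRel n R))) }

/-- `L` is an arithmetically definable language. -/
def ArithLang (g : GoedelCoding L) : Prop := IsArithmetical (symbolCodes g)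

/-- Code of a term, with a given coding of the variables. -/
def termCode (g : GoedelCoding L) {α : Type} (encα : α → ℕ) (t : L.Term α) : ℕ :=
  listCode (t.listEncode.map (Sum.elim (fun a => Nat.pair 0 (encα a))
    (fun p => Nat.pair 1 (Nat.pair p.1 (g.encFun p.1 p.2)))))

/-- Code of a (bounded) formula, with a given coding of free variables. -/
def formulaCode (g : GoedelCoding L) {α : Type} (encα : α → ℕ) {n : ℕ}
    (φ : L.BoundedFormula α n) : ℕ :=
  listCode (φ.listEncode.map (Sum.elim
    (fun p => Nat.pair 0 (Nat.pair p.1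
      (termCode g (Sum.elim (fun a => Nat.pair 0 (encα a)) (fun i => Nat.pair 1 i.1)) p.2)))
    (Sum.elim
      (fun q => Nat.pair 1 (Nat.pair q.1 (g.encRel q.1 q.2)))
      (fun m => Nat.pair 2 m))))

/-- Code of a sentence. -/
def sentenceCode (g : GoedelCoding L) (φ : L.Sentence) : ℕ :=
  formulaCode g (fun a : Empty => a.elim) φ

/-- The set of codes of the axioms of a theory. -/
def theoryCode (g : GoedelCoding L) (T : L.Theory) : Set ℕ :=
  { c | ∃ φ ∈ T, c = sentenceCode g φ }

/-- `T` is an arithmetically definable theory. -/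
def ArithTheory (g : GoedelCoding L) (T : L.Theory) : Prop := IsArithmetical (theoryCode g T)

/-! ## Coded structures -/

/-- A coded `L`-structure: an `L`-structure whose domain is a subset of `ℕ`
with infinite complement. -/
structure CodedStructure (L : FirstOrder.Language) where
  carrier : Set ℕ
  compl_infinite : (carrierᶜ : Set ℕ).Infinite
  struc : L.Structure ↥carrier

/-- A coded structure is a model of `T`. -/
def CodedStructure.Models (M : CodedStructure L) (T : L.Theory) : Prop :=
  ∀ φ ∈ T, @Sentence.Realize L ↥M.carrier M.struc φ

/-- The (coded) elementary diagram of a coded structure. -/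
def elemDiagram (g : GoedelCoding L) (M : CodedStructure L) : Set ℕ :=
  { c | ∃ (k : ℕ) (φ : L.Formula (Fin k)) (a : Fin k → ↥M.carrier),
      c = Nat.pair (Nat.pair k (formulaCode g Fin.val φ)) (tupleCode fun i => ((a i : ℕ))) ∧
      (letI := M.struc; φ.Realize a) }

/-- A coded structure is arithmetically decidable if its elementary diagram is arithmetical. -/
def ArithDecidable (g : GoedelCoding L) (M : CodedStructure L) : Prop :=
  IsArithmetical (elemDiagram g M)

/-- `M ≼ N` for coded structures: `M`'s domain is contained in `N`'s, and the
inclusion is elementary. -/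
structure ElemSub (M N : CodedStructure L) : Prop where
  subset : M.carrier ⊆ N.carrier
  elem : ∀ (k : ℕ) (φ : L.Formula (Fin k)) (a : Fin k → ↥M.carrier),
    (letI := M.struc; φ.Realize a) ↔
      (letI := N.struc; φ.Realize (fun i => (⟨((a i : ℕ)), subset (a i).2⟩ : ↥N.carrier)))

/-- A coded model of `T` is arithmetically extendible if it is an elementary substructure of
an arithmetically decidable coded model of `T`. -/
def ArithExtendible (g : GoedelCoding L) (T : L.Theory) (M : CodedStructure L) : Prop :=
  ∃ N : CodedStructure L, ArithDecidable g N ∧ N.Models T ∧ ElemSub M N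

/-! ## Model-theoretic notions in arbitrary structures -/

/-- `N` (with structure `SN`) is a model of `T`. -/
def ModelsT (L : FirstOrder.Language) (T : L.Theory) (N : Type) (SN : L.Structure N) : Prop :=
  ∀ φ ∈ T, @Sentence.Realize L N SN φ

/-- `T` has no finite models. -/
def NoFiniteModels (L : FirstOrder.Language) (T : L.Theory) : Prop :=
  ∀ (N : Type) (SN : L.Structure N), ModelsT L T N SN → Infinite N

/-- Elementary embeddings, with the structures given explicitly. -/
def EEmb (L : FirstOrder.Language) (M : Type) (SM : L.Structure M)
    (N : Type) (SN : L.Structure N) : Type _ :=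
  @FirstOrder.Language.ElementaryEmbedding L M N SM SN

/-- The underlying map of an elementary embedding. -/
def EEmb.fn {L : FirstOrder.Language} {M : Type} {SM : L.Structure M}
    {N : Type} {SN : L.Structure N} (j : EEmb L M SM N SN) : M → N :=
  @FirstOrder.Language.ElementaryEmbedding.toFun L M N SM SN j

/-- A subset of `N^n` definable with parameters from `P`. -/
def DefinableOverT (L : FirstOrder.Language) (N : Type) (SN : L.Structure N) (P : Set N)
    {n : ℕ} (X : Set (Fin n → N)) : Prop :=
  letI := SN
  ∃ (m : ℕ) (ψ : L.Formula (Fin n ⊕ Fin m)) (b : Fin m → N),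
    (∀ i, b i ∈ P) ∧ X = { v | ψ.Realize (Sum.elim v b) }

/-- A subset of `N` definable with (arbitrary) parameters. -/
def Definable1 (L : FirstOrder.Language) (N : Type) (SN : L.Structure N) (Y : Set N) : Prop :=
  letI := SN
  ∃ (m : ℕ) (ψ : L.Formula (Fin 1 ⊕ Fin m)) (b : Fin m → N),
    Y = { x : N | ψ.Realize (Sum.elim (fun _ => x) b) }

/-- The algebraic closure of `B` in `N`: elements satisfying a formula with parameters
from `B` having finitely many solutions. -/
def aclIn (L : FirstOrder.Language) (N : Type) (SN : L.Structure N) (B : Set N) : Set N :=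
  letI := SN
  { a : N | ∃ (k : ℕ) (φ : L.Formula (Fin 1 ⊕ Fin k)) (b : Fin k → N),
      (∀ i, b i ∈ B) ∧ φ.Realize (Sum.elim (fun _ => a) b) ∧
      { x : N | φ.Realize (Sum.elim (fun _ => x) b) }.Finite }

/-- The domain of the substructure of `N` generated by `B`: values of terms at
arguments from `B`. -/
def genSub (L : FirstOrder.Language) (N : Type) (SN : L.Structure N) (B : Set N) : Set N :=
  letI := SN
  { a : N | ∃ (t : L.Term ℕ) (v : ℕ → N), (∀ i, v i ∈ B) ∧ a = t.realize v }

/-- The set defined by a formula `φ(x, p̄)` in one free variable with parameters `p̄`. -/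
def smSet (L : FirstOrder.Language) (N : Type) (SN : L.Structure N) {k : ℕ}
    (φ : L.Formula (Fin 1 ⊕ Fin k)) (p : Fin k → N) : Set N :=
  letI := SN
  { x : N | φ.Realize (Sum.elim (fun _ => x) p) }

/-- A definable tuple-set in a coded structure, with parameters from `P`. -/
def DefinableOver (M : CodedStructure L) (P : Set ↥M.carrier) {n : ℕ}
    (X : Set (Fin n → ↥M.carrier)) : Prop :=
  DefinableOverT L ↥M.carrier M.struc P X

/-- A definable tuple-set in a coded structure, with arbitrary parameters. -/
def DefinableIn (M : CodedStructure L) {n : ℕ} (X : Set (Fin n → ↥M.carrier)) : Prop :=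
  DefinableOver M Set.univ X

/-! ## Isomorphisms of coded structures and `D`-categoricity -/

/-- An isomorphism of coded `L`-structures. -/
structure CodedIso (M N : CodedStructure L) where
  toFun : ↥M.carrier → ↥N.carrier
  invFun : ↥N.carrier → ↥M.carrier
  left_inv : Function.LeftInverse invFun toFun
  right_inv : Function.RightInverse invFun toFun
  map_fun : ∀ {k : ℕ} (f : L.Functions k) (v : Fin k → ↥M.carrier),
    toFun (M.struc.funMap f v) = N.struc.funMap f (toFun ∘ v)
  map_rel : ∀ {k : ℕ} (r : L.Relations k) (v : Fin k → ↥M.carrier),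
    M.struc.RelMap r v ↔ N.struc.RelMap r (toFun ∘ v)

/-- `f` is a `D`-preserving isomorphism, where `d` is a representative of the
arithmetic degree `D`. -/
def DPreserving (d : Set ℕ) {M N : CodedStructure L} (f : CodedIso M N) : Prop :=
  ArReducible (graphCode f.toFun) d ∧
  ArReducible (graphCode f.invFun) d ∧
  (∀ (n : ℕ) (X : Set (Fin n → ↥M.carrier)), DefinableIn M X →
      ArEquiv (tupleSetCode X) d →
      ArEquiv (tupleSetCode ((fun v => f.toFun ∘ v) '' X)) d) ∧
  (∀ (n : ℕ) (Y : Set (Fin n → ↥N.carrier)), DefinableIn N Y →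
      ArEquiv (tupleSetCode Y) d →
      ArEquiv (tupleSetCode ((fun v => f.invFun ∘ v) '' Y)) d)

/-- `T` is `D`-categorical, where `d` is a representative of the nonzero
arithmetic degree `D`. -/
def DCategorical (g : GoedelCoding L) (T : L.Theory) (d : Set ℕ) : Prop :=
  ∀ M₀ M₁ M₂ : CodedStructure L,
    ArithDecidable g M₀ → M₀.Models T →
    M₁.Models T → ArithExtendible g T M₁ →
    M₂.Models T → ArithExtendible g T M₂ →
    ElemSub M₀ M₁ → ElemSub M₀ M₂ →
    ArEquiv M₁.carrier d → ArEquiv M₂.carrier d →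
    ∃ f : CodedIso M₁ M₂, DPreserving d f ∧
      ∀ (x : ℕ) (hx : x ∈ M₀.carrier) (h₁ : x ∈ M₁.carrier),
        ((f.toFun ⟨x, h₁⟩ : ℕ)) = x

/-! ## Vaughtian pairs, prime models, strong minimality -/

/-- `T` has a Vaughtian pair. -/
def HasVaughtianPair (T : L.Theory) : Prop :=
  ∃ (N : Type) (SN : L.Structure N),
    ModelsT L T N SN ∧
    ∃ S : @FirstOrder.Language.ElementarySubstructure L N SN,
      ((S.toSubstructure : Set N) ≠ Set.univ ∧
      ∃ (k : ℕ) (φ : L.Formula (Fin 1 ⊕ Fin k)) (a : Fin k → N),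
        (∀ i, a i ∈ (S.toSubstructure : Set N)) ∧
        smSet L N SN φ a ⊆ (S.toSubstructure : Set N) ∧
        (smSet L N SN φ a).Infinite)

/-- A coded model of `T` is prime: it elementarily embeds into every model of `T`. -/
def PrimeModel (L : FirstOrder.Language) (T : L.Theory) (P : CodedStructure L) : Prop :=
  P.Models T ∧ ∀ (N : Type) (SN : L.Structure N), ModelsT L T N SN →
    Nonempty (EEmb L ↥P.carrier P.struc N SN)

/-- `φ(x, p̄)` is strongly minimal over the coded model `M`: its solution set in `M` is
infinite, and in every elementary extension of `M` modelling `T` every definable subset of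
its solution set is finite or cofinite in it. -/
def StronglyMinimalOver (T : L.Theory) (M : CodedStructure L) {k : ℕ}
    (φ : L.Formula (Fin 1 ⊕ Fin k)) (p : Fin k → ↥M.carrier) : Prop :=
  (smSet L ↥M.carrier M.struc φ p).Infinite ∧
  ∀ (N : Type) (SN : L.Structure N), ModelsT L T N SN →
    ∀ j : EEmb L ↥M.carrier M.struc N SN,
      ∀ Y : Set N, Definable1 L N SN Y →
        Y ⊆ smSet L N SN φ (fun i => j.fn (p i)) →
        (Y.Finite ∨ ((smSet L N SN φ (fun i => j.fn (p i))) \ Y).Finite)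

/-- `T` is a strongly minimal theory: every model is infinite, and every
parameter-definable subset of any model is finite or cofinite. -/
def StronglyMinimalTheory (L : FirstOrder.Language) (T : L.Theory) : Prop :=
  (∀ (N : Type) (SN : L.Structure N), ModelsT L T N SN → Infinite N) ∧
  (∀ (N : Type) (SN : L.Structure N), ModelsT L T N SN →
    ∀ Y : Set N, Definable1 L N SN Y → (Y.Finite ∨ (Yᶜ : Set N).Finite))

/-- The structural control clause: an arithmetically decidable prime model together with
a strongly minimal formula over it generating every elementary extension. -/
def GeneratesAll (T : L.Theory) (P : CodedStructure L) {k : ℕ}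
    (φ : L.Formula (Fin 1 ⊕ Fin k)) (p : Fin k → ↥P.carrier) : Prop :=
  ∀ (N : Type) (SN : L.Structure N), ModelsT L T N SN →
    ∀ j : EEmb L ↥P.carrier P.struc N SN,
      aclIn L N SN (Set.range j.fn ∪ smSet L N SN φ (fun i => j.fn (p i))) = Set.univ

/-- Clause (3) of the arithmetic Baldwin–Lachlan theorem. -/
def SMControl (g : GoedelCoding L) (T : L.Theory) : Prop :=
  ∃ (P : CodedStructure L), ArithDecidable g P ∧ PrimeModel L T P ∧
    ∃ (k : ℕ) (φ : L.Formula (Fin 1 ⊕ Fin k)) (p : Fin k → ↥P.carrier),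
      StronglyMinimalOver T P φ p ∧ GeneratesAll T P φ p

/-! ## Types and arithmetical stability -/

/-- A formula with a finite parameter tuple from a coded structure, in `n` object
variables. -/
def ParamFormula (L : FirstOrder.Language) (M : CodedStructure L) (n : ℕ) : Type :=
  Σ k : ℕ, L.Formula (Fin n ⊕ Fin k) × (Fin k → ↥M.carrier)

/-- All parameters of `q` lie in `A`. -/
def paramsIn {M : CodedStructure L} {n : ℕ} (A : Set ℕ) (q : ParamFormula L M n) : Prop :=
  ∀ i, ((q.2.2 i : ℕ)) ∈ A

/-- `p` is consistent with the elementary diagram of `M`: it is realized in some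
elementary extension of `M`. -/
def TypeConsistent (M : CodedStructure L) {n : ℕ} (p : Set (ParamFormula L M n)) : Prop :=
  ∃ (N : Type) (SN : L.Structure N) (j : EEmb L ↥M.carrier M.struc N SN) (b : Fin n → N),
    ∀ q ∈ p, letI := SN; q.2.1.Realize (Sum.elim b (fun i => j.fn (q.2.2 i)))

/-- `p` is a (complete) `n`-type over `A` inside `M`: a maximal set of formulas with
parameters from `A` consistent with the elementary diagram of `M`. -/
def IsNType (M : CodedStructure L) (A : Set ℕ) (n : ℕ)
    (p : Set (ParamFormula L M n)) : Prop :=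
  (∀ q ∈ p, paramsIn A q) ∧
  TypeConsistent M p ∧
  ∀ q : ParamFormula L M n, paramsIn A q → q ∉ p → ¬ TypeConsistent M (insert q p)

/-- The code of a formula-with-parameters. -/
def pfCode (g : GoedelCoding L) {M : CodedStructure L} {n : ℕ} (q : ParamFormula L M n) : ℕ :=
  Nat.pair
    (Nat.pair q.1 (formulaCode g
      (Sum.elim (fun i : Fin n => Nat.pair 0 i.1) (fun j : Fin q.1 => Nat.pair 1 j.1)) q.2.1))
    (tupleCode fun i => ((q.2.2 i : ℕ)))

/-- The set of codes of the formulas of `p`. -/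
def typeCode (g : GoedelCoding L) {M : CodedStructure L} {n : ℕ}
    (p : Set (ParamFormula L M n)) : Set ℕ :=
  { c | ∃ q ∈ p, c = pfCode g q }

/-- `p` is realized in the coded elementary extension `N` of `M`. -/
def RealizesType {M N : CodedStructure L} (h : M.carrier ⊆ N.carrier) {n : ℕ}
    (p : Set (ParamFormula L M n)) : Prop :=
  ∃ b : Fin n → ↥N.carrier, ∀ q ∈ p,
    letI := N.struc
    q.2.1.Realize (Sum.elim b (fun i => (⟨((q.2.2 i : ℕ)), h (q.2.2 i).2⟩ : ↥N.carrier)))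

/-- The `(n, i)`-th column of an effective join. -/
def tripleSection (X : Set ℕ) (n i : ℕ) : Set ℕ := { m | Nat.pair n (Nat.pair i m) ∈ X }

/-- `T` is arithmetically stable: over every arithmetically decidable model and every
arithmetical parameter set, the family of arithmetic `n`-types (for all `n ≥ 1`) has a
uniform arithmetical code in which every arithmetic `n`-type appears at least once. -/
def ArithStable (g : GoedelCoding L) (T : L.Theory) : Prop :=
  ∀ M : CodedStructure L, ArithDecidable g M → M.Models T →
    ∀ A : Set ℕ, A ⊆ M.carrier → IsArithmetical A →
      ∃ X : Set ℕ, IsArithmetical X ∧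
        (∀ n, 1 ≤ n → ∀ i : ℕ, ∃ p : Set (ParamFormula L M n),
            IsNType M A n p ∧ IsArithmetical (typeCode g p) ∧
            tripleSection X n i = typeCode g p) ∧
        (∀ n, 1 ≤ n → ∀ p : Set (ParamFormula L M n),
            IsNType M A n p → IsArithmetical (typeCode g p) →
            ∃ i : ℕ, tripleSection X n i = typeCode g p)

/-- The set of elements occurring as a coordinate of a tuple in `X`. -/
def coordSet {N : Type} {n : ℕ} (X : Set (Fin n → N)) : Set N :=
  { m | ∃ v ∈ X, ∃ i, v i = m }

/-! ## Definability in arithmetic -/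

/-- `p` is definable by a formula of arithmetic with oracle `Y`; the variables are indexed
by `ℕ`. -/
def Df (Y : Set ℕ) (p : (ℕ → ℕ) → Prop) : Prop :=
  letI := arithStructure Y
  ∃ φ : arithLang.Formula ℕ, ∀ v : ℕ → ℕ, φ.Realize v ↔ p v

/-- `f` is given by a term of arithmetic. -/
def Tm (f : (ℕ → ℕ) → ℕ) : Prop :=
  ∃ t : arithLang.Term ℕ, ∀ (Y : Set ℕ) (v : ℕ → ℕ),
    @Term.realize arithLang ℕ (arithStructure Y) ℕ v t = f v

theorem Tm.var (i : ℕ) : Tm fun v => v i := ⟨Term.var i, fun _ _ => rfl⟩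

theorem Tm.zero : Tm fun _ => 0 := ⟨Term.func ArFunc.zero ![], fun _ _ => rfl⟩

theorem Tm.one : Tm fun _ => 1 := ⟨Term.func ArFunc.one ![], fun _ _ => rfl⟩

theorem Tm.add {f g} (hf : Tm f) (hg : Tm g) : Tm fun v => f v + g v := by
  obtain ⟨s, hs⟩ := hf
  obtain ⟨t, ht⟩ := hg
  exact ⟨Term.func ArFunc.add ![s, t], fun Y v => congrArg₂ (· + ·) (hs Y v) (ht Y v)⟩

theorem Tm.mul {f g} (hf : Tm f) (hg : Tm g) : Tm fun v => f v * g v := by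
  obtain ⟨s, hs⟩ := hf
  obtain ⟨t, ht⟩ := hg
  exact ⟨Term.func ArFunc.mul ![s, t], fun Y v => congrArg₂ (· * ·) (hs Y v) (ht Y v)⟩

section
variable {Y : Set ℕ} {p q : (ℕ → ℕ) → Prop}

theorem Df.of_iff (hp : Df Y p) (h : ∀ v, q v ↔ p v) : Df Y q := by
  obtain rfl : q = p := funext fun v => propext (h v)
  exact hp

theorem Df.eq {f g} (hf : Tm f) (hg : Tm g) : Df Y fun v => f v = g v := by
  let _ := arithStructure Y
  obtain ⟨s, hs⟩ := hf
  obtain ⟨t, ht⟩ := hg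
  exact ⟨s.equal t, fun v => by rw [Formula.realize_equal, hs Y v, ht Y v]⟩

theorem Df.lt {f g} (hf : Tm f) (hg : Tm g) : Df Y fun v => f v < g v := by
  let _ := arithStructure Y
  obtain ⟨s, hs⟩ := hf
  obtain ⟨t, ht⟩ := hg
  refine ⟨Relations.formula (L := arithLang) ArRel.lt ![s, t], fun v => ?_⟩
  refine (Formula.realize_rel (L := arithLang) (R := (ArRel.lt : arithLang.Relations 2))).trans ?_
  change s.realize v < t.realize v ↔ _
  rw [hs Y v, ht Y v]

theorem Df.not (hp : Df Y p) : Df Y fun v => ¬ p v := by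
  let _ := arithStructure Y
  obtain ⟨φ, hφ⟩ := hp
  exact ⟨φ.not, fun v => by rw [Formula.realize_not, hφ v]⟩

theorem Df.and (hp : Df Y p) (hq : Df Y q) : Df Y fun v => p v ∧ q v := by
  let _ := arithStructure Y
  obtain ⟨φ, hφ⟩ := hp
  obtain ⟨ψ, hψ⟩ := hq
  exact ⟨φ ⊓ ψ, fun v => by rw [Formula.realize_inf, hφ v, hψ v]⟩

theorem Df.or (hp : Df Y p) (hq : Df Y q) : Df Y fun v => p v ∨ q v :=
  (hp.not.and hq.not).not.of_iff fun v => by tauto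

theorem Df.imp (hp : Df Y p) (hq : Df Y q) : Df Y fun v => p v → q v :=
  (hp.not.or hq).of_iff fun v => by tauto

/-- Existential quantification, using `k` as a fresh variable. -/
theorem Df.ex (k : ℕ) {p : (ℕ → ℕ) → ℕ → Prop} (h : Df Y fun v => p v (v k))
    (hk : ∀ v x y, p (Function.update v k x) y ↔ p v y) : Df Y fun v => ∃ x, p v x := by
  let _ := arithStructure Y
  obtain ⟨φ, hφ⟩ := h
  let ρ : ℕ → ℕ ⊕ Fin 1 := fun i => if i = k then Sum.inr 0 else Sum.inl i
  refine ⟨(BoundedFormula.relabel ρ φ : arithLang.BoundedFormula ℕ 1).ex, fun v => ?_⟩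
  rw [Formula.Realize, BoundedFormula.realize_ex]
  refine exists_congr fun x => ?_
  rw [BoundedFormula.realize_relabel, ← hk v x x]
  have h1 := hφ (Function.update v k x)
  simp only [Function.update_self] at h1
  rw [← h1, Formula.Realize]
  have e : (Sum.elim v (Fin.snoc (default : Fin 0 → ℕ) x ∘ Fin.castAdd 0) ∘ ρ) =
      Function.update v k x := by
    funext i
    by_cases hi : i = k
    · subst hi
      simp [ρ, Fin.snoc]
    · simp [ρ, hi]
  rw [← e]
  exact iff_of_eq (congrArg _ (Subsingleton.elim _ _))

theorem Df.all (k : ℕ) {p : (ℕ → ℕ) → ℕ → Prop} (h : Df Y fun v => p v (v k))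
    (hk : ∀ v x y, p (Function.update v k x) y ↔ p v y) : Df Y fun v => ∀ x, p v x :=
  (Df.ex k (p := fun v x => ¬ p v x) h.not fun v x y => not_congr (hk v x y)).not.of_iff fun v => by simp

theorem Df.comp (σ : ℕ → ℕ) (hp : Df Y p) : Df Y fun v => p fun i => v (σ i) := by
  let _ := arithStructure Y
  obtain ⟨φ, hφ⟩ := hp
  exact ⟨φ.relabel σ, fun v => by rw [Formula.realize_relabel, hφ]; rfl⟩

theorem df_iff_arReducible {X : Set ℕ} : (Df Y fun v => v 0 ∈ X) ↔ ArReducible X Y := by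
  let _ := arithStructure Y
  constructor
  · rintro ⟨φ, hφ⟩
    refine ⟨φ.relabel fun _ => 0, ?_⟩
    ext n
    simp only [Set.mem_ofPred_eq, Formula.realize_relabel]
    exact (hφ fun _ => n).symm
  · rintro ⟨φ, rfl⟩
    exact ⟨φ.relabel fun _ => 0, fun v => by rw [Formula.realize_relabel]; rfl⟩

theorem Df.pair (i j k : ℕ) : Df Y fun v => Nat.pair (v i) (v j) = v k := by
  refine (((Df.lt (.var i) (.var j)).and
    (Df.eq (((Tm.var j).mul (.var j)).add (.var i)) (.var k))).or
    ((Df.lt (.var i) (.var j)).not.and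
    (Df.eq ((((Tm.var i).mul (.var i)).add (.var i)).add (.var j)) (.var k)))).of_iff fun v => ?_
  rw [Nat.pair]
  split_ifs with h <;> simp [h]

theorem Df.beta : Df Y fun v => Nat.beta (v 0) (v 1) = v 2 := by
  have key : Df Y fun v => ∃ x, ∃ y, Nat.pair x y = v 0 ∧ v 2 < (v 1 + 1) * y + 1 ∧
      ∃ q, x = ((v 1 + 1) * y + 1) * q + v 2 := by
    refine Df.ex 3 (Df.ex 4 ((Df.pair 3 4 0).and ((Df.lt (.var 2)
      ((((Tm.var 1).add .one).mul (.var 4)).add .one)).and (Df.ex 5 (Df.eq (.var 3)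
      ((((((Tm.var 1).add .one).mul (.var 4)).add .one).mul (.var 5)).add (.var 2))) ?_))) ?_) ?_
    all_goals intro v x y; simp
  refine key.of_iff fun v => ?_
  rw [Nat.beta]
  constructor
  · intro h
    refine ⟨(v 0).unpair.1, (v 0).unpair.2, Nat.pair_unpair _, ?_,
      (v 0).unpair.1 / ((v 1 + 1) * (v 0).unpair.2 + 1), ?_⟩
    · rw [← h]
      exact Nat.mod_lt _ (Nat.succ_pos _)
    · rw [← h]
      exact (Nat.div_add_mod _ _).symm
  · rintro ⟨x, y, h0, hlt, q, rfl⟩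
    rw [← h0, Nat.unpair_pair]
    simp only
    rw [Nat.mul_add_mod, Nat.mod_eq_of_lt hlt]

theorem Df.comp₂ {r : ℕ → ℕ → Prop} (h : Df Y fun v => r (v 0) (v 1)) (i j : ℕ) :
    Df Y fun v => r (v i) (v j) :=
  h.comp fun k => if k = 0 then i else j

theorem Df.beta' (i j k : ℕ) : Df Y fun v => Nat.beta (v i) (v j) = v k :=
  Df.beta.comp fun l => if l = 0 then i else if l = 1 then j else k

/-- Graphs of primitive recursive functions are definable in arithmetic. -/
theorem Df.primrec {f : ℕ → ℕ} (hf : Nat.Primrec f) : Df Y fun v => f (v 0) = v 1 := by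
  induction hf with
  | zero => exact Df.eq .zero (.var 1)
  | succ => exact Df.eq ((Tm.var 0).add .one) (.var 1)
  | left =>
    have : Df Y fun v => ∃ x, Nat.pair (v 1) x = v 0 := by
      refine Df.ex 2 (Df.pair 1 2 0) ?_
      intro v x y; simp
    refine this.of_iff fun v => ⟨fun h => ⟨(v 0).unpair.2, ?_⟩, ?_⟩
    · rw [← h, Nat.pair_unpair]
    · rintro ⟨x, h⟩
      simp [← h]
  | right =>
    have : Df Y fun v => ∃ x, Nat.pair x (v 1) = v 0 := by
      refine Df.ex 2 (Df.pair 2 1 0) ?_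
      intro v x y; simp
    refine this.of_iff fun v => ⟨fun h => ⟨(v 0).unpair.1, ?_⟩, ?_⟩
    · rw [← h, Nat.pair_unpair]
    · rintro ⟨x, h⟩
      simp [← h]
  | @pair f g _ _ ihf ihg =>
    have : Df Y fun v => ∃ x, ∃ y, f (v 0) = x ∧ g (v 0) = y ∧ Nat.pair x y = v 1 := by
      refine Df.ex 2 (Df.ex 3 ((ihf.comp₂ (r := fun x y => f x = y) 0 2).and
        ((ihg.comp₂ (r := fun x y => g x = y) 0 3).and (Df.pair 2 3 1))) ?_) ?_
      all_goals intro v x y; simp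
    exact this.of_iff fun v => by simp
  | @comp f g _ _ ihf ihg =>
    have : Df Y fun v => ∃ x, g (v 0) = x ∧ f x = v 1 := by
      refine Df.ex 2 ((ihg.comp₂ (r := fun x y => g x = y) 0 2).and
        (ihf.comp₂ (r := fun x y => f x = y) 2 1)) ?_
      intro v x y; simp
    exact this.of_iff fun v => by simp
  | @prec f g _ _ ihf ihg =>
    have : Df Y fun v => ∃ a, ∃ n, ∃ s, Nat.pair a n = v 0 ∧
        (∃ o, ∃ w, o = 0 ∧ Nat.beta s o = w ∧ f a = w) ∧
        (∀ i, i < n → ∃ j, ∃ w, ∃ w', ∃ u, ∃ u', j = i + 1 ∧ Nat.beta s i = w ∧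
          Nat.beta s j = w' ∧ Nat.pair i w = u ∧ Nat.pair a u = u' ∧ g u' = w') ∧
        Nat.beta s n = v 1 := by
      refine Df.ex 2 (Df.ex 3 (Df.ex 4 ((Df.pair 2 3 0).and (Df.and
        (Df.ex 5 (Df.ex 6 ((Df.eq (.var 5) .zero).and ((Df.beta' 4 5 6).and
          (ihf.comp₂ (r := fun x y => f x = y) 2 6))) ?_) ?_)
        (Df.and (Df.all 5 (Df.imp (Df.lt (.var 5) (.var 3))
          (Df.ex 6 (Df.ex 7 (Df.ex 8 (Df.ex 9 (Df.ex 10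
            ((Df.eq (.var 6) ((Tm.var 5).add .one)).and ((Df.beta' 4 5 7).and
            ((Df.beta' 4 6 8).and ((Df.pair 5 7 9).and ((Df.pair 2 9 10).and
            (ihg.comp₂ (r := fun x y => g x = y) 10 8)))))) ?_) ?_) ?_) ?_) ?_)) ?_)
          (Df.beta' 4 3 1)))) ?_) ?_) ?_
      all_goals intro v x y; simp
    refine this.of_iff fun v => ?_
    constructor
    · intro h
      set a := (v 0).unpair.1 with ha
      set n := (v 0).unpair.2 with hn
      let F : ℕ → ℕ := fun m => Nat.rec (f a) (fun y IH => g (Nat.pair a (Nat.pair y IH))) m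
      let l := (List.range (n + 1)).map F
      have hl : ∀ i ≤ n, Nat.beta (Nat.unbeta l) i = F i := by
        intro i hi
        have hi' : i < l.length := by simp [l]; omega
        have := Nat.beta_unbeta_coe l ⟨i, hi'⟩
        simpa [l] using this
      refine ⟨a, n, Nat.unbeta l, Nat.pair_unpair _, ⟨0, _, rfl, rfl, ?_⟩, ?_, ?_⟩
      · rw [hl 0 (Nat.zero_le _)]
        rfl
      · intro i hi
        refine ⟨i + 1, _, _, _, _, rfl, rfl, rfl, rfl, rfl, ?_⟩
        rw [hl i hi.le, hl (i + 1) hi]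
      · rw [hl n le_rfl, ← h]
    · rintro ⟨a, n, s, h0, ⟨_, w, rfl, hw, hf⟩, hs, hv⟩
      rw [← h0, ← hv]
      simp only [Nat.unpaired, Nat.unpair_pair]
      have : ∀ m ≤ n, Nat.rec (f a) (fun y IH => g (Nat.pair a (Nat.pair y IH))) m =
          Nat.beta s m := by
        intro m
        induction m with
        | zero =>
          intro _
          rw [hw]
          exact hf
        | succ m ih =>
          intro hm
          obtain ⟨_, _, _, _, _, rfl, rfl, rfl, rfl, rfl, h⟩ := hs m hm
          rw [← h]
          simp only
          rw [ih (by omega)]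
      exact this n le_rfl

/-- An arithmetical set is reducible to every set. -/
theorem IsArithmetical.reducible {X : Set ℕ} (hX : IsArithmetical X) (Y : Set ℕ) :
    ArReducible X Y := by
  have key : ∀ {n : ℕ} (φ : arithLang.BoundedFormula (Fin 1) n),
      ∃ ψ : arithLang.BoundedFormula (Fin 1) n, ∀ v xs,
        @BoundedFormula.Realize _ _ (arithStructure ∅) _ _ φ v xs ↔
        @BoundedFormula.Realize _ _ (arithStructure Y) _ _ ψ v xs := by
    intro n φ
    have ht : ∀ {n} (t : arithLang.Term (Fin 1 ⊕ Fin n)) (v),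
        @Term.realize _ _ (arithStructure ∅) _ v t = @Term.realize _ _ (arithStructure Y) _ v t := by
      intro n t v
      induction t with
      | var => rfl
      | func f ts ih => exact congrArg (@Structure.funMap _ _ (arithStructure Y) _ f) (funext ih)
    induction φ with
    | falsum => exact ⟨.falsum, fun _ _ => Iff.rfl⟩
    | equal t s =>
      refine ⟨.equal t s, fun v xs => ?_⟩
      simp only [BoundedFormula.Realize, ht]
    | @rel n l R ts =>
      cases R with
      | lt =>
        refine ⟨.rel (L := arithLang) ArRel.lt ts, fun v xs => ?_⟩
        simp only [BoundedFormula.Realize, ht]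
        rfl
      | mem => exact ⟨.falsum, fun _ _ => Iff.rfl⟩
    | imp _ _ ih₁ ih₂ =>
      obtain ⟨ψ₁, h₁⟩ := ih₁
      obtain ⟨ψ₂, h₂⟩ := ih₂
      exact ⟨ψ₁.imp ψ₂, fun v xs => imp_congr (h₁ v xs) (h₂ v xs)⟩
    | all _ ih =>
      obtain ⟨ψ, h⟩ := ih
      exact ⟨ψ.all, fun v xs => forall_congr' fun a => h v _⟩
  obtain ⟨φ, rfl⟩ := hX
  obtain ⟨ψ, hψ⟩ := key φ
  refine ⟨ψ, ?_⟩
  ext n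
  exact hψ _ _

end

/-! ## Arithmetical functions and predicates on encoded types -/

noncomputable instance : Primcodable Prop := Primcodable.ofEquiv Bool Equiv.propEquivBool

theorem encode_prop_eq_one {p : Prop} : Encodable.encode p = 1 ↔ p := by
  change Encodable.encode (Equiv.propEquivBool p) = 1 ↔ p
  by_cases h : p <;> simp [Equiv.propEquivBool, h]

theorem encode_prop_eq_zero {p : Prop} : Encodable.encode p = 0 ↔ ¬ p := by
  change Encodable.encode (Equiv.propEquivBool p) = 0 ↔ ¬ p
  by_cases h : p <;> simp [Equiv.propEquivBool, h]

/-- `f` is arithmetical relative to `Y`: the graph of `f` on codes is definable in arithmetic with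
oracle `Y`. A predicate is regarded as a function to `Prop`. -/
@[fun_prop]
def AFun (Y : Set ℕ) {α β : Type*} [Primcodable α] [Primcodable β] (f : α → β) : Prop :=
  Df Y fun v => ∃ a, Encodable.encode a = v 0 ∧ Encodable.encode (f a) = v 1

section
variable {Y : Set ℕ} {α β γ δ : Type*} [Primcodable α] [Primcodable β] [Primcodable γ]
  [Primcodable δ]

theorem AFun.of_primrec {f : α → β} (hf : Primrec f) : AFun Y f := by
  have h1 : Primrec fun n => Encodable.encode ((Encodable.decode₂ α n).map f) :=
    Primrec.encode.comp (Primrec.option_map Primrec.decode₂ (hf.comp Primrec.snd).to₂)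
  have h2 : Df Y fun v => ∃ x,
      Encodable.encode ((Encodable.decode₂ α (v 0)).map f) = x ∧ x = v 1 + 1 := by
    refine Df.ex 2 (((Df.primrec (Primrec.nat_iff.1 h1)).comp₂ (r := fun n x =>
      Encodable.encode ((Encodable.decode₂ α n).map f) = x) 0 2).and
      (Df.eq (.var 2) ((Tm.var 1).add .one))) ?_
    intro v x y; simp
  refine h2.of_iff fun v => ?_
  simp only [exists_eq_left']
  constructor
  · rintro ⟨a, h, h'⟩
    rw [Encodable.mem_decode₂.2 h]
    simp [h']
  · intro h
    cases h0 : Encodable.decode₂ α (v 0) with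
    | none => simp [h0] at h
    | some a =>
      refine ⟨a, Encodable.mem_decode₂.1 h0, ?_⟩
      simpa [h0] using h

theorem AFun.graph₂ {f : α → β} (hf : AFun Y f) (i j : ℕ) :
    Df Y fun v => ∃ a, Encodable.encode a = v i ∧ Encodable.encode (f a) = v j :=
  Df.comp₂ (r := fun x y => ∃ a, Encodable.encode a = x ∧ Encodable.encode (f a) = y) hf i j

@[fun_prop]
theorem AFun.comp {f : β → γ} {g : α → β} (hf : AFun Y f) (hg : AFun Y g) :
    AFun Y fun x => f (g x) := by
  have : Df Y fun v => ∃ x, (∃ a, Encodable.encode a = v 0 ∧ Encodable.encode (g a) = x) ∧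
      ∃ b, Encodable.encode b = x ∧ Encodable.encode (f b) = v 1 := by
    refine Df.ex 2 ((hg.graph₂ 0 2).and (hf.graph₂ 2 1)) ?_
    intro v x y; simp
  refine this.of_iff fun v => ?_
  constructor
  · rintro ⟨a, h, h'⟩
    exact ⟨_, ⟨a, h, rfl⟩, _, rfl, h'⟩
  · rintro ⟨x, ⟨a, h, rfl⟩, b, h1, h2⟩
    obtain rfl := Encodable.encode_injective h1
    exact ⟨a, h, h2⟩

@[fun_prop]
theorem AFun.id : AFun Y fun x : α => x := .of_primrec .id

@[fun_prop]
theorem AFun.const (b : β) : AFun Y fun _ : α => b := .of_primrec (.const b)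

@[fun_prop]
theorem AFun.fst {f : α → β × γ} (hf : AFun Y f) : AFun Y fun x => (f x).1 :=
  AFun.comp (.of_primrec .fst) hf

@[fun_prop]
theorem AFun.snd {f : α → β × γ} (hf : AFun Y f) : AFun Y fun x => (f x).2 :=
  AFun.comp (.of_primrec .snd) hf

@[fun_prop]
theorem AFun.prodMk {f : α → β} {g : α → γ} (hf : AFun Y f) (hg : AFun Y g) :
    AFun Y fun x => (f x, g x) := by
  have : Df Y fun v => ∃ x, ∃ y, (∃ a, Encodable.encode a = v 0 ∧ Encodable.encode (f a) = x) ∧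
      (∃ a, Encodable.encode a = v 0 ∧ Encodable.encode (g a) = y) ∧ Nat.pair x y = v 1 := by
    refine Df.ex 2 (Df.ex 3 ((hf.graph₂ 0 2).and ((hg.graph₂ 0 3).and (Df.pair 2 3 1))) ?_) ?_
    all_goals intro v x y; simp
  refine this.of_iff fun v => ?_
  constructor
  · rintro ⟨a, h, h'⟩
    exact ⟨_, _, ⟨a, h, rfl⟩, ⟨a, h, rfl⟩, h'⟩
  · rintro ⟨_, _, ⟨a, h, rfl⟩, ⟨b, hb, rfl⟩, h2⟩
    obtain rfl := Encodable.encode_injective (h.trans hb.symm)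
    exact ⟨a, h, h2⟩

theorem AFun.comp₂ {f : β → γ → δ} {g : α → β} {h : α → γ}
    (hf : AFun Y fun x : β × γ => f x.1 x.2) (hg : AFun Y g) (hh : AFun Y h) :
    AFun Y fun x => f (g x) (h x) :=
  hf.comp (hg.prodMk hh)

theorem AFun.primrec₂ {f : β → γ → δ} {g : α → β} {h : α → γ}
    (hf : Primrec₂ f) (hg : AFun Y g) (hh : AFun Y h) : AFun Y fun x => f (g x) (h x) :=
  AFun.comp₂ (.of_primrec hf) hg hh

theorem AFun.df {p : α → Prop} (hp : AFun Y p) :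
    Df Y fun v => ∃ a, Encodable.encode a = v 0 ∧ p a := by
  have : Df Y fun v => ∃ x, (∃ a, Encodable.encode a = v 0 ∧ Encodable.encode (p a) = x) ∧
      x = 1 := by
    refine Df.ex 2 ((hp.graph₂ 0 2).and (Df.eq (.var 2) .one)) ?_
    intro v x y; simp
  refine this.of_iff fun v => ?_
  constructor
  · rintro ⟨a, h, h'⟩
    exact ⟨1, ⟨a, h, encode_prop_eq_one.2 h'⟩, rfl⟩
  · rintro ⟨_, ⟨a, h, h'⟩, rfl⟩
    exact ⟨a, h, encode_prop_eq_one.1 h'⟩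

theorem AFun.of_df {p : α → Prop} (hp : Df Y fun v => ∃ a, Encodable.encode a = v 0 ∧ p a) :
    AFun Y p := by
  have hd : Df Y fun v => ∃ a : α, Encodable.encode a = v 0 ∧ True := by
    have := (AFun.const (Y := Y) (α := α) True).df
    exact this
  have : Df Y fun v => ((∃ a, Encodable.encode a = v 0 ∧ p a) ∧ v 1 = 1) ∨
      ((∃ a : α, Encodable.encode a = v 0 ∧ True) ∧ ¬ (∃ a, Encodable.encode a = v 0 ∧ p a) ∧
        v 1 = 0) :=
    (hp.and (Df.eq (.var 1) .one)).or (hd.and (hp.not.and (Df.eq (.var 1) .zero)))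
  refine this.of_iff fun v => ?_
  constructor
  · rintro ⟨a, h, h'⟩
    by_cases hpa : p a
    · exact Or.inl ⟨⟨a, h, hpa⟩, by rw [← h', encode_prop_eq_one.2 hpa]⟩
    · refine Or.inr ⟨⟨a, h, trivial⟩, ?_, by rw [← h', encode_prop_eq_zero.2 hpa]⟩
      rintro ⟨b, hb, hpb⟩
      obtain rfl := Encodable.encode_injective (h.trans hb.symm)
      exact hpa hpb
  · rintro (⟨⟨a, h, hpa⟩, h1⟩ | ⟨⟨a, h, -⟩, hn, h0⟩)
    · exact ⟨a, h, by rw [h1, encode_prop_eq_one.2 hpa]⟩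
    · exact ⟨a, h, by rw [h0, encode_prop_eq_zero.2 fun hpa => hn ⟨a, h, hpa⟩]⟩

theorem aFun_mem_iff {X : Set ℕ} : (AFun Y fun n => n ∈ X) ↔ ArReducible X Y := by
  rw [← df_iff_arReducible]
  constructor <;> intro h
  · exact h.df.of_iff fun v => by simp
  · exact AFun.of_df (h.of_iff fun v => by simp)

@[fun_prop]
theorem AFun.not {p : α → Prop} (hp : AFun Y p) : AFun Y fun x => ¬ p x :=
  AFun.comp (f := Not) (.of_primrec (Primrec.dom_finite _)) hp

@[fun_prop]
theorem AFun.and {p q : α → Prop} (hp : AFun Y p) (hq : AFun Y q) : AFun Y fun x => p x ∧ q x :=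
  AFun.comp (f := fun x : Prop × Prop => x.1 ∧ x.2) (.of_primrec (Primrec.dom_finite _))
    (hp.prodMk hq)

@[fun_prop]
theorem AFun.or {p q : α → Prop} (hp : AFun Y p) (hq : AFun Y q) : AFun Y fun x => p x ∨ q x :=
  AFun.comp (f := fun x : Prop × Prop => x.1 ∨ x.2) (.of_primrec (Primrec.dom_finite _))
    (hp.prodMk hq)

@[fun_prop]
theorem AFun.iff {p q : α → Prop} (hp : AFun Y p) (hq : AFun Y q) :
    AFun Y fun x => p x ↔ q x :=
  AFun.comp (f := fun x : Prop × Prop => (x.1 ↔ x.2)) (.of_primrec (Primrec.dom_finite _))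
    (hp.prodMk hq)

@[fun_prop]
theorem AFun.exists {p : α → β → Prop} (hp : AFun Y fun x : α × β => p x.1 x.2) :
    AFun Y fun x => ∃ y, p x y := by
  refine AFun.of_df ?_
  have : Df Y fun v => ∃ y, ∃ z, Nat.pair (v 0) y = z ∧
      ∃ x : α × β, Encodable.encode x = z ∧ p x.1 x.2 := by
    refine Df.ex 1 (Df.ex 2 ((Df.pair 0 1 2).and
      (hp.df.comp fun _ => 2)) ?_) ?_
    all_goals intro v x y; simp
  refine this.of_iff fun v => ?_
  constructor
  · rintro ⟨a, h, b, hp⟩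
    exact ⟨_, _, rfl, (a, b), by rw [Encodable.encode_prod_val, h], hp⟩
  · rintro ⟨y, _, rfl, ⟨a, b⟩, h, hp⟩
    rw [Encodable.encode_prod_val, Nat.pair_eq_pair] at h
    exact ⟨a, h.1, b, hp⟩

@[fun_prop]
theorem AFun.eq {f g : α → β} (hf : AFun Y f) (hg : AFun Y g) : AFun Y fun x => f x = g x := by
  classical
  have h : AFun Y fun x : β × β => (decide (x.1 = x.2) = true) :=
    AFun.comp (f := fun b : Bool => b = true) (.of_primrec (Primrec.dom_finite _))
      (.of_primrec (Primrec.eq (α := β)).decide)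
  have := h.comp (hf.prodMk hg)
  simpa using this

theorem AFun.of_rel {r : β → γ → Prop} {f : α → β} {g : α → γ} (hr : PrimrecRel r)
    (hf : AFun Y f) (hg : AFun Y g) : AFun Y fun x => r (f x) (g x) := by
  classical
  have h : AFun Y fun x : β × γ => (decide (r x.1 x.2) = true) :=
    AFun.comp (f := fun b : Bool => b = true) (.of_primrec (Primrec.dom_finite _))
      (.of_primrec hr.decide)
  have := h.comp (hf.prodMk hg)
  simpa using this

theorem AFun.of_graph {f : α → β} (hf : AFun Y fun x : α × β => f x.1 = x.2) : AFun Y f := by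
  have : Df Y fun v => ∃ z, Nat.pair (v 0) (v 1) = z ∧
      ∃ x : α × β, Encodable.encode x = z ∧ f x.1 = x.2 := by
    refine Df.ex 2 ((Df.pair 0 1 2).and (hf.df.comp fun _ => 2)) ?_
    intro v x y; simp
  refine this.of_iff fun v => ?_
  constructor
  · rintro ⟨a, h, h'⟩
    exact ⟨_, rfl, (a, f a), by rw [Encodable.encode_prod_val, h, h'], rfl⟩
  · rintro ⟨_, rfl, ⟨a, b⟩, h, hp⟩
    rw [Encodable.encode_prod_val, Nat.pair_eq_pair] at h
    simp only at h hp
    exact ⟨a, h.1, by rw [hp, h.2]⟩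

theorem AFun.of_graph_iff {f : α → β} {p : α × β → Prop} (hp : AFun Y p)
    (h : ∀ a b, f a = b ↔ p (a, b)) : AFun Y f := by
  refine AFun.of_graph ?_
  simpa only [h] using hp

@[fun_prop]
theorem AFun.natPair {f g : α → ℕ} (hf : AFun Y f) (hg : AFun Y g) :
    AFun Y fun x => Nat.pair (f x) (g x) := .primrec₂ Primrec₂.natPair hf hg

@[fun_prop]
theorem AFun.add {f g : α → ℕ} (hf : AFun Y f) (hg : AFun Y g) :
    AFun Y fun x => f x + g x := .primrec₂ Primrec.nat_add hf hg

@[fun_prop]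
theorem AFun.mul {f g : α → ℕ} (hf : AFun Y f) (hg : AFun Y g) :
    AFun Y fun x => f x * g x := .primrec₂ Primrec.nat_mul hf hg

@[fun_prop]
theorem AFun.lt {f g : α → ℕ} (hf : AFun Y f) (hg : AFun Y g) :
    AFun Y fun x => f x < g x := .of_rel Primrec.nat_lt hf hg

@[fun_prop]
theorem AFun.encode {f : α → β} (hf : AFun Y f) : AFun Y fun x => Encodable.encode (f x) :=
  AFun.comp (.of_primrec .encode) hf

@[fun_prop]
theorem AFun.some {f : α → β} (hf : AFun Y f) : AFun Y fun x => Option.some (f x) :=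
  AFun.comp (.of_primrec .option_some) hf

@[fun_prop]
theorem AFun.cons {f : α → β} {g : α → List β} (hf : AFun Y f) (hg : AFun Y g) :
    AFun Y fun x => f x :: g x := .primrec₂ Primrec.list_cons hf hg

@[fun_prop]
theorem AFun.append {f g : α → List β} (hf : AFun Y f) (hg : AFun Y g) :
    AFun Y fun x => f x ++ g x := .primrec₂ Primrec.list_append hf hg

@[fun_prop]
theorem AFun.length {f : α → List β} (hf : AFun Y f) : AFun Y fun x => (f x).length :=
  AFun.comp (.of_primrec .list_length) hf

@[fun_prop]
theorem AFun.flatten {f : α → List (List β)} (hf : AFun Y f) : AFun Y fun x => (f x).flatten :=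
  AFun.comp (.of_primrec .list_flatten) hf

@[fun_prop]
theorem AFun.getElem? {f : α → List β} {g : α → ℕ} (hf : AFun Y f) (hg : AFun Y g) :
    AFun Y fun x => (f x)[g x]? := .primrec₂ Primrec.list_getElem? hf hg

@[fun_prop]
theorem AFun.mem {f : α → β} {g : α → List β} (hf : AFun Y f) (hg : AFun Y g) :
    AFun Y fun x => f x ∈ g x := by
  have : AFun Y fun x => ∃ s t, g x = s ++ f x :: t := by fun_prop
  simpa only [List.mem_iff_append] using this

@[fun_prop]
theorem AFun.map {f : α → List β} {g : α → β → γ} (hf : AFun Y f)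
    (hg : AFun Y fun x : α × β => g x.1 x.2) : AFun Y fun x => (f x).map (g x) := by
  have h1 : AFun Y fun x : α × List γ => ((f x.1).length = x.2.length ∧
      ¬ ∃ (i : ℕ) (b : β) (c : γ), (f x.1)[i]? = Option.some b ∧ x.2[i]? = Option.some c ∧ ¬ g x.1 b = c) := by
    fun_prop
  refine AFun.of_graph_iff h1 fun a l => ?_
  constructor
  · rintro rfl
    refine ⟨by simp, ?_⟩
    rintro ⟨i, b, c, hb, hc, hne⟩
    rw [List.getElem?_map, hb] at hc
    exact hne (by simpa using hc)
  · rintro ⟨hl, h⟩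
    push Not at h
    refine List.ext_getElem (by simpa using hl) fun i h1 h2 => ?_
    rw [List.getElem_map]
    exact h i _ _ (List.getElem?_eq_getElem _) (List.getElem?_eq_getElem _)

/-- The least element of an arithmetical family of sets of natural numbers. -/
@[fun_prop]
theorem AFun.sInf {p : α → ℕ → Prop} (hp : AFun Y fun x : α × ℕ => p x.1 x.2) :
    AFun Y fun x => sInf {n | p x n} := by
  have h1 : AFun Y fun x : α × ℕ => ((p x.1 x.2 ∧ ¬ ∃ m, m < x.2 ∧ p x.1 m) ∨
      ((¬ ∃ m, p x.1 m) ∧ x.2 = 0)) := by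
    have : AFun Y fun y : (α × ℕ) × ℕ => p y.1.1 y.2 :=
      AFun.comp₂ (f := p) hp (by fun_prop) (by fun_prop)
    fun_prop
  refine AFun.of_graph_iff h1 fun a n => ?_
  by_cases he : ∃ m, p a m
  · have hne : {n | p a n}.Nonempty := he
    constructor
    · rintro rfl
      exact Or.inl ⟨Nat.sInf_mem hne, fun ⟨m, hm, hpm⟩ => Nat.notMem_of_lt_sInf hm hpm⟩
    · rintro (⟨h1, h2⟩ | ⟨h1, -⟩)
      · refine le_antisymm (Nat.sInf_le h1) (not_lt.1 fun hlt => h2 ⟨_, hlt, Nat.sInf_mem hne⟩)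
      · exact absurd he h1
  · have : {n | p a n} = ∅ := by
      ext m
      simpa using fun h => he ⟨m, h⟩
    rw [this, Nat.sInf_empty]
    constructor
    · rintro rfl
      exact Or.inr ⟨he, rfl⟩
    · rintro (⟨h1, h2⟩ | ⟨h1, h⟩)
      · exact absurd ⟨_, h1⟩ he
      · exact h.symm

open Classical in
@[fun_prop]
theorem AFun.ite {p : α → Prop} {f g : α → β} (hp : AFun Y p) (hf : AFun Y f) (hg : AFun Y g) :
    AFun Y fun x => if p x then f x else g x := by
  have h1 : AFun Y fun x : α × β => (p x.1 ∧ f x.1 = x.2) ∨ (¬ p x.1 ∧ g x.1 = x.2) := by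
    fun_prop
  refine AFun.of_graph_iff h1 fun a b => ?_
  by_cases h : p a <;> simp [h]

end

section
variable {Y : Set ℕ} {α β : Type*} [Primcodable α] [Primcodable β]

/-! ### Inductive definitions -/

/-- The least predicate closed under the rules `Rule a l b` (from all of `l`, infer `b`). -/
inductive Closure {α β : Type*} (Rule : α → List β → β → Prop) (a : α) : β → Prop
  | intro (l : List β) (b : β) : Rule a l b → (∀ z ∈ l, Closure Rule a z) → Closure Rule a b

/-- A list each of whose members is inferred from later members. -/
def Derivation {β : Type*} (R : List β → β → Prop) : List β → Prop
  | [] => True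
  | x :: L => (∃ l, R l x ∧ ∀ z ∈ l, z ∈ L) ∧ Derivation R L

theorem derivation_iff {β : Type*} {R : List β → β → Prop} {L : List β} :
    Derivation R L ↔ ∀ L₁ x L₂, L = L₁ ++ x :: L₂ → ∃ l, R l x ∧ ∀ z ∈ l, z ∈ L₂ := by
  induction L with
  | nil => simp [Derivation]
  | cons y L ih =>
    simp only [Derivation, ih]
    constructor
    · rintro ⟨h, h'⟩ (_ | ⟨z, L₁⟩) x L₂ he
      · simp only [List.nil_append, List.cons.injEq] at he
        obtain ⟨rfl, rfl⟩ := he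
        exact h
      · simp only [List.cons_append, List.cons.injEq] at he
        exact h' _ _ _ he.2
    · intro h
      exact ⟨h [] y L rfl, fun L₁ x L₂ he => h (y :: L₁) x L₂ (by rw [he]; rfl)⟩

theorem Derivation.append {β : Type*} {R : List β → β → Prop} {L L' : List β}
    (h : Derivation R L) (h' : Derivation R L') : Derivation R (L ++ L') := by
  induction L with
  | nil => exact h'
  | cons x L ih =>
    obtain ⟨⟨l, hl, hz⟩, h⟩ := h
    exact ⟨⟨l, hl, fun z hzl => List.mem_append_left _ (hz z hzl)⟩, ih h⟩

theorem closure_iff {α β : Type*} {Rule : α → List β → β → Prop} {a : α} {b : β} :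
    Closure Rule a b ↔ ∃ L, Derivation (Rule a) L ∧ b ∈ L := by
  constructor
  · intro h
    induction h with
    | intro l b hb _ ih =>
      have : ∃ L, Derivation (Rule a) L ∧ ∀ z ∈ l, z ∈ L := by
        clear hb
        induction l with
        | nil => exact ⟨[], trivial, by simp⟩
        | cons y l ihl =>
          obtain ⟨L₁, h₁, hy⟩ := ih y (by simp)
          obtain ⟨L₂, h₂, hl⟩ := ihl (fun z hz => by rename_i h; exact h z (by simp [hz]))
            (fun z hz => ih z (by simp [hz]))
          refine ⟨L₁ ++ L₂, h₁.append h₂, fun z hz => ?_⟩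
          rcases List.mem_cons.1 hz with rfl | hz
          · exact List.mem_append_left _ hy
          · exact List.mem_append_right _ (hl z hz)
      obtain ⟨L, hL, hl⟩ := this
      exact ⟨b :: L, ⟨⟨l, hb, hl⟩, hL⟩, by simp⟩
  · rintro ⟨L, hL, hb⟩
    induction L generalizing b with
    | nil => simp at hb
    | cons x L ih =>
      obtain ⟨⟨l, hl, hz⟩, hL⟩ := hL
      rcases List.mem_cons.1 hb with rfl | hb
      · exact ⟨l, b, hl, fun z h => ih hL (hz z h)⟩
      · exact ih hL hb

theorem AFun.closure {Rule : α → List β → β → Prop}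
    (h : AFun Y fun x : α × List β × β => Rule x.1 x.2.1 x.2.2) :
    AFun Y fun x : α × β => Closure Rule x.1 x.2 := by
  have hR : AFun Y fun x : ((((α × β) × List β) × List β) × β) × List β =>
      ∃ l, Rule x.1.1.1.1.1 l x.1.2 ∧ ¬ ∃ z, z ∈ l ∧ ¬ z ∈ x.2 := by
    have : AFun Y fun y : (((((α × β) × List β) × List β) × β) × List β) × List β =>
        Rule y.1.1.1.1.1.1 y.2 y.1.1.2 :=
      h.comp (f := fun x : α × List β × β => Rule x.1 x.2.1 x.2.2) (g := fun y :
        (((((α × β) × List β) × List β) × β) × List β) × List β =>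
          (y.1.1.1.1.1.1, y.2, y.1.1.2)) (by fun_prop)
    fun_prop
  have : AFun Y fun x : α × β => ∃ L, (¬ ∃ L₁, ∃ y, ∃ L₂, L = L₁ ++ y :: L₂ ∧
      ¬ ∃ l, Rule x.1 l y ∧ ¬ ∃ z, z ∈ l ∧ ¬ z ∈ L₂) ∧ x.2 ∈ L := by
    fun_prop
  simp only [closure_iff, derivation_iff]
  convert this using 5
  simp

/-! ### An arithmetical form of weak König's lemma -/

variable {C : List (ℕ × Bool) → Prop}

/-- The partial truth assignment `s` satisfies all clauses on its domain. -/
def PartialOk (C : List (ℕ × Bool) → Prop) (s : List Bool) : Prop :=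
  ∀ c, C c → (∀ l ∈ c, l.1 < s.length) → ∃ l ∈ c, s[l.1]? = some l.2

/-- `s` has arbitrarily long extensions satisfying all clauses on their domain. -/
def Extendible (C : List (ℕ × Bool) → Prop) (s : List Bool) : Prop :=
  ∀ n, ∃ u : List Bool, n ≤ u.length ∧ PartialOk C (s ++ u)

/-- `t` is an initial segment of the leftmost path through the extendible assignments. -/
def IsPath (C : List (ℕ × Bool) → Prop) (t : List Bool) : Prop :=
  ∀ t₁ b t₂, t = t₁ ++ b :: t₂ → (b = true ↔ ¬ Extendible C (t₁ ++ [false]))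

theorem PartialOk.of_append {s u : List Bool} (h : PartialOk C (s ++ u)) : PartialOk C s := by
  intro c hc hl
  obtain ⟨l, hlc, h⟩ := h c hc fun l hlc => by
    have := hl l hlc
    simp; omega
  exact ⟨l, hlc, by rwa [List.getElem?_append_left (hl l hlc)] at h⟩

theorem Extendible.partialOk {s : List Bool} (h : Extendible C s) : PartialOk C s := by
  obtain ⟨u, -, h⟩ := h 0
  exact h.of_append

theorem Extendible.true_of_not_false {s : List Bool} (h : Extendible C s)
    (hf : ¬ Extendible C (s ++ [false])) : Extendible C (s ++ [true]) := by
  intro n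
  unfold Extendible at hf
  push Not at hf
  obtain ⟨m, hm⟩ := hf
  obtain ⟨u, hu, hok⟩ := h (max n m + 1)
  cases u with
  | nil => simp at hu
  | cons b u =>
    simp only [List.length_cons, add_le_add_iff_right, sup_le_iff] at hu
    cases b with
    | false => exact absurd (by simpa using hok) (hm u hu.2)
    | true => exact ⟨u, hu.1, by simpa using hok⟩

theorem isPath_concat {t : List Bool} {b : Bool} : IsPath C (t ++ [b]) ↔
    IsPath C t ∧ (b = true ↔ ¬ Extendible C (t ++ [false])) := by
  constructor
  · intro h
    exact ⟨fun t₁ c t₂ he => h t₁ c (t₂ ++ [b]) (by simp [he]), h t b [] rfl⟩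
  · rintro ⟨h, hb⟩ t₁ c t₂ he
    rcases List.eq_nil_or_concat t₂ with rfl | ⟨t₃, d, rfl⟩
    · obtain ⟨rfl, h2⟩ := List.append_inj' he rfl
      obtain rfl : b = c := by simpa using h2
      exact hb
    · rw [List.concat_eq_append, ← List.cons_append, ← List.append_assoc] at he
      exact h _ _ _ (List.append_inj' he rfl).1

theorem IsPath.eq {s t : List Bool} (hs : IsPath C s) (ht : IsPath C t)
    (h : s.length = t.length) : s = t := by
  induction s using List.reverseRecOn generalizing t with
  | nil => simpa using h.symm
  | append_singleton s b ih =>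
    rcases List.eq_nil_or_concat t with rfl | ⟨t, c, rfl⟩
    · simp at h
    · rw [List.concat_eq_append] at *
      rw [isPath_concat] at hs ht
      obtain rfl := ih hs.1 ht.1 (by simpa using h)
      have := hs.2.trans ht.2.symm
      rw [Bool.eq_iff_iff.2 this]

open Classical in
/-- The leftmost path through the extendible assignments. -/
noncomputable def path (C : List (ℕ × Bool) → Prop) : ℕ → List Bool
  | 0 => []
  | n + 1 => path C n ++ [Decidable.decide ¬ Extendible C (path C n ++ [false])]

theorem length_path (n : ℕ) : (path C n).length = n := by
  induction n with
  | zero => rfl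
  | succ n ih => simp [path, ih]

theorem isPath_path (n : ℕ) : IsPath C (path C n) := by
  induction n with
  | zero => intro t₁ b t₂ h; simp [path] at h
  | succ n ih => exact isPath_concat.2 ⟨ih, by simp⟩

theorem extendible_path (h : Extendible C []) (n : ℕ) : Extendible C (path C n) := by
  induction n with
  | zero => exact h
  | succ n ih =>
    by_cases hf : Extendible C (path C n ++ [false])
    · simp [path, hf]
    · simpa [path, hf] using ih.true_of_not_false hf

theorem path_getElem? {n i : ℕ} {b : Bool} (h : (path C n)[i]? = some b) :
    b = true ↔ ¬ Extendible C (path C i ++ [false]) := by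
  induction n with
  | zero => simp [path] at h
  | succ n ih =>
    rw [path, List.getElem?_append] at h
    split_ifs at h with hi
    · exact ih h
    · rw [List.getElem?_singleton] at h
      split_ifs at h with h0
      obtain rfl : i = n := by rw [length_path] at *; omega
      simp only [Option.some.injEq] at h
      simp [← h]

theorem AFun.exists_assignment (hC : AFun Y C)
    (h : ∀ n, ∃ f : ℕ → Bool, ∀ c, C c → (∀ l ∈ c, l.1 < n) → ∃ l ∈ c, f l.1 = l.2) :
    ∃ F : ℕ → Prop, AFun Y F ∧ ∀ c, C c → ∃ l ∈ c, (F l.1 ↔ l.2 = true) := by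
  have hext : Extendible C [] := by
    intro n
    obtain ⟨f, hf⟩ := h n
    refine ⟨(List.range n).map f, by simp, ?_⟩
    intro c hc hl
    simp only [List.nil_append, List.length_map, List.length_range] at hl
    obtain ⟨l, hlc, hfl⟩ := hf c hc hl
    exact ⟨l, hlc, by simp [hl l hlc, hfl]⟩
  refine ⟨fun n => ¬ Extendible C (path C n ++ [false]), ?_, fun c hc => ?_⟩
  · have hok : AFun Y (PartialOk C) := by
      have : AFun Y fun s : List Bool => ¬ ∃ c, C c ∧ (¬ ∃ l, l ∈ c ∧ ¬ l.1 < s.length) ∧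
        ¬ ∃ l, l ∈ c ∧ s[l.1]? = Option.some l.2 := by fun_prop
      convert this using 2
      simp only [PartialOk, not_exists, not_and, not_not, not_forall, exists_prop]
    have hE : AFun Y (Extendible C) := by
      have : AFun Y fun s : List Bool => ¬ ∃ n : ℕ, ¬ ∃ u : List Bool,
        ¬ u.length < n ∧ PartialOk C (s ++ u) := by fun_prop
      convert this using 2
      simp [Extendible]
    have hP : AFun Y (IsPath C) := by
      have : AFun Y fun t : List Bool => ¬ ∃ t₁ b t₂, t = t₁ ++ b :: t₂ ∧
        ¬ (b = true ↔ ¬ Extendible C (t₁ ++ [false])) := by fun_prop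
      convert this using 2
      simp [IsPath]
    have : AFun Y fun n => ∃ t : List Bool, IsPath C t ∧ t.length = n ∧
      ¬ Extendible C (t ++ [false]) := by fun_prop
    convert this using 2 with n
    constructor
    · intro h
      exact ⟨_, isPath_path n, length_path n, h⟩
    · rintro ⟨t, ht, hn, hh⟩
      rwa [← ht.eq (isPath_path n) (by rw [hn, length_path])]
  · obtain ⟨n, hn⟩ : ∃ n, ∀ l ∈ c, l.1 < n := by
      clear hc
      induction c with
      | nil => exact ⟨0, by simp⟩
      | cons a c ih =>
        obtain ⟨n, hn⟩ := ih
        refine ⟨max n (a.1 + 1), fun l hl => ?_⟩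
        rcases List.mem_cons.1 hl with rfl | hl
        · simp
        · exact lt_max_of_lt_left (hn l hl)
    obtain ⟨l, hlc, hl⟩ := (extendible_path hext n).partialOk c hc (by simpa [length_path] using hn)
    exact ⟨l, hlc, (path_getElem? hl).symm⟩

end

/-! ### Codes of terms and formulas as lists -/

/-- The natural number naming the tree with root `t` and immediate subtrees `ys`. -/
def mk (t : ℕ) (ys : List ℕ) : ℕ := Nat.pair t (Encodable.encode ys)

theorem mk_inj {t t' : ℕ} {ys ys' : List ℕ} : mk t ys = mk t' ys' ↔ t = t' ∧ ys = ys' := by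
  simp [mk, Nat.pair_eq_pair]

theorem exists_mk (x : ℕ) : ∃ t ys, x = mk t ys :=
  ⟨x.unpair.1, Denumerable.ofNat (List ℕ) x.unpair.2, by
    rw [mk, Denumerable.encode_ofNat, Nat.pair_unpair]⟩

theorem lt_encode_of_mem {y : ℕ} {ys : List ℕ} (h : y ∈ ys) : y < Encodable.encode ys := by
  induction ys with
  | nil => simp at h
  | cons a l ih =>
    rw [Encodable.encode_list_cons]
    rcases List.mem_cons.1 h with rfl | h
    · exact Nat.lt_succ_of_le (Nat.left_le_pair _ _)
    · exact Nat.lt_succ_of_le ((ih h).le.trans (Nat.right_le_pair _ _))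

theorem lt_mk_of_mem {t y : ℕ} {ys : List ℕ} (h : y ∈ ys) : y < mk t ys :=
  (lt_encode_of_mem h).trans_le (Nat.right_le_pair _ _)

@[fun_prop]
theorem AFun.mk {Y : Set ℕ} {α : Type*} [Primcodable α] {f : α → ℕ} {g : α → List ℕ}
    (hf : AFun Y f) (hg : AFun Y g) : AFun Y fun x => mk (f x) (g x) :=
  hf.natPair hg.encode

/-- The list of codes underlying `termCode`. -/
def termList (g : GoedelCoding L) {α : Type} (e : α → ℕ) (t : L.Term α) : List ℕ :=
  t.listEncode.map (Sum.elim (fun a => Nat.pair 0 (e a))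
    (fun p => Nat.pair 1 (Nat.pair p.1 (g.encFun p.1 p.2))))

/-- The coding of the variables of a bounded formula. -/
def varCode {α : Type} (e : α → ℕ) (n : ℕ) : α ⊕ Fin n → ℕ :=
  Sum.elim (fun a => Nat.pair 0 (e a)) (fun i => Nat.pair 1 i.1)

/-- The list of codes underlying `formulaCode`. -/
def formulaList (g : GoedelCoding L) {α : Type} (e : α → ℕ) {n : ℕ}
    (φ : L.BoundedFormula α n) : List ℕ :=
  φ.listEncode.map (Sum.elim
    (fun p => Nat.pair 0 (Nat.pair p.1 (termCode g (varCode e p.1) p.2)))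
    (Sum.elim
      (fun q => Nat.pair 1 (Nat.pair q.1 (g.encRel q.1 q.2)))
      (fun m => Nat.pair 2 m)))

section
variable (g : GoedelCoding L) {α β : Type} (e : α → ℕ) {n : ℕ}

@[simp]
theorem termList_var (a : α) : termList g e (.var a : L.Term α) = [Nat.pair 0 (e a)] := rfl

@[simp]
theorem termList_func {m : ℕ} (f : L.Functions m) (ts : Fin m → L.Term α) :
    termList g e (.func f ts) = Nat.pair 1 (Nat.pair m (g.encFun m f)) ::
      (List.ofFn fun i => termList g e (ts i)).flatten := by
  simp only [termList, Term.listEncode, List.map_cons, Sum.elim_inr, List.flatMap_def,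
    List.map_flatten, List.map_map, List.ofFn_eq_map]
  rfl

@[simp]
theorem formulaList_falsum :
    formulaList g e (.falsum : L.BoundedFormula α n) = [Nat.pair 2 (n + 2)] := rfl

@[simp]
theorem formulaList_equal (t₁ t₂ : L.Term (α ⊕ Fin n)) : formulaList g e (.equal t₁ t₂) =
    [Nat.pair 0 (Nat.pair n (Encodable.encode (termList g (varCode e n) t₁))),
      Nat.pair 0 (Nat.pair n (Encodable.encode (termList g (varCode e n) t₂)))] := rfl

@[simp]
theorem formulaList_rel {m : ℕ} (R : L.Relations m) (ts : Fin m → L.Term (α ⊕ Fin n)) :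
    formulaList g e (.rel R ts) = Nat.pair 1 (Nat.pair m (g.encRel m R)) :: Nat.pair 2 n ::
      List.ofFn fun i => Nat.pair 0 (Nat.pair n
        (Encodable.encode (termList g (varCode e n) (ts i)))) := by
  simp only [formulaList, BoundedFormula.listEncode, List.map_append, List.map_map,
    List.ofFn_eq_map]
  rfl

@[simp]
theorem formulaList_imp (φ ψ : L.BoundedFormula α n) : formulaList g e (.imp φ ψ) =
    Nat.pair 2 0 :: (formulaList g e φ ++ formulaList g e ψ) := by
  simp [formulaList, BoundedFormula.listEncode]

@[simp]
theorem formulaList_all (φ : L.BoundedFormula α (n + 1)) : formulaList g e (.all φ) =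
    Nat.pair 2 1 :: formulaList g e φ := by
  simp [formulaList, BoundedFormula.listEncode]

variable {e}

theorem varCode_injective (he : Function.Injective e) (n : ℕ) :
    Function.Injective (varCode e n) := by
  rintro (a | a) (b | b) h <;> simp only [varCode, Sum.elim_inl, Sum.elim_inr, Nat.pair_eq_pair] at h
  · rw [he h.2]
  · simp at h
  · simp at h
  · rw [Fin.ext h.2]

theorem termList_injective (he : Function.Injective e) :
    Function.Injective (termList g e : L.Term α → List ℕ) := by
  refine Function.Injective.comp (List.map_injective_iff.2 ?_) Term.listEncode_injective
  rintro (a | ⟨m, a⟩) (b | ⟨k, b⟩) h <;>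
    simp only [Sum.elim_inl, Sum.elim_inr, Nat.pair_eq_pair] at h
  · rw [he h.2]
  · simp at h
  · simp at h
  · obtain ⟨-, rfl, h⟩ := h
    rw [g.encFun_inj _ h]

theorem formulaList_sigma_injective (he : Function.Injective e) :
    Function.Injective fun φ : Σ n, L.BoundedFormula α n => formulaList g e φ.2 := by
  refine Function.Injective.comp (List.map_injective_iff.2 ?_)
    BoundedFormula.listEncode_sigma_injective
  rintro (⟨m, a⟩ | ⟨m, a⟩ | a) (⟨k, b⟩ | ⟨k, b⟩ | b) h <;>
    simp only [Sum.elim_inl, Sum.elim_inr, Nat.pair_eq_pair] at h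
  · obtain ⟨-, rfl, h⟩ := h
    rw [termList_injective g (varCode_injective he m) (Encodable.encode_injective h)]
  · simp at h
  · simp at h
  · simp at h
  · obtain ⟨-, rfl, h⟩ := h
    rw [g.encRel_inj _ h]
  · simp at h
  · simp at h
  · simp at h
  · rw [h.2]

theorem formulaList_injective (he : Function.Injective e) :
    Function.Injective (formulaList g e : L.BoundedFormula α n → List ℕ) := fun φ ψ h =>
  eq_of_heq (Sigma.mk.inj (formulaList_sigma_injective g he (a₁ := ⟨n, φ⟩) (a₂ := ⟨n, ψ⟩) h)).2

theorem termList_relabel {e' : β → ℕ} (f : α → β) (hf : ∀ a, e' (f a) = e a) (t : L.Term α) :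
    termList g e' (t.relabel f) = termList g e t := by
  induction t with
  | var a => simp [Term.relabel, hf]
  | func F ts ih => simp [Term.relabel, ih]

theorem formulaList_relabelEquiv {e' : β → ℕ} (f : α ≃ β) (hf : ∀ a, e' (f a) = e a)
    (φ : L.BoundedFormula α n) :
    formulaList g e' (BoundedFormula.relabelEquiv f φ) = formulaList g e φ := by
  have ht : ∀ (n : ℕ) (t : L.Term (α ⊕ Fin n)),
      termList g (varCode e' n) (t.relabel (Sum.map f _root_.id)) = termList g (varCode e n) t :=
    fun n t => termList_relabel g _ (by rintro (a | a) <;> simp [varCode, hf]) t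
  simp only [BoundedFormula.relabelEquiv, BoundedFormula.mapTermRelEquiv_apply]
  induction φ with
  | falsum => rfl
  | equal t₁ t₂ =>
    simp only [BoundedFormula.mapTermRel, formulaList_equal]
    rw [← ht, ← ht]; rfl
  | rel R ts =>
    simp only [BoundedFormula.mapTermRel, formulaList_rel]
    simp only [← ht]; rfl
  | imp φ ψ ih₁ ih₂ => simp only [BoundedFormula.mapTermRel, formulaList_imp, ih₁, ih₂]
  | all φ ih =>
    simp only [BoundedFormula.mapTermRel, formulaList_all]
    rw [← ih]; rfl

end

/-! ### Arithmeticity of the syntax -/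

/-- The name of the value of a term in the free structure on `ℕ`. -/
def termVal (g : GoedelCoding L) {α : Type} (v : α → ℕ) : L.Term α → ℕ
  | .var a => v a
  | @Term.func _ _ m f ts =>
    mk (Nat.pair 2 (Nat.pair m (g.encFun m f))) (List.ofFn fun i => termVal g v (ts i))

/-- The rules generating the pairs of the code of a term and the name of its value, where `p` lists
the values of the free and the bound variables. -/
def TermRule (g : GoedelCoding L) (p : List ℕ × List ℕ) (l : List (List ℕ × ℕ)) (b : List ℕ × ℕ) :
    Prop :=
  (l = [] ∧ ∃ i, b.1 = [Nat.pair 0 (Nat.pair 0 i)] ∧ p.1[i]? = some b.2) ∨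
  (l = [] ∧ ∃ i, b.1 = [Nat.pair 0 (Nat.pair 1 i)] ∧ p.2[i]? = some b.2) ∨
  ∃ m e, Nat.pair 0 (Nat.pair m e) ∈ symbolCodes g ∧ l.length = m ∧
    b.1 = Nat.pair 1 (Nat.pair m e) :: (l.map Prod.fst).flatten ∧
    b.2 = mk (Nat.pair 2 (Nat.pair m e)) (l.map Prod.snd)

/-- `c` codes a term whose value is named by `y`, where `as` and `bs` list the values of the free
and the bound variables. -/
def TermValue (g : GoedelCoding L) (as bs : List ℕ) (c : List ℕ) (y : ℕ) : Prop :=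
  Closure (TermRule g) (as, bs) (c, y)

theorem mem_symbolCodes_fun (g : GoedelCoding L) {m e : ℕ} :
    Nat.pair 0 (Nat.pair m e) ∈ symbolCodes g ↔ ∃ f : L.Functions m, g.encFun m f = e := by
  simp only [symbolCodes, Set.mem_ofPred_eq, Nat.pair_eq_pair]
  constructor
  · rintro (⟨n, f, -, rfl, h⟩ | ⟨n, f, h, -⟩)
    · exact ⟨f, h.symm⟩
    · simp at h
  · rintro ⟨f, rfl⟩
    exact Or.inl ⟨m, f, trivial, rfl, rfl⟩

theorem mem_symbolCodes_rel (g : GoedelCoding L) {m e : ℕ} :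
    Nat.pair 1 (Nat.pair m e) ∈ symbolCodes g ↔ ∃ R : L.Relations m, g.encRel m R = e := by
  simp only [symbolCodes, Set.mem_ofPred_eq, Nat.pair_eq_pair]
  constructor
  · rintro (⟨n, f, h, -⟩ | ⟨n, f, -, rfl, h⟩)
    · simp at h
    · exact ⟨f, h.symm⟩
  · rintro ⟨f, rfl⟩
    exact Or.inr ⟨m, f, trivial, rfl, rfl⟩

theorem exists_ofFn_of_forall_mem {α β : Type*} {P : α → β → Prop} {l : List β}
    (h : ∀ z ∈ l, ∃ a, P a z) : ∃ t : Fin l.length → α, ∀ i, P (t i) (l.get i) :=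
  ⟨fun i => (h (l.get i) (l.get_mem i)).choose, fun i => (h (l.get i) (l.get_mem i)).choose_spec⟩

theorem termValue_iff (g : GoedelCoding L) {k n : ℕ} {a : Fin k → ℕ} {x : Fin n → ℕ} {c : List ℕ}
    {y : ℕ} : TermValue g (List.ofFn a) (List.ofFn x) c y ↔
      ∃ t : L.Term (Fin k ⊕ Fin n), termList g (varCode Fin.val n) t = c ∧
        termVal g (Sum.elim a x) t = y := by
  constructor
  · suffices ∀ b, Closure (TermRule g) (List.ofFn a, List.ofFn x) b →
        ∃ t : L.Term (Fin k ⊕ Fin n), termList g (varCode Fin.val n) t = b.1 ∧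
        termVal g (Sum.elim a x) t = b.2 from this (c, y)
    intro b h
    induction h with
    | intro l b hb _ ih =>
      rcases hb with ⟨-, i, h1, h2⟩ | ⟨-, i, h1, h2⟩ | ⟨m, e, hs, rfl, h1, h2⟩
      · rw [List.getElem?_ofFn] at h2
        split_ifs at h2 with hi
        exact ⟨.var (.inl ⟨i, hi⟩), by simp [varCode, h1], by simpa [termVal] using h2⟩
      · rw [List.getElem?_ofFn] at h2
        split_ifs at h2 with hi
        exact ⟨.var (.inr ⟨i, hi⟩), by simp [varCode, h1], by simpa [termVal] using h2⟩
      · obtain ⟨f, rfl⟩ := (mem_symbolCodes_fun g).1 hs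
        obtain ⟨t, ht⟩ := exists_ofFn_of_forall_mem ih
        refine ⟨.func f t, ?_, ?_⟩
        · simp only [termList_func, fun i => (ht i).1, h1]
          congr 2
          exact List.ext_get (by simp) (by simp)
        · simp only [termVal, fun i => (ht i).2, h2]
          congr 1
          exact List.ext_get (by simp) (by simp)
  · rintro ⟨t, rfl, rfl⟩
    induction t with
    | var v =>
      refine .intro [] _ ?_ (by simp)
      cases v with
      | inl i => exact Or.inl ⟨rfl, i, rfl, by simp [termVal]⟩
      | inr i => exact Or.inr (Or.inl ⟨rfl, i, rfl, by simp [termVal]⟩)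
    | @func m f ts ih =>
      refine .intro (List.ofFn fun i =>
        (termList g (varCode Fin.val n) (ts i), termVal g (Sum.elim a x) (ts i))) _
        (Or.inr (Or.inr ⟨m, g.encFun m f, (mem_symbolCodes_fun g).2 ⟨f, rfl⟩, by simp, ?_, ?_⟩))
        ?_
      · simp only [termList_func, List.map_ofFn]; rfl
      · simp only [termVal, List.map_ofFn]; rfl
      · intro z hz
        obtain ⟨i, rfl⟩ := (List.mem_ofFn' _ _).1 hz
        exact ih i

/-- `c` codes a term with `k` free and `n` bound variables. -/
def IsTerm (g : GoedelCoding L) (k n : ℕ) (c : List ℕ) : Prop :=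
  ∃ t : L.Term (Fin k ⊕ Fin n), termList g (varCode Fin.val n) t = c

theorem isTerm_iff (g : GoedelCoding L) {k n : ℕ} {c : List ℕ} : IsTerm g k n c ↔
    ∃ as : List ℕ, ∃ bs : List ℕ, ∃ y,
      as.length = k ∧ bs.length = n ∧ TermValue g as bs c y := by
  constructor
  · rintro ⟨t, rfl⟩
    exact ⟨List.ofFn fun _ : Fin k => 0, List.ofFn fun _ : Fin n => 0, _, by simp, by simp,
      (termValue_iff g).2 ⟨t, rfl, rfl⟩⟩
  · rintro ⟨as, bs, y, rfl, rfl, h⟩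
    rw [← List.ofFn_get as, ← List.ofFn_get bs, termValue_iff] at h
    obtain ⟨t, h, -⟩ := h
    exact ⟨t, h⟩

/-- The rules generating the codes of bounded formulas with `k` free variables. -/
def FormulaRule (g : GoedelCoding L) (k : ℕ) (l : List (ℕ × List ℕ)) (b : ℕ × List ℕ) : Prop :=
  (l = [] ∧ b.2 = [Nat.pair 2 (b.1 + 2)]) ∨
  (l = [] ∧ ∃ c₁ c₂, IsTerm g k b.1 c₁ ∧ IsTerm g k b.1 c₂ ∧
    b.2 = [Nat.pair 0 (Nat.pair b.1 (Encodable.encode c₁)),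
      Nat.pair 0 (Nat.pair b.1 (Encodable.encode c₂))]) ∨
  (l = [] ∧ ∃ e, ∃ cs : List (List ℕ), Nat.pair 1 (Nat.pair cs.length e) ∈ symbolCodes g ∧
    (¬ ∃ c, c ∈ cs ∧ ¬ IsTerm g k b.1 c) ∧
    b.2 = Nat.pair 1 (Nat.pair cs.length e) :: Nat.pair 2 b.1 ::
      cs.map fun c => Nat.pair 0 (Nat.pair b.1 (Encodable.encode c))) ∨
  (∃ l₁ l₂, l = [(b.1, l₁), (b.1, l₂)] ∧ b.2 = Nat.pair 2 0 :: (l₁ ++ l₂)) ∨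
  ∃ l₁, l = [(b.1 + 1, l₁)] ∧ b.2 = Nat.pair 2 1 :: l₁

/-- `c` codes a formula with `k` free and `n` bound variables. -/
def IsFormula (g : GoedelCoding L) (k n : ℕ) (c : List ℕ) : Prop :=
  ∃ φ : L.BoundedFormula (Fin k) n, formulaList g Fin.val φ = c

theorem isFormula_iff (g : GoedelCoding L) {k n : ℕ} {c : List ℕ} :
    IsFormula g k n c ↔ Closure (FormulaRule g) k (n, c) := by
  constructor
  · rintro ⟨φ, rfl⟩
    induction φ with
    | falsum => exact .intro [] _ (Or.inl ⟨rfl, rfl⟩) (by simp)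
    | equal t₁ t₂ =>
      exact .intro [] _ (Or.inr (Or.inl ⟨rfl, _, _, ⟨t₁, rfl⟩, ⟨t₂, rfl⟩, rfl⟩)) (by simp)
    | @rel n m R ts =>
      refine .intro [] _ (Or.inr (Or.inr (Or.inl ⟨rfl, g.encRel m R, List.ofFn fun i =>
        termList g (varCode Fin.val n) (ts i), ?_, ?_, ?_⟩))) (by simp)
      · simpa using (mem_symbolCodes_rel g).2 ⟨R, rfl⟩
      · rintro ⟨c, hc, h⟩
        obtain ⟨i, rfl⟩ := (List.mem_ofFn' _ _).1 hc
        exact h ⟨ts i, rfl⟩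
      · simp only [formulaList_rel, List.map_ofFn, List.length_ofFn]; rfl
    | @imp n φ ψ ih₁ ih₂ =>
      refine .intro _ _ (Or.inr (Or.inr (Or.inr (Or.inl ⟨_, _, rfl, formulaList_imp ..⟩)))) ?_
      intro z hz
      rcases List.mem_pair.1 hz with rfl | rfl
      · exact ih₁
      · exact ih₂
    | all φ ih =>
      refine .intro _ _ (Or.inr (Or.inr (Or.inr (Or.inr ⟨_, rfl, formulaList_all ..⟩)))) ?_
      intro z hz
      rw [List.mem_singleton.1 hz]
      exact ih
  · suffices ∀ b, Closure (FormulaRule g) k b → IsFormula g k b.1 b.2 from this (n, c)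
    rintro b h
    induction h with
    | intro l b hb _ ih =>
      obtain ⟨n, c⟩ := b
      rcases hb with ⟨-, h⟩ | ⟨-, _, _, ⟨t₁, rfl⟩, ⟨t₂, rfl⟩, h⟩ | ⟨-, e, cs, hs, hc, h⟩ |
        ⟨l₁, l₂, rfl, h⟩ | ⟨l₁, rfl, h⟩
      · exact ⟨.falsum, h.symm⟩
      · exact ⟨.equal t₁ t₂, h.symm⟩
      · obtain ⟨R, rfl⟩ := (mem_symbolCodes_rel g).1 hs
        push Not at hc
        obtain ⟨t, ht⟩ := exists_ofFn_of_forall_mem hc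
        refine ⟨.rel R t, ?_⟩
        simp only [formulaList_rel, ht]
        refine Eq.trans ?_ h.symm
        congr 2
        exact List.ext_get (by simp) (by simp)
      · obtain ⟨φ, hφ⟩ := ih (n, l₁) (by simp)
        obtain ⟨ψ, hψ⟩ := ih (n, l₂) (by simp)
        exact ⟨.imp φ ψ, by rw [formulaList_imp, hφ, hψ]; exact h.symm⟩
      · obtain ⟨φ, hφ⟩ := ih (n + 1, l₁) (by simp)
        exact ⟨.all φ, by rw [formulaList_all, hφ]; exact h.symm⟩

section
variable {Y : Set ℕ} {α : Type*} [Primcodable α] {g : GoedelCoding L}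

theorem AFun.termValue (hL : AFun Y fun n => n ∈ symbolCodes g) {as bs c : α → List ℕ} {y : α → ℕ}
    (has : AFun Y as) (hbs : AFun Y bs) (hc : AFun Y c) (hy : AFun Y y) :
    AFun Y fun x => TermValue g (as x) (bs x) (c x) (y x) := by
  refine AFun.comp (f := fun x : (List ℕ × List ℕ) × (List ℕ × ℕ) => Closure (TermRule g) x.1 x.2)
    (AFun.closure ?_) (g := fun x => ((as x, bs x), (c x, y x))) (by fun_prop)
  unfold TermRule
  fun_prop

theorem AFun.isTerm (hL : AFun Y fun n => n ∈ symbolCodes g) {k n : α → ℕ} {c : α → List ℕ}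
    (hk : AFun Y k) (hn : AFun Y n) (hc : AFun Y c) :
    AFun Y fun x => IsTerm g (k x) (n x) (c x) := by
  simp only [isTerm_iff]
  have : AFun Y fun x : ((α × List ℕ) × List ℕ) × ℕ => TermValue g x.1.1.2 x.1.2 (c x.1.1.1) x.2 :=
    .termValue hL (by fun_prop) (by fun_prop) (by fun_prop) (by fun_prop)
  fun_prop

theorem AFun.isFormula (hL : AFun Y fun n => n ∈ symbolCodes g) {k n : α → ℕ} {c : α → List ℕ}
    (hk : AFun Y k) (hn : AFun Y n) (hc : AFun Y c) :
    AFun Y fun x => IsFormula g (k x) (n x) (c x) := by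
  simp only [isFormula_iff]
  refine AFun.comp (f := fun x : ℕ × (ℕ × List ℕ) => Closure (FormulaRule g) x.1 x.2)
    (AFun.closure ?_) (g := fun x => (k x, (n x, c x))) (by fun_prop)
  have hT : AFun Y fun x : ℕ × ℕ × List ℕ => IsTerm g x.1 x.2.1 x.2.2 :=
    .isTerm hL (by fun_prop) (by fun_prop) (by fun_prop)
  unfold FormulaRule
  fun_prop

end

/-! ### Names, queries and the clauses they satisfy -/

/-- The query whether the names `x` and `y` denote the same element. -/
def eqQuery (x y : ℕ) : ℕ := mk (Nat.pair 0 0) [x, y]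

/-- The query whether the relation symbol with code `e` and arity `m` holds of `ys`. -/
def relQuery (m e : ℕ) (ys : List ℕ) : ℕ := mk (Nat.pair 1 (Nat.pair m e)) ys

/-- The query whether the formula coded by `p`, with `k` free variables, holds of `ys`. -/
def codeQuery (k : ℕ) (p ys : List ℕ) : ℕ := mk (Nat.pair 2 (Nat.pair k (Encodable.encode p))) ys

/-- The query whether `φ` holds of the elements named by `a` and `x`. -/
def formulaQuery (g : GoedelCoding L) {k n : ℕ} (φ : L.BoundedFormula (Fin k) n) (a : Fin k → ℕ)
    (x : Fin n → ℕ) : ℕ :=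
  codeQuery k (formulaList g Fin.val φ) (List.ofFn a ++ List.ofFn x)

/-- The name of the `i`-th independent constant. -/
def cstName (i : ℕ) : ℕ := mk (Nat.pair 0 i) []

/-- The name of the base element `m`. -/
def baseName (m : ℕ) : ℕ := mk (Nat.pair 1 m) []

/-- The name of a counterexample to the formula coded by `p` with parameters `ys`. -/
def skolemName (k : ℕ) (p ys : List ℕ) : ℕ := mk (Nat.pair 3 (Nat.pair k (Encodable.encode p))) ys

/-- The rules for the occurrence of the `i`-th constant in a name. -/
def OccursRule (i : ℕ) (l : List ℕ) (x : ℕ) : Prop :=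
  (l = [] ∧ ∃ ys, x = mk (Nat.pair 0 i) ys) ∨ ∃ t ys z, l = [z] ∧ x = mk t ys ∧ z ∈ ys

/-- The `i`-th constant occurs in the name `x`. -/
def Occurs (i x : ℕ) : Prop := Closure OccursRule i x

theorem occurs_mk {i t : ℕ} {ys : List ℕ} :
    Occurs i (mk t ys) ↔ t = Nat.pair 0 i ∨ ∃ z ∈ ys, Occurs i z := by
  constructor
  · rintro ⟨l, _, ⟨rfl, zs, h⟩ | ⟨t', zs, z, rfl, h, hz⟩, hl⟩
    · exact Or.inl (mk_inj.1 h).1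
    · exact Or.inr ⟨z, by rwa [(mk_inj.1 h).2], hl z (by simp)⟩
  · rintro (rfl | ⟨z, hz, h⟩)
    · exact .intro [] _ (Or.inl ⟨rfl, ys, rfl⟩) (by simp)
    · exact .intro [z] _ (Or.inr ⟨t, ys, z, rfl, rfl, hz⟩)
        fun w hw => by rwa [List.mem_singleton.1 hw]

section
variable {Y : Set ℕ} {α : Type*} [Primcodable α]

@[fun_prop]
theorem AFun.bnot {f : α → Bool} (hf : AFun Y f) : AFun Y fun x => !f x :=
  AFun.comp (f := fun b : Bool => !b) (.of_primrec (Primrec.dom_finite _)) hf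

@[fun_prop]
theorem AFun.eqQuery {f h : α → ℕ} (hf : AFun Y f) (hh : AFun Y h) :
    AFun Y fun x => eqQuery (f x) (h x) := by
  unfold ArMorley.eqQuery; fun_prop

@[fun_prop]
theorem AFun.relQuery {f h : α → ℕ} {ys : α → List ℕ} (hf : AFun Y f) (hh : AFun Y h)
    (hys : AFun Y ys) : AFun Y fun x => relQuery (f x) (h x) (ys x) := by
  unfold ArMorley.relQuery; fun_prop

@[fun_prop]
theorem AFun.codeQuery {f : α → ℕ} {p ys : α → List ℕ} (hf : AFun Y f) (hp : AFun Y p)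
    (hys : AFun Y ys) : AFun Y fun x => codeQuery (f x) (p x) (ys x) := by
  unfold ArMorley.codeQuery; fun_prop

@[fun_prop]
theorem AFun.skolemName {f : α → ℕ} {p ys : α → List ℕ} (hf : AFun Y f) (hp : AFun Y p)
    (hys : AFun Y ys) : AFun Y fun x => skolemName (f x) (p x) (ys x) := by
  unfold ArMorley.skolemName; fun_prop

@[fun_prop]
theorem AFun.cstName {f : α → ℕ} (hf : AFun Y f) : AFun Y fun x => cstName (f x) := by
  unfold ArMorley.cstName; fun_prop

@[fun_prop]
theorem AFun.baseName {f : α → ℕ} (hf : AFun Y f) : AFun Y fun x => baseName (f x) := by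
  unfold ArMorley.baseName; fun_prop

@[fun_prop]
theorem AFun.occurs {f h : α → ℕ} (hf : AFun Y f) (hh : AFun Y h) :
    AFun Y fun x => Occurs (f x) (h x) := by
  refine AFun.comp (f := fun x : ℕ × ℕ => Closure OccursRule x.1 x.2)
    (AFun.closure ?_) (g := fun x => (f x, h x)) (by fun_prop)
  unfold OccursRule
  fun_prop

end

/-- The clauses describing an elementary diagram in which the constants are independent, the base
elements from `B` are distinct and the formulas in `D` hold of the base elements. -/
inductive IsClause (g : GoedelCoding L) (B : Set ℕ)
    (D : ∀ k, L.Formula (Fin k) → (Fin k → ℕ) → Prop) : List (ℕ × Bool) → Prop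
  | refl (x : ℕ) : IsClause g B D [(eqQuery x x, true)]
  | congrQuery (t : ℕ) (l : List (ℕ × ℕ)) :
    IsClause g B D (l.map (fun p => (eqQuery p.1 p.2, false)) ++
      [(mk t (l.map Prod.fst), false), (mk t (l.map Prod.snd), true)])
  | congrName (t : ℕ) (l : List (ℕ × ℕ)) :
    IsClause g B D (l.map (fun p => (eqQuery p.1 p.2, false)) ++
      [(eqQuery (mk t (l.map Prod.fst)) (mk t (l.map Prod.snd)), true)])
  | falsum {k n : ℕ} (a : Fin k → ℕ) (x : Fin n → ℕ) :
    IsClause g B D [(formulaQuery g .falsum a x, false)]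
  | equal {k n : ℕ} (a : Fin k → ℕ) (x : Fin n → ℕ) (t₁ t₂ : L.Term (Fin k ⊕ Fin n)) (b : Bool) :
    IsClause g B D [(formulaQuery g (.equal t₁ t₂) a x, b),
      (eqQuery (termVal g (Sum.elim a x) t₁) (termVal g (Sum.elim a x) t₂), !b)]
  | rel {k n m : ℕ} (a : Fin k → ℕ) (x : Fin n → ℕ) (R : L.Relations m)
    (ts : Fin m → L.Term (Fin k ⊕ Fin n)) (b : Bool) :
    IsClause g B D [(formulaQuery g (.rel R ts) a x, b),
      (relQuery m (g.encRel m R) (List.ofFn fun i => termVal g (Sum.elim a x) (ts i)), !b)]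
  | imp {k n : ℕ} (a : Fin k → ℕ) (x : Fin n → ℕ) (φ ψ : L.BoundedFormula (Fin k) n) :
    IsClause g B D [(formulaQuery g (.imp φ ψ) a x, false), (formulaQuery g φ a x, false),
      (formulaQuery g ψ a x, true)]
  | imp_left {k n : ℕ} (a : Fin k → ℕ) (x : Fin n → ℕ) (φ ψ : L.BoundedFormula (Fin k) n) :
    IsClause g B D [(formulaQuery g (.imp φ ψ) a x, true), (formulaQuery g φ a x, true)]
  | imp_right {k n : ℕ} (a : Fin k → ℕ) (x : Fin n → ℕ) (φ ψ : L.BoundedFormula (Fin k) n) :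
    IsClause g B D [(formulaQuery g (.imp φ ψ) a x, true), (formulaQuery g ψ a x, false)]
  | all {k n : ℕ} (a : Fin k → ℕ) (x : Fin n → ℕ) (φ : L.BoundedFormula (Fin k) (n + 1)) (y : ℕ) :
    IsClause g B D [(formulaQuery g (.all φ) a x, false), (formulaQuery g φ a (Fin.snoc x y), true)]
  | skolem {k n : ℕ} (a : Fin k → ℕ) (x : Fin n → ℕ) (φ : L.BoundedFormula (Fin k) (n + 1)) :
    IsClause g B D [(formulaQuery g (.all φ) a x, true), (formulaQuery g φ a (Fin.snoc x
      (skolemName k (formulaList g Fin.val φ) (List.ofFn a ++ List.ofFn x))), false)]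
  | diagram {k : ℕ} (φ : L.Formula (Fin k)) (v : Fin k → ℕ) : D k φ v →
    IsClause g B D [(formulaQuery g φ (fun i => baseName (v i)) (default : Fin 0 → ℕ), true)]
  | indep (i x : ℕ) : ¬ Occurs i x → IsClause g B D [(eqQuery (cstName i) x, false)]
  | base (m m' : ℕ) : m ∈ B → m' ∈ B → m ≠ m' →
    IsClause g B D [(eqQuery (baseName m) (baseName m'), false)]

/-- The formula coded by `p` and the tuple listed by `ms` are related by `D`. -/
def IsInstance (g : GoedelCoding L) (D : ∀ k, L.Formula (Fin k) → (Fin k → ℕ) → Prop) (k : ℕ)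
    (p ms : List ℕ) : Prop :=
  ∃ (φ : L.Formula (Fin k)) (v : Fin k → ℕ), formulaList g Fin.val φ = p ∧ List.ofFn v = ms ∧
    D k φ v

section
variable (g : GoedelCoding L) {B : Set ℕ} {D : ∀ k, L.Formula (Fin k) → (Fin k → ℕ) → Prop}

theorem ofFn_snoc' {n : ℕ} (x : Fin n → ℕ) (y : ℕ) :
    List.ofFn (Fin.snoc x y : Fin (n + 1) → ℕ) = List.ofFn x ++ [y] := by
  rw [List.ofFn_succ', List.concat_eq_append]
  simp

theorem exists_ofFn (l : List ℕ) : ∃ (n : ℕ) (x : Fin n → ℕ), l = List.ofFn x :=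
  ⟨_, _, (List.ofFn_get l).symm⟩

theorem isClause_iff (c : List (ℕ × Bool)) : IsClause g B D c ↔
    (∃ x, c = [(eqQuery x x, true)]) ∨
    (∃ t, ∃ l : List (ℕ × ℕ), c = l.map (fun p => (eqQuery p.1 p.2, false)) ++
      [(mk t (l.map Prod.fst), false), (mk t (l.map Prod.snd), true)]) ∨
    (∃ t, ∃ l : List (ℕ × ℕ), c = l.map (fun p => (eqQuery p.1 p.2, false)) ++
      [(eqQuery (mk t (l.map Prod.fst)) (mk t (l.map Prod.snd)), true)]) ∨
    (∃ as bs : List ℕ,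
      c = [(codeQuery as.length [Nat.pair 2 (bs.length + 2)] (as ++ bs), false)]) ∨
    (∃ as bs c₁ c₂ y₁ y₂ b, TermValue g as bs c₁ y₁ ∧ TermValue g as bs c₂ y₂ ∧
      c = [(codeQuery as.length [Nat.pair 0 (Nat.pair bs.length (Encodable.encode c₁)),
        Nat.pair 0 (Nat.pair bs.length (Encodable.encode c₂))] (as ++ bs), b),
        (eqQuery y₁ y₂, !b)]) ∨
    (∃ as bs e, ∃ l : List (List ℕ × ℕ), ∃ b, Nat.pair 1 (Nat.pair l.length e) ∈ symbolCodes g ∧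
      (¬ ∃ z, z ∈ l ∧ ¬ TermValue g as bs z.1 z.2) ∧
      c = [(codeQuery as.length (Nat.pair 1 (Nat.pair l.length e) :: Nat.pair 2 bs.length ::
        l.map fun z => Nat.pair 0 (Nat.pair bs.length (Encodable.encode z.1))) (as ++ bs), b),
        (relQuery l.length e (l.map Prod.snd), !b)]) ∨
    (∃ as bs l₁ l₂, IsFormula g as.length bs.length l₁ ∧ IsFormula g as.length bs.length l₂ ∧
      (c = [(codeQuery as.length (Nat.pair 2 0 :: (l₁ ++ l₂)) (as ++ bs), false),
          (codeQuery as.length l₁ (as ++ bs), false), (codeQuery as.length l₂ (as ++ bs), true)] ∨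
        c = [(codeQuery as.length (Nat.pair 2 0 :: (l₁ ++ l₂)) (as ++ bs), true),
          (codeQuery as.length l₁ (as ++ bs), true)] ∨
        c = [(codeQuery as.length (Nat.pair 2 0 :: (l₁ ++ l₂)) (as ++ bs), true),
          (codeQuery as.length l₂ (as ++ bs), false)])) ∨
    (∃ as bs l₁, IsFormula g as.length (bs.length + 1) l₁ ∧
      ((∃ y, c = [(codeQuery as.length (Nat.pair 2 1 :: l₁) (as ++ bs), false),
          (codeQuery as.length l₁ (as ++ (bs ++ [y])), true)]) ∨
        c = [(codeQuery as.length (Nat.pair 2 1 :: l₁) (as ++ bs), true),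
          (codeQuery as.length l₁ (as ++ (bs ++ [skolemName as.length l₁ (as ++ bs)])), false)])) ∨
    (∃ k, ∃ p, ∃ ms, IsInstance g D k p ms ∧ c = [(codeQuery k p (ms.map baseName), true)]) ∨
    (∃ i x, ¬ Occurs i x ∧ c = [(eqQuery (cstName i) x, false)]) ∨
    ∃ m m', m ∈ B ∧ m' ∈ B ∧ ¬ m = m' ∧ c = [(eqQuery (baseName m) (baseName m'), false)] := by
  constructor
  · rintro (x | ⟨t, l⟩ | ⟨t, l⟩ | ⟨a, x⟩ | ⟨a, x, t₁, t₂, b⟩ | ⟨a, x, R, ts, b⟩ | ⟨a, x, φ, ψ⟩ |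
      ⟨a, x, φ, ψ⟩ | ⟨a, x, φ, ψ⟩ | ⟨a, x, φ, y⟩ | ⟨a, x, φ⟩ | ⟨φ, v, h⟩ | ⟨i, x, h⟩ |
      ⟨m, m', h, h', hne⟩)
    · exact Or.inl ⟨x, rfl⟩
    · exact Or.inr <| Or.inl ⟨t, l, rfl⟩
    · exact Or.inr <| Or.inr <| Or.inl ⟨t, l, rfl⟩
    · exact Or.inr <| Or.inr <| Or.inr <| Or.inl
        ⟨List.ofFn a, List.ofFn x, by simp [formulaQuery]⟩
    · exact Or.inr <| Or.inr <| Or.inr <| Or.inr <| Or.inl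
        ⟨List.ofFn a, List.ofFn x, _, _, _, _, b, (termValue_iff g).2 ⟨t₁, rfl, rfl⟩,
          (termValue_iff g).2 ⟨t₂, rfl, rfl⟩, by simp [formulaQuery]⟩
    · refine Or.inr <| Or.inr <| Or.inr <| Or.inr <| Or.inr <| Or.inl
        ⟨List.ofFn a, List.ofFn x, g.encRel _ R, List.ofFn fun i =>
          (termList g (varCode Fin.val _) (ts i), termVal g (Sum.elim a x) (ts i)), b,
          by simpa using (mem_symbolCodes_rel g).2 ⟨R, rfl⟩, ?_, ?_⟩
      · rintro ⟨z, hz, h⟩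
        obtain ⟨i, rfl⟩ := (List.mem_ofFn' _ _).1 hz
        exact h ((termValue_iff g).2 ⟨ts i, rfl, rfl⟩)
      · simp [formulaQuery, List.map_ofFn, Function.comp_def]
    · exact Or.inr <| Or.inr <| Or.inr <| Or.inr <| Or.inr <| Or.inr <| Or.inl
        ⟨List.ofFn a, List.ofFn x, _, _, by simpa using ⟨φ, rfl⟩, by simpa using ⟨ψ, rfl⟩,
          Or.inl (by simp [formulaQuery])⟩
    · exact Or.inr <| Or.inr <| Or.inr <| Or.inr <| Or.inr <| Or.inr <| Or.inl
        ⟨List.ofFn a, List.ofFn x, _, _, by simpa using ⟨φ, rfl⟩, by simpa using ⟨ψ, rfl⟩,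
          Or.inr (Or.inl (by simp [formulaQuery]))⟩
    · exact Or.inr <| Or.inr <| Or.inr <| Or.inr <| Or.inr <| Or.inr <| Or.inl
        ⟨List.ofFn a, List.ofFn x, _, _, by simpa using ⟨φ, rfl⟩, by simpa using ⟨ψ, rfl⟩,
          Or.inr (Or.inr (by simp [formulaQuery]))⟩
    · exact Or.inr <| Or.inr <| Or.inr <| Or.inr <| Or.inr <| Or.inr <| Or.inr <| Or.inl
        ⟨List.ofFn a, List.ofFn x, _, by simpa using ⟨φ, rfl⟩,
          Or.inl ⟨y, by simp only [formulaQuery, ofFn_snoc', formulaList_all, List.length_ofFn]⟩⟩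
    · exact Or.inr <| Or.inr <| Or.inr <| Or.inr <| Or.inr <| Or.inr <| Or.inr <| Or.inl
        ⟨List.ofFn a, List.ofFn x, _, by simpa using ⟨φ, rfl⟩,
          Or.inr (by simp only [formulaQuery, ofFn_snoc', formulaList_all, List.length_ofFn])⟩
    · exact Or.inr <| Or.inr <| Or.inr <| Or.inr <| Or.inr <| Or.inr <| Or.inr <| Or.inr <| Or.inl
        ⟨_, _, _, ⟨φ, v, rfl, rfl, h⟩, by simp [formulaQuery, List.map_ofFn, Function.comp_def]⟩
    · exact Or.inr <| Or.inr <| Or.inr <| Or.inr <| Or.inr <| Or.inr <| Or.inr <| Or.inr <|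
        Or.inr <| Or.inl ⟨i, x, h, rfl⟩
    · exact Or.inr <| Or.inr <| Or.inr <| Or.inr <| Or.inr <| Or.inr <| Or.inr <| Or.inr <|
        Or.inr <| Or.inr ⟨m, m', h, h', hne, rfl⟩
  · rintro (⟨x, rfl⟩ | ⟨t, l, rfl⟩ | ⟨t, l, rfl⟩ | ⟨as, bs, rfl⟩ |
      ⟨as, bs, c₁, c₂, y₁, y₂, b, h₁, h₂, rfl⟩ | ⟨as, bs, e, l, b, hs, hl, rfl⟩ |
      ⟨as, bs, l₁, l₂, h₁, h₂, h⟩ | ⟨as, bs, l₁, h₁, h⟩ |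
      ⟨k, p, ms, ⟨φ, v, rfl, rfl, h⟩, rfl⟩ | ⟨i, x, h, rfl⟩ | ⟨m, m', h, h', hne, rfl⟩)
    · exact .refl x
    · exact .congrQuery t l
    · exact .congrName t l
    · obtain ⟨k, a, rfl⟩ := exists_ofFn as
      obtain ⟨n, x, rfl⟩ := exists_ofFn bs
      simpa [formulaQuery] using IsClause.falsum (g := g) (B := B) (D := D) a x
    · obtain ⟨k, a, rfl⟩ := exists_ofFn as
      obtain ⟨n, x, rfl⟩ := exists_ofFn bs
      obtain ⟨t₁, rfl, rfl⟩ := (termValue_iff g).1 h₁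
      obtain ⟨t₂, rfl, rfl⟩ := (termValue_iff g).1 h₂
      simpa [formulaQuery] using IsClause.equal (g := g) (B := B) (D := D) a x t₁ t₂ b
    · obtain ⟨k, a, rfl⟩ := exists_ofFn as
      obtain ⟨n, x, rfl⟩ := exists_ofFn bs
      obtain ⟨R, rfl⟩ := (mem_symbolCodes_rel g).1 hs
      push Not at hl
      obtain ⟨ts, hts⟩ := exists_ofFn_of_forall_mem fun z hz => (termValue_iff g).1 (hl z hz)
      have := IsClause.rel (g := g) (B := B) (D := D) a x R ts b
      simp only [formulaQuery, formulaList_rel, fun i => (hts i).1, fun i => (hts i).2] at this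
      convert this using 1
      simp only [List.length_ofFn]
      congr 3
      · congr 3
        exact List.ext_get (by simp) (by simp)
      · congr 1
        exact List.ext_get (by simp) (by simp)
    · obtain ⟨k, a, rfl⟩ := exists_ofFn as
      obtain ⟨n, x, rfl⟩ := exists_ofFn bs
      simp only [List.length_ofFn] at h₁ h₂ h
      obtain ⟨φ, rfl⟩ := h₁
      obtain ⟨ψ, rfl⟩ := h₂
      rw [← formulaList_imp] at h
      rcases h with rfl | rfl | rfl
      · exact .imp a x φ ψ
      · exact .imp_left a x φ ψ
      · exact .imp_right a x φ ψ
    · obtain ⟨k, a, rfl⟩ := exists_ofFn as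
      obtain ⟨n, x, rfl⟩ := exists_ofFn bs
      simp only [List.length_ofFn, ← ofFn_snoc'] at h₁ h
      obtain ⟨φ, rfl⟩ := h₁
      rw [← formulaList_all] at h
      rcases h with ⟨y, rfl⟩ | rfl
      · exact .all a x φ y
      · exact .skolem a x φ
    · have := IsClause.diagram (g := g) (B := B) φ v h
      simpa [formulaQuery, List.map_ofFn, Function.comp_def] using this
    · exact .indep i x h
    · exact .base m m' h h' hne

theorem AFun.isClause {Y : Set ℕ} (hL : AFun Y fun n => n ∈ symbolCodes g)
    (hB : AFun Y fun n => n ∈ B)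
    (hD : AFun Y fun x : ℕ × List ℕ × List ℕ => IsInstance g D x.1 x.2.1 x.2.2) :
    AFun Y (IsClause g B D) := by
  have hT : AFun Y fun x : List ℕ × List ℕ × List ℕ × ℕ =>
      TermValue g x.1 x.2.1 x.2.2.1 x.2.2.2 :=
    .termValue hL (by fun_prop) (by fun_prop) (by fun_prop) (by fun_prop)
  have hF : AFun Y fun x : ℕ × ℕ × List ℕ => IsFormula g x.1 x.2.1 x.2.2 :=
    .isFormula hL (by fun_prop) (by fun_prop) (by fun_prop)
  have : AFun Y fun c => IsClause g B D c := by
    simp only [isClause_iff]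
    repeat' refine AFun.or ?_ ?_
    all_goals fun_prop
  exact this

end

/-! ### Satisfying the clauses in an infinite structure -/

/-- The value of a name, given the interpretation `G` of the roots. -/
def nameEval {N : Type*} (G : ℕ → List N → N) (x : ℕ) : N :=
  G x.unpair.1 ((Denumerable.ofNat (List ℕ) x.unpair.2).attach.map fun y => nameEval G y.1)
termination_by x
decreasing_by
  have h := lt_encode_of_mem y.2
  rw [Denumerable.encode_ofNat] at h
  exact h.trans_le (Nat.unpair_right_le x)

theorem nameEval_mk {N : Type*} (G : ℕ → List N → N) (t : ℕ) (ys : List ℕ) :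
    nameEval G (mk t ys) = G t (ys.map (nameEval G)) := by
  rw [nameEval]
  simp [mk]

theorem exists_forall_ne {N : Type*} [Infinite N] (e : (ℕ → N) → ℕ → N) (P : ℕ → ℕ → Prop)
    (he : ∀ i x, P i x → ∀ c y, e (Function.update c i y) x = e c x) (n : ℕ) :
    ∃ c : ℕ → N, ∀ i < n, ∀ x < n, P i x → c i ≠ e c x := by
  classical
  obtain ⟨A, hA⟩ := Infinite.exists_subset_card_eq N (n * n + 1)
  obtain ⟨a₀, -⟩ := Finset.card_pos.1 (by omega : 0 < A.card)
  let ext : (Fin n → A) → ℕ → N := fun c i => if h : i < n then c ⟨i, h⟩ else a₀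
  have ext_update (c : Fin n → A) (i : Fin n) (a : A) :
      ext (Function.update c i a) = Function.update (ext c) i a := by
    funext j
    by_cases hj : j < n
    · by_cases hij : j = i
      · subst hij
        simp [ext]
      · have : (⟨j, hj⟩ : Fin n) ≠ i := fun h => hij (by rw [← h])
        simp [ext, hj, Function.update_of_ne this, Function.update_of_ne hij]
    · have hij : j ≠ i := fun h => hj (h ▸ i.2)
      simp [ext, hj, Function.update_of_ne hij]
  let bad : Fin n × Fin n → Finset (Fin n → A) := fun p =>
    Finset.univ.filter fun c => P p.1 p.2 ∧ ext c p.1 = e (ext c) p.2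
  have card_bad (p) : (bad p).card * A.card ≤ Fintype.card (Fin n → A) := by
    rw [← Fintype.card_coe A, ← Fintype.card_coe, ← Fintype.card_prod]
    refine Fintype.card_le_of_injective (fun z : bad p × A => Function.update z.1.1 p.1 z.2) ?_
    rintro ⟨⟨c, hc⟩, a⟩ ⟨⟨c', hc'⟩, a'⟩ h
    simp only [bad, Finset.mem_filter, Finset.mem_univ, true_and] at hc hc'
    dsimp only at h
    have ha : a = a' := by simpa using congrFun h p.1
    have hcc : ext c p.1 = ext c' p.1 := by
      rw [hc.2, hc'.2, ← he _ _ hc.1 (ext c) a, ← he _ _ hc.1 (ext c') a', ← ext_update,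
        ← ext_update, h]
    have : c = c' := by
      funext j
      by_cases hj : j = p.1
      · subst hj
        simpa [ext] using hcc
      · simpa [hj] using congrFun h j
    simp [ha, this]
  by_contra! hall
  have hcover : (Finset.univ : Finset (Fin n → A)) ⊆ Finset.univ.biUnion bad := by
    intro c _
    obtain ⟨i, hi, x, hx, hP, h⟩ := hall (ext c)
    exact Finset.mem_biUnion.2 ⟨(⟨i, hi⟩, ⟨x, hx⟩), Finset.mem_univ _, by simp [bad, hP, h]⟩
  have h1 := (Finset.card_le_card hcover).trans Finset.card_biUnion_le
  have h2 : (∑ p, (bad p).card) * A.card ≤ (n * n) * Fintype.card (Fin n → A) := by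
    rw [Finset.sum_mul]
    exact (Finset.sum_le_sum fun p _ => card_bad p).trans (by simp)
  have hpos : 0 < Fintype.card (Fin n → A) :=
    Fintype.card_pos_iff.2 ⟨fun _ => ⟨(Finset.card_pos.1 (by omega : 0 < A.card)).choose,
      (Finset.card_pos.1 (by omega : 0 < A.card)).choose_spec⟩⟩
  have h3 := (Nat.mul_le_mul_right A.card h1).trans h2
  rw [Finset.card_univ, hA] at h3
  nlinarith

theorem formulaList_append_inj (g : GoedelCoding L) {N : Type*} {k n n' : ℕ} {φ : L.BoundedFormula (Fin k) n}
    {φ' : L.BoundedFormula (Fin k) n'} {v v' : Fin k → N} {xs : Fin n → N} {xs' : Fin n' → N}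
    (h : formulaList g Fin.val φ = formulaList g Fin.val φ')
    (hv : List.ofFn v ++ List.ofFn xs = List.ofFn v' ++ List.ofFn xs') :
    v = v' ∧ ∃ h : n = n', h ▸ xs = xs' ∧ h ▸ φ = φ' := by
  obtain ⟨h1, h2⟩ := List.append_inj hv (by simp)
  obtain rfl : n = n' := by simpa using congrArg List.length h2
  exact ⟨List.ofFn_injective h1, rfl, List.ofFn_injective h2,
    formulaList_injective g Fin.val_injective h⟩

section
variable (g : GoedelCoding L) {N : Type*} [L.Structure N]

/-- The root with code `t` holds of `as` in the structure `N`. -/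
def RootHolds (t : ℕ) (as : List N) : Prop :=
  (t = Nat.pair 0 0 ∧ ∃ y, as = [y, y]) ∨
  (∃ (m : ℕ) (R : L.Relations m) (v : Fin m → N), t = Nat.pair 1 (Nat.pair m (g.encRel m R)) ∧
    as = List.ofFn v ∧ Structure.RelMap R v) ∨
  ∃ (k n : ℕ) (φ : L.BoundedFormula (Fin k) n) (v : Fin k → N) (xs : Fin n → N),
    t = Nat.pair 2 (Nat.pair k (Encodable.encode (formulaList g Fin.val φ))) ∧
    as = List.ofFn v ++ List.ofFn xs ∧ φ.Realize v xs

theorem rootHolds_eq {x y : N} : RootHolds g (Nat.pair 0 0) [x, y] ↔ x = y := by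
  simp [RootHolds, Nat.pair_eq_pair, eq_comm]

theorem rootHolds_rel {m : ℕ} {R : L.Relations m} {v : Fin m → N} :
    RootHolds g (Nat.pair 1 (Nat.pair m (g.encRel m R))) (List.ofFn v) ↔
      Structure.RelMap R v := by
  constructor
  · rintro (⟨h, -⟩ | ⟨m', R', v', h, hv, hR⟩ | ⟨k, n, φ, v', xs, h, -⟩)
    · simp [Nat.pair_eq_pair] at h
    · simp only [Nat.pair_eq_pair, true_and] at h
      obtain ⟨rfl, h⟩ := h
      rwa [List.ofFn_injective hv, g.encRel_inj _ h]
    · simp [Nat.pair_eq_pair] at h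
  · exact fun h => Or.inr (Or.inl ⟨m, R, v, rfl, rfl, h⟩)

theorem rootHolds_formula {k n : ℕ} {φ : L.BoundedFormula (Fin k) n} {v : Fin k → N}
    {xs : Fin n → N} :
    RootHolds g (Nat.pair 2 (Nat.pair k (Encodable.encode (formulaList g Fin.val φ))))
      (List.ofFn v ++ List.ofFn xs) ↔ φ.Realize v xs := by
  constructor
  · rintro (⟨h, -⟩ | ⟨m', R', v', h, hv, hR⟩ | ⟨k', n', φ', v', xs', h, hv, hR⟩)
    · simp [Nat.pair_eq_pair] at h
    · simp [Nat.pair_eq_pair] at h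
    · simp only [Nat.pair_eq_pair, true_and, Encodable.encode_inj] at h
      obtain ⟨rfl, h⟩ := h
      obtain ⟨rfl, rfl, rfl, rfl⟩ := formulaList_append_inj g h hv
      exact hR
  · exact fun h => Or.inr (Or.inr ⟨k, n, φ, v, xs, rfl, rfl, h⟩)

theorem exists_rootFun [Nonempty N] (b : ℕ → N) : ∃ G : ℕ → List N → N,
    (∀ m as, G (Nat.pair 1 m) as = b m) ∧
    (∀ (m : ℕ) (f : L.Functions m) (v : Fin m → N),
      G (Nat.pair 2 (Nat.pair m (g.encFun m f))) (List.ofFn v) = Structure.funMap f v) ∧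
    ∀ (k n : ℕ) (φ : L.BoundedFormula (Fin k) (n + 1)) (v : Fin k → N) (xs : Fin n → N),
      φ.Realize v (Fin.snoc xs
        (G (Nat.pair 3 (Nat.pair k (Encodable.encode (formulaList g Fin.val φ))))
          (List.ofFn v ++ List.ofFn xs))) → φ.all.Realize v xs := by
  suffices ∀ t as, ∃ y : N, (∀ m, t = Nat.pair 1 m → y = b m) ∧
      (∀ (m : ℕ) (f : L.Functions m) (v : Fin m → N),
        t = Nat.pair 2 (Nat.pair m (g.encFun m f)) → as = List.ofFn v → y = Structure.funMap f v) ∧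
      ∀ (k n : ℕ) (φ : L.BoundedFormula (Fin k) (n + 1)) (v : Fin k → N) (xs : Fin n → N),
        t = Nat.pair 3 (Nat.pair k (Encodable.encode (formulaList g Fin.val φ))) →
        as = List.ofFn v ++ List.ofFn xs → φ.Realize v (Fin.snoc xs y) → φ.all.Realize v xs by
    choose G hG using this
    exact ⟨G, fun m as => (hG _ as).1 m rfl, fun m f v => (hG _ _).2.1 m f v rfl rfl,
      fun k n φ v xs => (hG _ _).2.2 k n φ v xs rfl rfl⟩
  intro t as
  by_cases h1 : ∃ m, t = Nat.pair 1 m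
  · obtain ⟨m, rfl⟩ := h1
    refine ⟨b m, ?_, ?_, ?_⟩
    · rintro m' h
      rw [(Nat.pair_eq_pair.1 h).2]
    all_goals simp [Nat.pair_eq_pair]
  by_cases h2 : ∃ (m : ℕ) (f : L.Functions m) (v : Fin m → N),
      t = Nat.pair 2 (Nat.pair m (g.encFun m f)) ∧ as = List.ofFn v
  · obtain ⟨m, f, v, rfl, rfl⟩ := h2
    refine ⟨Structure.funMap f v, by simp [Nat.pair_eq_pair], ?_, by simp [Nat.pair_eq_pair]⟩
    intro m' f' v' h hv
    simp only [Nat.pair_eq_pair, true_and] at h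
    obtain ⟨rfl, h⟩ := h
    rw [List.ofFn_injective hv, g.encFun_inj _ h]
  by_cases h3 : ∃ (k n : ℕ) (φ : L.BoundedFormula (Fin k) (n + 1)) (v : Fin k → N) (xs : Fin n → N),
      t = Nat.pair 3 (Nat.pair k (Encodable.encode (formulaList g Fin.val φ))) ∧
      as = List.ofFn v ++ List.ofFn xs ∧ ¬ φ.all.Realize v xs
  · obtain ⟨k, n, φ, v, xs, rfl, rfl, h⟩ := h3
    rw [BoundedFormula.realize_all, not_forall] at h
    obtain ⟨y, hy⟩ := h
    refine ⟨y, by simp [Nat.pair_eq_pair], by simp [Nat.pair_eq_pair], ?_⟩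
    intro k' n' φ' v' xs' h hv hR
    simp only [Nat.pair_eq_pair, true_and, Encodable.encode_inj] at h
    obtain ⟨rfl, h⟩ := h
    obtain ⟨h5, h6⟩ := List.append_inj hv (by simp)
    obtain rfl : n = n' := by simpa using congrArg List.length h6
    obtain rfl := List.ofFn_injective h5
    obtain rfl := List.ofFn_injective h6
    obtain rfl := formulaList_injective g Fin.val_injective h
    exact absurd hR hy
  · refine ⟨Classical.arbitrary N, fun m h => absurd ⟨m, h⟩ h1,
      fun m f v h hv => absurd ⟨m, f, v, h, hv⟩ h2, fun k n φ v xs h hv _ => ?_⟩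
    by_contra hR
    exact h3 ⟨k, n, φ, v, xs, h, hv, hR⟩

theorem exists_satisfies [Infinite N] {B : Set ℕ}
    {D : ∀ k, L.Formula (Fin k) → (Fin k → ℕ) → Prop} (b : ℕ → N) (hb : Set.InjOn b B)
    (hD : ∀ k φ v, D k φ v → φ.Realize fun i => b (v i)) (n : ℕ) :
    ∃ f : ℕ → Bool, ∀ c, IsClause g B D c → (∀ l ∈ c, l.1 < n) → ∃ l ∈ c, f l.1 = l.2 := by
  classical
  obtain ⟨G, hb', hfun, hsk⟩ := exists_rootFun g b
  let root (c : ℕ → N) (t : ℕ) (as : List N) : N := if t.unpair.1 = 0 then c t.unpair.2 else G t as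
  let e (c : ℕ → N) : ℕ → N := nameEval (root c)
  have e_mk (c t ys) : e c (mk t ys) = root c t (ys.map (e c)) := nameEval_mk _ _ _
  have he (i x : ℕ) (h : ¬ Occurs i x) (c : ℕ → N) (y : N) :
      e (Function.update c i y) x = e c x := by
    induction x using Nat.strong_induction_on with
    | _ x ih =>
      obtain ⟨t, ys, rfl⟩ := exists_mk x
      simp only [occurs_mk, not_or, not_exists, not_and] at h
      have hys : ys.map (e (Function.update c i y)) = ys.map (e c) :=
        List.map_congr_left fun z hz => ih z (lt_mk_of_mem hz) (h.2 z hz)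
      rw [e_mk, e_mk, hys]
      by_cases ht : t.unpair.1 = 0
      · have : t.unpair.2 ≠ i := fun h' => h.1 (by rw [← h', ← ht, Nat.pair_unpair])
        simp [root, ht, this]
      · simp [root, ht]
  obtain ⟨c, hc⟩ := exists_forall_ne e (fun i x => ¬ Occurs i x) he n
  let f (q : ℕ) : Bool := decide (∃ t ys, q = mk t ys ∧ RootHolds g t (ys.map (e c)))
  have hf (t ys) : f (mk t ys) = true ↔ RootHolds g t (ys.map (e c)) := by
    simp only [f, mk_inj, decide_eq_true_eq]
    exact ⟨fun ⟨_, _, ⟨rfl, rfl⟩, h⟩ => h, fun h => ⟨_, _, ⟨rfl, rfl⟩, h⟩⟩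
  have hfe (x y) : f (eqQuery x y) = true ↔ e c x = e c y := by
    rw [eqQuery, hf]; exact rootHolds_eq g
  have hfR {m} (R : L.Relations m) (x : Fin m → ℕ) :
      f (relQuery m (g.encRel m R) (List.ofFn x)) = true ↔
        Structure.RelMap R fun i => e c (x i) := by
    rw [relQuery, hf, List.map_ofFn]; exact rootHolds_rel g
  have hfq {k n} (φ : L.BoundedFormula (Fin k) n) (a : Fin k → ℕ) (x : Fin n → ℕ) :
      f (formulaQuery g φ a x) = true ↔ φ.Realize (fun i => e c (a i)) fun i => e c (x i) := by
    rw [formulaQuery, codeQuery, hf, List.map_append, List.map_ofFn, List.map_ofFn]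
    exact rootHolds_formula g
  have hcst (i) : e c (cstName i) = c i := by simp [cstName, e_mk, root]
  have hbase (m) : e c (baseName m) = b m := by simp [baseName, e_mk, root, hb']
  have hterm {k n} (a : Fin k → ℕ) (x : Fin n → ℕ) (t : L.Term (Fin k ⊕ Fin n)) :
      e c (termVal g (Sum.elim a x) t) =
        t.realize (Sum.elim (fun i => e c (a i)) fun i => e c (x i)) := by
    induction t with
    | var v => cases v <;> rfl
    | func F ts ih =>
      rw [termVal, e_mk]
      simp only [root, Nat.unpair_pair, List.map_ofFn, Function.comp_def, ih]
      exact hfun _ _ _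
  have hcongr (l : List (ℕ × ℕ)) (h : ∀ p ∈ l, f (eqQuery p.1 p.2) = true) :
      (l.map Prod.fst).map (e c) = (l.map Prod.snd).map (e c) := by
    rw [List.map_map, List.map_map]
    exact List.map_congr_left fun p hp => (hfe _ _).1 (h p hp)
  have hsnoc {m : ℕ} (x : Fin m → ℕ) (y : ℕ) :
      (fun i => e c ((Fin.snoc x y : Fin (m + 1) → ℕ) i)) = Fin.snoc (fun i => e c (x i)) (e c y) :=
    Fin.comp_snoc (e c) x y
  have hnot {q : ℕ} : f q = false ↔ ¬ f q = true := by simp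
  refine ⟨f, fun C hC hn => ?_⟩
  by_contra! hall
  induction hC with
  | refl x => exact hall _ (List.mem_singleton_self _) ((hfe x x).2 rfl)
  | congrQuery t l =>
    simp only [List.mem_append, List.mem_map, List.mem_cons, List.not_mem_nil, or_false, ne_eq,
      or_imp, forall_and, forall_eq, forall_exists_index, and_imp, forall_apply_eq_imp_iff₂,
      Bool.not_eq_false] at hall
    rw [hf, hf, hcongr l hall.1] at hall
    exact hall.2.2 hall.2.1
  | congrName t l =>
    simp only [List.mem_append, List.mem_map, List.mem_cons, List.not_mem_nil, or_false, ne_eq,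
      or_imp, forall_and, forall_eq, forall_exists_index, and_imp, forall_apply_eq_imp_iff₂,
      Bool.not_eq_false] at hall
    rw [hfe, e_mk, e_mk, hcongr l hall.1] at hall
    exact hall.2 rfl
  | falsum a x =>
    simp only [List.mem_cons, List.not_mem_nil, or_false, ne_eq, forall_eq, hfq, hnot,
      not_not] at hall
    exact hall
  | equal a x t₁ t₂ b =>
    have key : f (formulaQuery g (.equal t₁ t₂) a x) = true ↔
        f (eqQuery (termVal g (Sum.elim a x) t₁) (termVal g (Sum.elim a x) t₂)) = true := by
      rw [hfq, hfe, hterm, hterm]; rfl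
    simp only [List.mem_cons, List.not_mem_nil, or_false, ne_eq, forall_eq_or_imp,
      forall_eq] at hall
    cases b <;> simp_all
  | @rel k _ m a x R ts b =>
    have key : f (formulaQuery g (.rel R ts) a x) = true ↔
        f (relQuery m (g.encRel m R) (List.ofFn fun i => termVal g (Sum.elim a x) (ts i))) =
          true := by
      rw [hfq, hfR]
      simp only [hterm]
      rfl
    simp only [List.mem_cons, List.not_mem_nil, or_false, ne_eq, forall_eq_or_imp,
      forall_eq] at hall
    cases b <;> simp_all
  | imp a x φ ψ =>
    simp only [List.mem_cons, List.not_mem_nil, or_false, ne_eq, forall_eq_or_imp,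
      forall_eq, hfq, hnot, not_not] at hall
    exact hall.2.2 (hall.1 hall.2.1)
  | imp_left a x φ ψ =>
    simp only [List.mem_cons, List.not_mem_nil, or_false, ne_eq, forall_eq_or_imp,
      forall_eq, hfq] at hall
    exact hall.1 fun h => absurd h hall.2
  | imp_right a x φ ψ =>
    simp only [List.mem_cons, List.not_mem_nil, or_false, ne_eq, forall_eq_or_imp,
      forall_eq, hfq, hnot, not_not] at hall
    exact hall.1 fun _ => hall.2
  | all a x φ y =>
    simp only [List.mem_cons, List.not_mem_nil, or_false, ne_eq, forall_eq_or_imp,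
      forall_eq, hfq, hnot, not_not] at hall
    exact hall.2 (by rw [hsnoc]; exact hall.1 (e c y))
  | skolem a x φ =>
    simp only [List.mem_cons, List.not_mem_nil, or_false, ne_eq, forall_eq_or_imp,
      forall_eq, hfq, hnot, not_not] at hall
    rw [hsnoc, skolemName, e_mk, List.map_append, List.map_ofFn, List.map_ofFn] at hall
    simp only [root, Nat.unpair_pair] at hall
    exact hall.1 (hsk _ _ φ _ _ hall.2)
  | diagram φ v h =>
    simp only [List.mem_cons, List.not_mem_nil, or_false, ne_eq, forall_eq, hfq, hbase] at hall
    rw [Subsingleton.elim (fun i => e c ((default : Fin 0 → ℕ) i)) default] at hall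
    exact hall (hD _ φ v h)
  | indep i x h =>
    simp only [List.mem_cons, List.not_mem_nil, or_false, ne_eq, forall_eq, hnot, not_not, hfe,
      hcst] at hall hn
    have hlt : cstName i < n ∧ x < n :=
      ⟨(lt_mk_of_mem (by simp)).trans hn, (lt_mk_of_mem (by simp)).trans hn⟩
    have hi : i ≤ cstName i := by
      rw [cstName, mk]
      exact (Nat.right_le_pair 0 i).trans (Nat.left_le_pair _ _)
    exact hc i (hi.trans_lt hlt.1) x hlt.2 h hall
  | base m m' h h' hne =>
    simp only [List.mem_cons, List.not_mem_nil, or_false, ne_eq, forall_eq, hnot, not_not, hfe,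
      hbase] at hall
    exact hne (hb h h' hall)

end

/-! ### Representing classes of names by natural numbers -/

theorem AFun.of_isArithmetical {X : Set ℕ} (hX : IsArithmetical X) (Y : Set ℕ) :
    AFun Y fun n => n ∈ X :=
  aFun_mem_iff.2 (hX.reducible Y)

theorem AFun.of_empty {f : ℕ → ℕ} (hf : AFun ∅ f) (Y : Set ℕ) : AFun Y f := by
  have h : AFun ∅ fun n => n ∈ {n : ℕ | ∃ x y, n = Nat.pair x y ∧ f x = y} := by
    simp only [Set.mem_ofPred_eq]
    fun_prop
  have h' := AFun.of_isArithmetical (aFun_mem_iff.1 h) Y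
  refine AFun.of_graph_iff (p := fun z => Nat.pair z.1 z.2 ∈
    {n : ℕ | ∃ x y, n = Nat.pair x y ∧ f x = y}) ?_ ?_
  · exact AFun.comp (f := fun n => n ∈ {n : ℕ | ∃ x y, n = Nat.pair x y ∧ f x = y}) h'
      (g := fun z : ℕ × ℕ => Nat.pair z.1 z.2) (by fun_prop)
  · intro a b
    constructor
    · rintro rfl
      exact ⟨a, _, rfl, rfl⟩
    · rintro ⟨x, y, h, rfl⟩
      dsimp only at h
      rw [(Nat.pair_eq_pair.1 h).1, (Nat.pair_eq_pair.1 h).2]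

section
variable {Y : Set ℕ}

theorem AFun.count {α : Type*} [Primcodable α] {p : ℕ → Prop} [inst : DecidablePred p] (hp : AFun Y p) {f : α → ℕ}
    (hf : AFun Y f) : AFun Y fun x => Nat.count p (f x) := by
  obtain rfl : inst = fun _ => Classical.propDecidable _ := Subsingleton.elim _ _
  classical
  have key (n : ℕ) : Nat.count p n =
      ((List.range n).map fun w => if p w then [0] else ([] : List ℕ)).flatten.length := by
    induction n with
    | zero => simp
    | succ n ih => by_cases h : p n <;> simp [Nat.count_succ, List.range_succ, ih, h]
  have hr : AFun Y fun x => List.range (f x) :=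
    AFun.comp (f := List.range) (.of_primrec Primrec.list_range) hf
  have hp' : AFun Y fun x : α × ℕ => p x.2 := AFun.comp (f := p) hp (by fun_prop)
  simp only [key]
  fun_prop

theorem exists_representatives {B : Set ℕ} (hB : AFun Y fun n => n ∈ B) (hBc : (Bᶜ : Set ℕ).Infinite)
    {E : ℕ → ℕ → Prop} (hE : AFun Y fun x : ℕ × ℕ => E x.1 x.2) (hEq : Equivalence E)
    (hBE : ∀ m ∈ B, ∀ m' ∈ B, E (baseName m) (baseName m') → m = m') :
    ∃ r : ℕ → ℕ, AFun Y r ∧ (∀ x y, r x = r y ↔ E x y) ∧ (∀ m ∈ B, r (baseName m) = m) ∧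
      ((Set.range r)ᶜ : Set ℕ).Infinite := by
  classical
  have hinf : {n | n ∉ B}.Infinite := hBc
  let s : ℕ → ℕ := Nat.nth fun n => n ∉ B
  have hs_mem (k) : s k ∉ B := Nat.nth_mem_of_infinite hinf k
  have hs_inj : Function.Injective s := Nat.nth_injective hinf
  have hs : AFun Y s := by
    have hc : AFun Y fun z : ℕ × ℕ => Nat.count (fun n => n ∉ B) z.2 :=
      AFun.count (p := fun n => n ∉ B) (by fun_prop) (f := fun z : ℕ × ℕ => z.2) (by fun_prop)
    refine AFun.of_graph_iff (p := fun z => ¬ z.2 ∈ B ∧ Nat.count (fun n => n ∉ B) z.2 = z.1)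
      (by fun_prop) fun k z => ⟨?_, ?_⟩
    · rintro rfl
      exact ⟨hs_mem k, Nat.count_nth_of_infinite hinf k⟩
    · rintro ⟨hz, hk⟩
      rw [← show _ = k from hk]
      exact Nat.nth_count hz
  let r (x : ℕ) : ℕ := if ∃ m, m ∈ B ∧ E x (baseName m) then sInf {m | m ∈ B ∧ E x (baseName m)}
    else s (2 * sInf {y | E y x})
  have hr_pos {x m : ℕ} (hm : m ∈ B) (h : E x (baseName m)) : r x = m := by
    have h0 : ∃ m, m ∈ B ∧ E x (baseName m) := ⟨m, hm, h⟩
    have h1 := Nat.sInf_mem (s := {m | m ∈ B ∧ E x (baseName m)}) h0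
    simp only [r, if_pos h0]
    exact hBE _ h1.1 _ hm (hEq.trans (hEq.symm h1.2) h)
  have hr_neg {x : ℕ} (h : ¬ ∃ m, m ∈ B ∧ E x (baseName m)) : r x = s (2 * sInf {y | E y x}) :=
    if_neg h
  refine ⟨r, ?_, fun x y => ⟨fun h => ?_, fun h => ?_⟩, fun m hm => hr_pos hm (hEq.refl _), ?_⟩
  · have h1 : AFun Y fun x => sInf {m | m ∈ B ∧ E x (baseName m)} := by
      refine AFun.sInf (p := fun x m => m ∈ B ∧ E x (baseName m)) ?_
      fun_prop
    have h2 : AFun Y fun x => sInf {y | E y x} := by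
      refine AFun.sInf (p := fun x y => E y x) ?_
      fun_prop
    fun_prop
  · by_cases hx : ∃ m, m ∈ B ∧ E x (baseName m) <;> by_cases hy : ∃ m, m ∈ B ∧ E y (baseName m)
    · obtain ⟨m, hm, hx⟩ := hx
      obtain ⟨m', hm', hy⟩ := hy
      rw [hr_pos hm hx, hr_pos hm' hy] at h
      exact hEq.trans hx (h ▸ hEq.symm hy)
    · obtain ⟨m, hm, hx⟩ := hx
      rw [hr_pos hm hx, hr_neg hy] at h
      exact absurd (h ▸ hm) (hs_mem _)
    · obtain ⟨m, hm, hy⟩ := hy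
      rw [hr_pos hm hy, hr_neg hx] at h
      exact absurd (h ▸ hm) (hs_mem _)
    · rw [hr_neg hx, hr_neg hy] at h
      have h' : sInf {z | E z x} = sInf {z | E z y} := by
        have := hs_inj h
        omega
      have h1 := Nat.sInf_mem (s := {z | E z x}) ⟨x, hEq.refl x⟩
      have h2 := Nat.sInf_mem (s := {z | E z y}) ⟨y, hEq.refl y⟩
      rw [h'] at h1
      exact hEq.trans (hEq.symm h1) h2
  · have h1 (z) : E x z ↔ E y z := ⟨hEq.trans (hEq.symm h), hEq.trans h⟩
    have h2 (z) : E z x ↔ E z y := ⟨fun h' => hEq.trans h' h, fun h' => hEq.trans h' (hEq.symm h)⟩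
    simp only [r, h1, h2]
  · refine Set.infinite_of_injective_forall_mem (f := fun k => s (2 * k + 1)) ?_ ?_
    · intro k k' h
      have := hs_inj h
      omega
    · rintro k ⟨x, hx⟩
      by_cases h : ∃ m, m ∈ B ∧ E x (baseName m)
      · obtain ⟨m, hm, h⟩ := h
        rw [hr_pos hm h] at hx
        exact hs_mem _ (hx ▸ hm)
      · rw [hr_neg h] at hx
        have := hs_inj hx
        omega

end

/-! ### The structure of classes of names -/

section
variable {g : GoedelCoding L} {B : Set ℕ} {D : ∀ k, L.Formula (Fin k) → (Fin k → ℕ) → Prop}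
  {F : ℕ → Prop}

/-- The assignment `F` satisfies each of the clauses `IsClause g B D`. -/
def Satisfies (g : GoedelCoding L) (B : Set ℕ)
    (D : ∀ k, L.Formula (Fin k) → (Fin k → ℕ) → Prop) (F : ℕ → Prop) : Prop :=
  ∀ c, IsClause g B D c → ∃ l ∈ c, (F l.1 ↔ l.2 = true)

namespace Satisfies

theorem of_congrQuery (hF : Satisfies g B D F) {t : ℕ} {l : List (ℕ × ℕ)}
    (hl : ∀ p ∈ l, F (eqQuery p.1 p.2)) (h : F (mk t (l.map Prod.fst))) :
    F (mk t (l.map Prod.snd)) := by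
  obtain ⟨q, hq, h'⟩ := hF _ (.congrQuery t l)
  simp only [List.mem_append, List.mem_map, List.mem_cons, List.not_mem_nil, or_false] at hq
  rcases hq with ⟨p, hp, rfl⟩ | rfl | rfl
  · exact absurd (h'.1 (hl p hp)) (by simp)
  · exact absurd (h'.1 h) (by simp)
  · exact h'.2 rfl

theorem of_congrName (hF : Satisfies g B D F) {t : ℕ} {l : List (ℕ × ℕ)}
    (hl : ∀ p ∈ l, F (eqQuery p.1 p.2)) :
    F (eqQuery (mk t (l.map Prod.fst)) (mk t (l.map Prod.snd))) := by
  obtain ⟨q, hq, h'⟩ := hF _ (.congrName t l)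
  simp only [List.mem_append, List.mem_map, List.mem_cons, List.not_mem_nil, or_false] at hq
  rcases hq with ⟨p, hp, rfl⟩ | rfl
  · exact absurd (h'.1 (hl p hp)) (by simp)
  · exact h'.2 rfl

theorem equivalence (hF : Satisfies g B D F) : Equivalence fun x y => F (eqQuery x y) := by
  have refl (x : ℕ) : F (eqQuery x x) := by simpa using hF _ (.refl x)
  refine ⟨refl, fun {x y} h => ?_, fun {x y z} h h' => ?_⟩
  · exact hF.of_congrQuery (t := Nat.pair 0 0) (l := [(x, y), (x, x)]) (by simp [h, refl]) (refl x)
  · exact hF.of_congrQuery (t := Nat.pair 0 0) (l := [(x, x), (y, z)]) (by simp [h', refl]) h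

theorem base (hF : Satisfies g B D F) {m m' : ℕ} (hm : m ∈ B) (hm' : m' ∈ B)
    (h : F (eqQuery (baseName m) (baseName m'))) : m = m' := by
  by_contra hne
  simpa [h] using hF _ (.base m m' hm hm' hne)

theorem occurs (hF : Satisfies g B D F) {i x : ℕ} (h : F (eqQuery (cstName i) x)) : Occurs i x := by
  by_contra hi
  simpa [h] using hF _ (.indep i x hi)

variable {r : ℕ → ℕ}

theorem exists_zip {ys ys' : List ℕ} (h : ys.map r = ys'.map r) :
    ∃ l : List (ℕ × ℕ), l.map Prod.fst = ys ∧ l.map Prod.snd = ys' ∧ ∀ p ∈ l, r p.1 = r p.2 := by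
  induction ys generalizing ys' with
  | nil => exact ⟨[], rfl, by simpa [eq_comm] using h, by simp⟩
  | cons y ys ih =>
    cases ys' with
    | nil => simp at h
    | cons y' ys' =>
      simp only [List.map_cons, List.cons.injEq] at h
      obtain ⟨l, rfl, rfl, hl⟩ := ih h.2
      exact ⟨(y, y') :: l, rfl, rfl, by simpa [h.1] using hl⟩

theorem query_congr (hF : Satisfies g B D F) (hr : ∀ x y, r x = r y ↔ F (eqQuery x y)) {t : ℕ}
    {ys ys' : List ℕ} (h : ys.map r = ys'.map r) : F (mk t ys) ↔ F (mk t ys') := by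
  suffices ∀ {ys ys' : List ℕ}, ys.map r = ys'.map r → F (mk t ys) → F (mk t ys') from
    ⟨this h, this h.symm⟩
  intro ys ys' h hy
  obtain ⟨l, rfl, rfl, hl⟩ := exists_zip h
  exact hF.of_congrQuery (fun p hp => (hr _ _).1 (hl p hp)) hy

theorem name_congr (hF : Satisfies g B D F) (hr : ∀ x y, r x = r y ↔ F (eqQuery x y)) {t : ℕ}
    {ys ys' : List ℕ} (h : ys.map r = ys'.map r) : r (mk t ys) = r (mk t ys') := by
  obtain ⟨l, rfl, rfl, hl⟩ := exists_zip h
  exact (hr _ _).2 (hF.of_congrName fun p hp => (hr _ _).1 (hl p hp))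

end Satisfies

/-- The set `W` of names is closed under forming names with a root that is not a constant. -/
def IsClosedNames (W : Set ℕ) : Prop :=
  ∀ t ys, t.unpair.1 ≠ 0 → (∀ y ∈ ys, y ∈ W) → mk t ys ∈ W

/-- A name in `W` of an element of the image of `W` under `r`. -/
noncomputable def nameOf (r : ℕ → ℕ) (W : Set ℕ) (z : ↥(r '' W)) : ℕ := z.2.choose

theorem nameOf_mem (r : ℕ → ℕ) (W : Set ℕ) (z : ↥(r '' W)) : nameOf r W z ∈ W :=
  z.2.choose_spec.1

theorem map_nameOf (r : ℕ → ℕ) (W : Set ℕ) (z : ↥(r '' W)) : r (nameOf r W z) = z :=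
  z.2.choose_spec.2

/-- The element named by a name in `W`. -/
def elemOf (r : ℕ → ℕ) (W : Set ℕ) (x : W) : ↥(r '' W) := ⟨r x, x, x.2, rfl⟩

/-- The structure described by `F` on the image of `W` under `r`. -/
noncomputable abbrev nameStructure (g : GoedelCoding L) (F : ℕ → Prop) (r : ℕ → ℕ) {W : Set ℕ}
    (hW : IsClosedNames W) : L.Structure ↥(r '' W) where
  funMap := fun {m} f v => elemOf r W ⟨mk (Nat.pair 2 (Nat.pair m (g.encFun m f)))
    (List.ofFn fun i => nameOf r W (v i)), hW _ _ (by simp) fun y hy => by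
      obtain ⟨i, rfl⟩ := (List.mem_ofFn' _ _).1 hy
      exact nameOf_mem r W _⟩
  RelMap := fun {m} R v => F (relQuery m (g.encRel m R) (List.ofFn fun i => nameOf r W (v i)))

variable {r : ℕ → ℕ} {W : Set ℕ}

theorem elemOf_surjective : Function.Surjective (elemOf r W) := by
  rintro ⟨_, x, hx, rfl⟩
  exact ⟨⟨x, hx⟩, rfl⟩

theorem realize_term (hF : Satisfies g B D F) (hr : ∀ x y, r x = r y ↔ F (eqQuery x y))
    (hW : IsClosedNames W) {α : Type} (v : α → W) (t : L.Term α) :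
    letI := nameStructure g F r hW
    ((t.realize fun a => elemOf r W (v a) : ↥(r '' W)) : ℕ) =
      r (termVal g (fun a => (v a : ℕ)) t) := by
  let _ := nameStructure g F r hW
  induction t with
  | var a => rfl
  | func f ts ih =>
    refine hF.name_congr hr ?_
    simp only [List.map_ofFn, Function.comp_def, map_nameOf, ih]

theorem realize_iff (hF : Satisfies g B D F) (hr : ∀ x y, r x = r y ↔ F (eqQuery x y))
    (hW : IsClosedNames W) {k n : ℕ} (φ : L.BoundedFormula (Fin k) n) (a : Fin k → W)
    (x : Fin n → W) :
    letI := nameStructure g F r hW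
    (φ.Realize (fun i => elemOf r W (a i)) fun i => elemOf r W (x i)) ↔
      F (formulaQuery g φ (fun i => (a i : ℕ)) fun i => (x i : ℕ)) := by
  let _ := nameStructure g F r hW
  have hterm {n : ℕ} (x : Fin n → W) (t : L.Term (Fin k ⊕ Fin n)) :
      ((t.realize (Sum.elim (fun i => elemOf r W (a i)) fun i => elemOf r W (x i)) :
        ↥(r '' W)) : ℕ) = r (termVal g (Sum.elim (fun i => (a i : ℕ)) fun i => (x i : ℕ)) t) := by
    have h := realize_term hF hr hW (Sum.elim a x) t
    convert h using 3
    · funext i; cases i <;> rfl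
    · funext i; cases i <;> rfl
  change (φ.Realize (fun i => elemOf r W (a i)) fun i => elemOf r W (x i)) ↔ F (formulaQuery g φ _ _)
  induction φ with
  | falsum =>
    have h := hF _ (.falsum (fun i => (a i : ℕ)) fun i => (x i : ℕ))
    exact iff_of_false id (by simpa using h)
  | equal t₁ t₂ =>
    have h := fun b => hF _ (.equal (fun i => (a i : ℕ)) (fun i => (x i : ℕ)) t₁ t₂ b)
    have h1 := h true
    have h2 := h false
    simp at h1 h2
    change t₁.realize _ = t₂.realize _ ↔ _
    rw [Subtype.ext_iff, hterm, hterm, hr]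
    tauto
  | rel R ts =>
    have h := fun b => hF _ (.rel (fun i => (a i : ℕ)) (fun i => (x i : ℕ)) R ts b)
    have h1 := h true
    have h2 := h false
    simp at h1 h2
    change F (relQuery _ _ _) ↔ _
    rw [relQuery, hF.query_congr hr (ys' := List.ofFn fun i => termVal g
      (Sum.elim (fun i => (a i : ℕ)) fun i => (x i : ℕ)) (ts i))]
    · rw [relQuery] at h1 h2
      tauto
    · simp only [List.map_ofFn, Function.comp_def, map_nameOf, hterm]
  | imp φ ψ ihφ ihψ =>
    have h1 := hF _ (.imp (fun i => (a i : ℕ)) (fun i => (x i : ℕ)) φ ψ)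
    have h2 := hF _ (.imp_left (fun i => (a i : ℕ)) (fun i => (x i : ℕ)) φ ψ)
    have h3 := hF _ (.imp_right (fun i => (a i : ℕ)) (fun i => (x i : ℕ)) φ ψ)
    simp at h1 h2 h3
    rw [BoundedFormula.realize_imp, ihφ, ihψ]
    tauto
  | all φ ih =>
    rw [BoundedFormula.realize_all, elemOf_surjective.forall]
    have hsnoc (w : W) : φ.Realize (fun i => elemOf r W (a i))
        (Fin.snoc (fun i => elemOf r W (x i)) (elemOf r W w)) ↔
        F (formulaQuery g φ (fun i => (a i : ℕ)) (Fin.snoc (fun i => (x i : ℕ)) w)) := by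
      have h := ih (Fin.snoc x w)
      have h1 := Fin.comp_snoc (elemOf r W) x w
      have h2 := Fin.comp_snoc (Subtype.val : W → ℕ) x w
      simp only [Function.comp_def] at h1 h2
      rwa [h1, h2] at h
    simp only [hsnoc]
    have h1 := fun y => hF _ (.all (fun i => (a i : ℕ)) (fun i => (x i : ℕ)) φ y)
    have h2 := hF _ (.skolem (fun i => (a i : ℕ)) (fun i => (x i : ℕ)) φ)
    simp at h1 h2
    constructor
    · intro h
      refine h2.resolve_right (not_not.2 (h ⟨_, hW _ _ (by simp) fun y hy => ?_⟩))
      rcases List.mem_append.1 hy with hy | hy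
      · obtain ⟨i, rfl⟩ := (List.mem_ofFn' _ _).1 hy
        exact (a i).2
      · obtain ⟨i, rfl⟩ := (List.mem_ofFn' _ _).1 hy
        exact (x i).2
    · exact fun h w => (h1 w).resolve_left (not_not.2 h)

end

/-! ### Arithmetically decidable models with independent constants -/

theorem ArReducible.refl (Y : Set ℕ) : ArReducible Y Y := by
  let _ := arithStructure Y
  exact ⟨Relations.formula₁ (L := arithLang) ArRel.mem (Term.var 0), Set.ext fun _ => Iff.rfl⟩

theorem AFun.mem_self (Y : Set ℕ) : AFun Y fun n => n ∈ Y := aFun_mem_iff.2 (ArReducible.refl Y)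

/-- The names all of whose constants have index in `S`. -/
def namesOver (S : Set ℕ) : Set ℕ := {x | ∀ i, Occurs i x → i ∈ S}

theorem isClosedNames_namesOver (S : Set ℕ) : IsClosedNames (namesOver S) := by
  intro t ys ht hys i hi
  rcases occurs_mk.1 hi with rfl | ⟨z, hz, h⟩
  · simp at ht
  · exact hys z hz i h

theorem isClosedNames_univ : IsClosedNames Set.univ := fun _ _ _ _ => trivial

section
variable {g : GoedelCoding L} {B : Set ℕ} {D : ∀ k, L.Formula (Fin k) → (Fin k → ℕ) → Prop}

/-- The coded structure described by `F` on the image of `W` under `r`. -/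
noncomputable def codedNames (g : GoedelCoding L) (F : ℕ → Prop) {r : ℕ → ℕ}
    (hr : ((Set.range r)ᶜ : Set ℕ).Infinite) {W : Set ℕ} (hW : IsClosedNames W) :
    CodedStructure L where
  carrier := r '' W
  compl_infinite := hr.mono (Set.compl_subset_compl.2 (Set.image_subset_range r W))
  struc := nameStructure g F r hW

variable {F : ℕ → Prop} {r : ℕ → ℕ} {W W' : Set ℕ}

theorem realize_codedNames (hF : Satisfies g B D F) (hr : ∀ x y, r x = r y ↔ F (eqQuery x y))
    (hri : ((Set.range r)ᶜ : Set ℕ).Infinite) (hW : IsClosedNames W) {k : ℕ}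
    (φ : L.Formula (Fin k)) (a : Fin k → ↥(codedNames g F hri hW).carrier) (x : Fin k → ℕ)
    (hx : ∀ i, x i ∈ W) (ha : ∀ i, r (x i) = a i) :
    (letI := (codedNames g F hri hW).struc; φ.Realize a) ↔
      F (formulaQuery g φ x (default : Fin 0 → ℕ)) := by
  have h := realize_iff hF hr hW φ (fun i => ⟨x i, hx i⟩) default
  obtain rfl : a = fun i => elemOf r W ⟨x i, hx i⟩ := funext fun i => Subtype.ext (ha i).symm
  rw [Subsingleton.elim (fun i => (((default : Fin 0 → W) i : W) : ℕ)) default] at h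
  rw [← h, Subsingleton.elim (fun i => elemOf r W ((default : Fin 0 → W) i)) default]
  rfl

theorem codedNames_elemSub (hF : Satisfies g B D F) (hr : ∀ x y, r x = r y ↔ F (eqQuery x y))
    (hri : ((Set.range r)ᶜ : Set ℕ).Infinite) (hW : IsClosedNames W) (hW' : IsClosedNames W')
    (hWW' : W ⊆ W') : ElemSub (codedNames g F hri hW) (codedNames g F hri hW') where
  subset := Set.image_mono hWW'
  elem k φ a := by
    rw [realize_codedNames hF hr hri hW φ a (fun i => nameOf r W (a i))
      (fun i => nameOf_mem r W (a i)) fun i => map_nameOf r W (a i)]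
    exact (realize_codedNames hF hr hri hW' φ _ (fun i => nameOf r W (a i))
      (fun i => hWW' (nameOf_mem r W (a i))) fun i => map_nameOf r W (a i)).symm

theorem codedNames_arithDecidable (hL : ArithLang g) (hF : Satisfies g B D F)
    (hr : ∀ x y, r x = r y ↔ F (eqQuery x y)) (hri : ((Set.range r)ᶜ : Set ℕ).Infinite)
    (hFa : AFun ∅ F) (hra : AFun ∅ r) :
    ArithDecidable g (codedNames g F hri isClosedNames_univ) := by
  have key (c : ℕ) : c ∈ elemDiagram g (codedNames g F hri isClosedNames_univ) ↔
      ∃ p bs, IsFormula g bs.length 0 p ∧ F (codeQuery bs.length p bs) ∧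
        c = Nat.pair (Nat.pair bs.length (Encodable.encode p)) (Encodable.encode (bs.map r)) := by
    constructor
    · rintro ⟨k, φ, a, rfl, h⟩
      rw [realize_codedNames hF hr hri isClosedNames_univ φ a (fun i => nameOf r _ (a i))
        (fun i => nameOf_mem r _ (a i)) fun i => map_nameOf r _ (a i)] at h
      refine ⟨formulaList g Fin.val φ, List.ofFn fun i => nameOf r _ (a i), ?_, ?_, ?_⟩
      · rw [List.length_ofFn]
        exact ⟨φ, rfl⟩
      · simpa [formulaQuery] using h
      · have hm (i) : r (nameOf r Set.univ (a i)) = a i := map_nameOf r _ (a i)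
        simp only [List.length_ofFn, List.map_ofFn, Function.comp_def, hm]
        rfl
    · rintro ⟨p, bs, hp, h, rfl⟩
      obtain ⟨k, x, rfl⟩ := exists_ofFn bs
      rw [List.length_ofFn] at hp h
      obtain ⟨φ, rfl⟩ := hp
      refine ⟨k, φ, fun i => ⟨r (x i), x i, trivial, rfl⟩, ?_, ?_⟩
      · simp only [List.length_ofFn, List.map_ofFn, Function.comp_def]
        rfl
      · rw [realize_codedNames hF hr hri isClosedNames_univ φ _ x (fun _ => trivial) fun _ => rfl]
        simpa [formulaQuery] using h
  refine aFun_mem_iff.1 ?_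
  simp only [key]
  have hform : AFun ∅ fun x : ℕ × List ℕ => IsFormula g x.1 0 x.2 :=
    .isFormula (aFun_mem_iff.2 hL) (by fun_prop) (by fun_prop) (by fun_prop)
  fun_prop

theorem occurs_cstName {i j : ℕ} : Occurs i (cstName j) ↔ j = i := by
  simp [cstName, occurs_mk, Nat.pair_eq_pair]

theorem not_occurs_baseName {i m : ℕ} : ¬ Occurs i (baseName m) := by
  simp [baseName, occurs_mk, Nat.pair_eq_pair]

theorem codedNames_arEquiv (hF : Satisfies g B D F)
    (hr : ∀ x y, r x = r y ↔ F (eqQuery x y)) (hri : ((Set.range r)ᶜ : Set ℕ).Infinite)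
    (hra : AFun ∅ r) (S : Set ℕ) :
    ArEquiv (codedNames g F hri (isClosedNames_namesOver S)).carrier S := by
  constructor
  · have h := AFun.mem_self S
    have hra' := hra.of_empty S
    have key (c : ℕ) : c ∈ (codedNames g F hri (isClosedNames_namesOver S)).carrier ↔
        ∃ x, (¬ ∃ i, Occurs i x ∧ ¬ i ∈ S) ∧ r x = c := by
      simp [codedNames, namesOver]
    refine aFun_mem_iff.1 ?_
    simp only [key]
    fun_prop
  · have key (i : ℕ) : i ∈ S ↔
        r (cstName i) ∈ (codedNames g F hri (isClosedNames_namesOver S)).carrier := by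
      constructor
      · intro hi
        exact ⟨cstName i, fun j hj => occurs_cstName.1 hj ▸ hi, rfl⟩
      · rintro ⟨x, hx, h⟩
        exact hx i (hF.occurs ((hr _ _).1 h.symm))
    have h := AFun.mem_self (codedNames g F hri (isClosedNames_namesOver S)).carrier
    have hra' := hra.of_empty (codedNames g F hri (isClosedNames_namesOver S)).carrier
    refine aFun_mem_iff.1 ?_
    simp only [key]
    fun_prop

theorem exists_models (hL : ArithLang g) (hB : IsArithmetical B) (hBc : (Bᶜ : Set ℕ).Infinite)
    (hDB : ∀ k φ v, D k φ v → ∀ i, v i ∈ B)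
    (hDa : AFun ∅ fun x : ℕ × List ℕ × List ℕ => IsInstance g D x.1 x.2.1 x.2.2)
    {P : Type*} [L.Structure P] [Infinite P] (b : ℕ → P) (hb : Set.InjOn b B)
    (hD : ∀ k φ v, D k φ v → φ.Realize fun i => b (v i)) (S : Set ℕ) :
    ∃ M N : CodedStructure L, ArithDecidable g N ∧ ElemSub M N ∧ ArEquiv M.carrier S ∧
      B ⊆ M.carrier ∧ ∀ k φ v, D k φ v → ∀ h : ∀ i, v i ∈ M.carrier,
        letI := M.struc
        φ.Realize fun i => (⟨v i, h i⟩ : ↥M.carrier) := by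
  have hBa : AFun ∅ fun n => n ∈ B := aFun_mem_iff.2 hB
  obtain ⟨F, hFa, hF⟩ := AFun.exists_assignment (AFun.isClause g (aFun_mem_iff.2 hL) hBa hDa)
    (exists_satisfies g b hb hD)
  replace hF : Satisfies g B D F := hF
  obtain ⟨r, hra, hr, hrB, hri⟩ := exists_representatives hBa hBc
    (E := fun x y => F (eqQuery x y)) (by fun_prop) hF.equivalence
    fun m hm m' hm' => hF.base hm hm'
  have hbase (m : ℕ) : baseName m ∈ namesOver S := fun i hi => absurd hi not_occurs_baseName
  refine ⟨codedNames g F hri (isClosedNames_namesOver S), codedNames g F hri isClosedNames_univ,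
    codedNames_arithDecidable hL hF hr hri hFa hra,
    codedNames_elemSub hF hr hri _ _ (Set.subset_univ _), codedNames_arEquiv hF hr hri hra S,
    fun m hm => ⟨baseName m, hbase m, hrB m hm⟩, fun k φ v h hv => ?_⟩
  rw [realize_codedNames hF hr hri (isClosedNames_namesOver S) φ _ (fun i => baseName (v i))
    (fun i => hbase _) fun i => hrB _ (hDB k φ v h i)]
  simpa using hF _ (.diagram φ v h)

end

/-! ### Sentences as formulas -/

/-- A sentence as a formula in the variables `Fin 0`. -/
def sentenceFormula (σ : L.Sentence) : L.Formula (Fin 0) :=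
  BoundedFormula.relabelEquiv (Equiv.equivOfIsEmpty Empty (Fin 0)) σ

theorem realize_sentenceFormula {P : Type*} [L.Structure P] (σ : L.Sentence) (a : Fin 0 → P) :
    (sentenceFormula σ).Realize a ↔ Sentence.Realize P σ := by
  rw [sentenceFormula, Formula.Realize, BoundedFormula.realize_relabelEquiv]
  exact iff_of_eq (congrArg₂ _ (Subsingleton.elim _ _) rfl)

theorem encode_sentenceFormula (g : GoedelCoding L) (σ : L.Sentence) :
    Encodable.encode (formulaList g Fin.val (sentenceFormula σ)) = sentenceCode g σ := by
  rw [sentenceFormula, formulaList_relabelEquiv g _ (e := fun a : Empty => a.elim)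
    fun a : Empty => a.elim]
  rfl

theorem ElemSub.realize_sentence_iff {M N : CodedStructure L} (h : ElemSub M N) (σ : L.Sentence) :
    @Sentence.Realize L M.carrier M.struc σ ↔ @Sentence.Realize L N.carrier N.struc σ := by
  have := h.elem 0 (sentenceFormula σ) (fun i => i.elim0)
  simpa only [@realize_sentenceFormula L M.carrier M.struc,
    @realize_sentenceFormula L N.carrier N.struc] using this

theorem infinite_of_noFiniteModels {T : L.Theory} (h : NoFiniteModels L T) {P : Type*}
    [L.Structure P] (hP : ∀ σ ∈ T, Sentence.Realize P σ) : Infinite P := by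
  by_contra hfin
  rw [not_infinite_iff_finite] at hfin
  obtain ⟨n, ⟨e⟩⟩ := Finite.exists_equiv_fin P
  let S : L.Structure (Fin n) := e.inducedStructure
  have := h (Fin n) S fun σ hσ =>
    (StrongHomClass.realize_sentence (e.inducedStructureEquiv (L := L)) σ).1 (hP σ hσ)
  exact not_finite (Fin n)

theorem exists_model_of_arithTheory {g : GoedelCoding L} (hL : ArithLang g) {T : L.Theory}
    (hT : ArithTheory g T) (hsat : T.IsSatisfiable) (hnf : NoFiniteModels L T) (S : Set ℕ) :
    ∃ M : CodedStructure L, M.Models T ∧ ArithExtendible g T M ∧ ArEquiv M.carrier S := by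
  obtain ⟨P⟩ := hsat
  have hP : ∀ σ ∈ T, Sentence.Realize P σ := fun σ hσ => Theory.realize_sentence_of_mem T hσ
  have := infinite_of_noFiniteModels hnf hP
  let D : ∀ k, L.Formula (Fin k) → (Fin k → ℕ) → Prop := fun k φ _ =>
    ∃ σ ∈ T, (⟨k, φ⟩ : Σ k, L.Formula (Fin k)) = ⟨0, sentenceFormula σ⟩
  have key (x : ℕ × List ℕ × List ℕ) : IsInstance g D x.1 x.2.1 x.2.2 ↔
      x.1 = 0 ∧ x.2.2 = [] ∧ Encodable.encode x.2.1 ∈ theoryCode g T := by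
    obtain ⟨k, p, ms⟩ := x
    dsimp only
    constructor
    · rintro ⟨φ, v, rfl, rfl, σ, hσ, h⟩
      cases h
      exact ⟨rfl, rfl, σ, hσ, encode_sentenceFormula g σ⟩
    · rintro ⟨rfl, rfl, σ, hσ, h⟩
      rw [← encode_sentenceFormula, Encodable.encode_inj] at h
      exact ⟨sentenceFormula σ, default, h.symm, rfl, σ, hσ, rfl⟩
  have hmem : AFun ∅ fun n => n ∈ theoryCode g T := aFun_mem_iff.2 hT
  obtain ⟨M, N, hN, hMN, hS, -, hM⟩ := exists_models (g := g) (B := ∅) (D := D) hL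
    (aFun_mem_iff.1 (by simp only [Set.mem_empty_iff_false]; fun_prop))
    (by simpa using Set.infinite_univ)
    (by
      rintro k φ v ⟨σ, hσ, h⟩ i
      cases h
      exact i.elim0)
    (by simp only [key]; fun_prop)
    (P := P) (Infinite.natEmbedding P) (Set.injOn_empty _)
    (by
      rintro k φ v ⟨σ, hσ, h⟩
      cases h
      exact (realize_sentenceFormula σ _).2 (hP σ hσ))
    S
  have hMT : M.Models T := fun σ hσ => by
    let _ := M.struc
    exact (realize_sentenceFormula σ _).1
      (hM 0 (sentenceFormula σ) default ⟨σ, hσ, rfl⟩ fun i => i.elim0)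
  exact ⟨M, hMT, ⟨N, hN, fun σ hσ => (hMN.realize_sentence_iff σ).1 (hMT σ hσ), hMN⟩, hS⟩

theorem isArithmetical_carrier {g : GoedelCoding L} {M : CodedStructure L}
    (hM : ArithDecidable g M) : IsArithmetical M.carrier := by
  have key (m : ℕ) : m ∈ M.carrier ↔
      Nat.pair (Nat.pair 1 (formulaCode g Fin.val (⊤ : L.Formula (Fin 1)))) (Encodable.encode [m])
        ∈ elemDiagram g M := by
    constructor
    · exact fun h => ⟨1, ⊤, fun _ => ⟨m, h⟩, rfl, fun h => h⟩
    · rintro ⟨k, φ, a, h, -⟩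
      obtain ⟨h1, h2⟩ := Nat.pair_eq_pair.1 h
      obtain rfl := (Nat.pair_eq_pair.1 h1).1
      have h3 : [m] = List.ofFn fun i => (a i : ℕ) := Encodable.encode_injective h2
      have h4 : m = a 0 := by simpa using h3
      exact h4 ▸ (a 0).2
  have hmem : AFun ∅ fun n => n ∈ elemDiagram g M := aFun_mem_iff.2 hM
  refine aFun_mem_iff.1 ?_
  simp only [key]
  fun_prop

theorem exists_extension_of_arithDecidable {g : GoedelCoding L} (hL : ArithLang g) {T : L.Theory}
    (hnf : NoFiniteModels L T) {M₀ : CodedStructure L} (hdec : ArithDecidable g M₀)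
    (hM₀ : M₀.Models T) (S : Set ℕ) :
    ∃ M : CodedStructure L, M.Models T ∧ ArithExtendible g T M ∧ ElemSub M₀ M ∧
      ArEquiv M.carrier S := by
  let _ := M₀.struc
  have : Infinite M₀.carrier := hnf _ M₀.struc hM₀
  let D : ∀ k, L.Formula (Fin k) → (Fin k → ℕ) → Prop := fun k φ v =>
    ∃ a : Fin k → M₀.carrier, (∀ i, (a i : ℕ) = v i) ∧ φ.Realize a
  have key (x : ℕ × List ℕ × List ℕ) : IsInstance g D x.1 x.2.1 x.2.2 ↔
      Nat.pair (Nat.pair x.1 (Encodable.encode x.2.1)) (Encodable.encode x.2.2)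
        ∈ elemDiagram g M₀ := by
    obtain ⟨k, p, ms⟩ := x
    dsimp only
    constructor
    · rintro ⟨φ, v, rfl, rfl, a, ha, h⟩
      obtain rfl : (fun i => (a i : ℕ)) = v := funext ha
      exact ⟨k, φ, a, rfl, h⟩
    · rintro ⟨k', φ, a, h, hφ⟩
      obtain ⟨h1, h2⟩ := Nat.pair_eq_pair.1 h
      obtain ⟨rfl, h3⟩ := Nat.pair_eq_pair.1 h1
      exact ⟨φ, fun i => a i, (Encodable.encode_injective h3).symm,
        (Encodable.encode_injective h2).symm, a, fun _ => rfl, hφ⟩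
  have hmem : AFun ∅ fun n => n ∈ elemDiagram g M₀ := aFun_mem_iff.2 hdec
  let b : ℕ → M₀.carrier := Function.invFun Subtype.val
  have hb (m : M₀.carrier) : b m = m := Function.leftInverse_invFun Subtype.val_injective m
  obtain ⟨M, N, hN, hMN, hS, hsub, hM⟩ := exists_models (D := D) hL
    (isArithmetical_carrier hdec) M₀.compl_infinite
    (fun k φ v ⟨a, ha, _⟩ i => ha i ▸ (a i).2)
    (by simp only [key]; fun_prop) b
    (fun m hm m' hm' h => by
      have h' : b (⟨m, hm⟩ : M₀.carrier) = b (⟨m', hm'⟩ : M₀.carrier) := h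
      rw [hb, hb] at h'
      exact congrArg Subtype.val h')
    (fun k φ v ⟨a, ha, hφ⟩ => by simpa only [← ha, hb] using hφ) S
  have helem : ElemSub M₀ M := by
    refine ⟨hsub, fun k φ a => ?_⟩
    let _ := M.struc
    have hfwd (φ : L.Formula (Fin k)) (hφ : φ.Realize a) :
        φ.Realize fun i => (⟨a i, hsub (a i).2⟩ : M.carrier) :=
      hM k φ (fun i => a i) ⟨a, fun _ => rfl, hφ⟩ fun i => hsub (a i).2
    refine ⟨hfwd φ, fun h => ?_⟩
    by_contra hn
    exact Formula.realize_not.1 (hfwd φ.not (Formula.realize_not.2 hn)) h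
  have hMT : M.Models T := fun σ hσ => (helem.realize_sentence_iff σ).1 (hM₀ σ hσ)
  exact ⟨M, hMT, ⟨N, hN, fun σ hσ => (hMN.realize_sentence_iff σ).1 (hMT σ hσ), hMN⟩, helem, hS⟩

/-- **Realizing arbitrary nonzero arithmetic degrees**, absolutely and over a fixed
arithmetically decidable base. -/
theorem realizing_arbitrary_degrees
    (L : FirstOrder.Language) (g : GoedelCoding L) (hL : ArithLang g)
    (T : L.Theory) (hT : ArithTheory g T) (hcomp : T.IsComplete)
    (hnf : NoFiniteModels L T) :
    (∀ d : Set ℕ, ¬ IsArithmetical d →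
      ∃ M : CodedStructure L, M.Models T ∧ ArithExtendible g T M ∧
        ArEquiv M.carrier d) ∧
    (∀ M₀ : CodedStructure L, ArithDecidable g M₀ → M₀.Models T →
      ∀ d : Set ℕ, ¬ IsArithmetical d →
        ∃ M : CodedStructure L, M.Models T ∧ ArithExtendible g T M ∧
          ElemSub M₀ M ∧ ArEquiv M.carrier d) :=
    ⟨fun d _ => exists_model_of_arithTheory hL hT hcomp.1 hnf d,
      fun _ hdec hM₀ d _ => exists_extension_of_arithDecidable hL hnf hdec hM₀ d⟩

end ArMorley
end

section
/- Let T be a complete theory, let M₀ ⊨ T be an arithmetically decidable model, let φ(x, m̄₀) be a formula with parameters m̄₀ from M₀ that is strongly minimal over M₀, and let M₀ ≼ M ⊨ T. Put C := φ(M, m̄₀), and assume M = acl_M(M₀ ∪ C). Let ā ∈ M^{<ω}, and let X ⊆ M^r be an infinite set definable in M with parameters from M₀ ∪ ā such that X is not contained in acl_M(M₀ ∪ ā)^r. Then C ⊆ acl_M(M₀ ∪ ā ∪ coord(X)), and consequently M = acl_M(M₀ ∪ ā ∪ coord(X)), where coord(X) := {m ∈ M : m occurs as a coordinate of some tuple in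 X}. -/
open FirstOrder FirstOrder.Language

namespace ArMorley

variable {L : FirstOrder.Language}

section Definability

variable {N : Type} [L.Structure N] {A B : Set N} {α β : Type}

theorem definable_exists {p : (α → N) → N → Prop}
    (h : A.Definable L {u : α ⊕ Unit → N | p (u ∘ Sum.inl) (u (Sum.inr ()))}) :
    A.Definable L {v : α → N | ∃ y, p v y} := by
  refine (congrArg (A.Definable L) ?_).mp h.exists_of_finite
  ext v
  exact ⟨fun ⟨u, hu⟩ => ⟨u (), hu⟩, fun ⟨y, hy⟩ => ⟨fun _ => y, hy⟩⟩

theorem definable_forall {p : (α → N) → N → Prop}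
    (h : A.Definable L {u : α ⊕ Unit → N | p (u ∘ Sum.inl) (u (Sum.inr ()))}) :
    A.Definable L {v : α → N | ∀ y, p v y} := by
  refine (congrArg (A.Definable L) ?_).mp h.forall_of_finite
  ext v
  exact ⟨fun hu y => hu fun _ => y, fun hy u => hy (u ())⟩

theorem not_encard_le_iff {M : Type*} {s : Set M} {l : ℕ} :
    ¬ s.encard ≤ l ↔ ∃ w : Fin (l + 1) → M, (∀ i j, i ≠ j → w i ≠ w j) ∧ ∀ i, w i ∈ s := by
  rw [not_le]
  constructor
  · intro h
    obtain ⟨t, hts, ht⟩ := Set.exists_subset_encard_eq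
      (show ((l + 1 : ℕ) : ℕ∞) ≤ s.encard from by push_cast; exact Order.add_one_le_of_lt h)
    have hfin : t.Finite := Set.finite_of_encard_eq_coe ht
    have hcard : Nat.card t = l + 1 := by
      rw [Nat.card_coe_set_eq, Set.ncard, ht]; rfl
    have := hfin.to_subtype
    let e := Finite.equivFinOfCardEq hcard
    exact ⟨fun i => e.symm i, fun i j hij h' => hij (e.symm.injective (Subtype.ext h')),
      fun i => hts (e.symm i).2⟩
  · rintro ⟨w, hinj, hw⟩
    have hw' : Function.Injective w := fun i j h => by_contra fun hij => hinj i j hij h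
    have h1 : (Set.range w).encard = ((l + 1 : ℕ) : ℕ∞) := by
      rw [← Set.image_univ, hw'.encard_image, Set.encard_univ]
      simp
    calc (l : ℕ∞) < ((l + 1 : ℕ) : ℕ∞) := by exact_mod_cast Nat.lt_succ_self l
      _ = (Set.range w).encard := h1.symm
      _ ≤ s.encard := Set.encard_le_encard (Set.range_subset_iff.2 hw)

theorem definable_ne (i k : α) : A.Definable L {v : α → N | v i ≠ v k} := by
  have h := (Set.Definable.diagonal (L := L) A).preimage_comp ![i, k]
  exact h.compl

theorem definable_encard_le {p : (α → N) → N → Prop} (l : ℕ)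
    (h : A.Definable L {u : α ⊕ Unit → N | p (u ∘ Sum.inl) (u (Sum.inr ()))}) :
    A.Definable L {v : α → N | {y | p v y}.encard ≤ l} := by
  have h1 : A.Definable L {u : α ⊕ Fin (l + 1) → N |
      (∀ i j, i ≠ j → u (Sum.inr i) ≠ u (Sum.inr j)) ∧
        ∀ i, p (u ∘ Sum.inl) (u (Sum.inr i))} := by
    rw [Set.ofPred_and]
    simp only [Set.ofPred_forall]
    refine Set.Definable.inter ?_ ?_
    · refine Set.definable_iInter_of_finite fun i => Set.definable_iInter_of_finite fun k => ?_
      by_cases hik : i = k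
      · simp [hik, Set.definable_univ]
      · simpa [hik] using definable_ne (Sum.inr i) (Sum.inr k)
    · exact Set.definable_iInter_of_finite fun i =>
        h.preimage_comp (Sum.elim Sum.inl fun _ => Sum.inr i)
  refine (congrArg (A.Definable L) ?_).mp h1.exists_of_finite.compl
  ext v
  rw [Set.mem_compl_iff, Set.mem_ofPred_eq, Set.mem_ofPred_eq, not_iff_comm, not_encard_le_iff]
  rfl

theorem Definable.exists_family {c : β → N} {S : Set (α → N)}
    (h : (A ∪ Set.range c).Definable L S) :
    ∃ S' : Set (α ⊕ β → N), A.Definable L S' ∧ S = {v | Sum.elim v c ∈ S'} := by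
  classical
  obtain ⟨φ, rfl⟩ := Set.definable_iff_exists_formula_sum.1 h
  let f : ↥(A ∪ Set.range c) ⊕ α → A ⊕ (α ⊕ β) := Sum.elim
    (fun x => if hx : (x : N) ∈ A then Sum.inl ⟨x, hx⟩
      else Sum.inr (Sum.inr (x.2.resolve_left hx).choose)) (fun a => Sum.inr (Sum.inl a))
  refine ⟨{w | (φ.relabel f).Realize (Sum.elim (↑) w)},
    Set.definable_iff_exists_formula_sum.2 ⟨_, rfl⟩, ?_⟩
  ext v
  simp only [Set.mem_ofPred_eq, Formula.realize_relabel]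
  refine iff_of_eq (congrArg φ.Realize ?_)
  funext x
  rcases x with x | a
  · by_cases hx : (x : N) ∈ A
    · simp [f, hx]
    · simpa [f, hx] using (x.2.resolve_left hx).choose_spec.symm
  · simp [f]

theorem Definable.fiber {S' : Set (α ⊕ β → N)} (h : A.Definable L S') (c : β → N) :
    (A ∪ Set.range c).Definable L {v | Sum.elim v c ∈ S'} := by
  obtain ⟨φ, rfl⟩ := Set.definable_iff_exists_formula_sum.1 h
  let f : A ⊕ (α ⊕ β) → ↥(A ∪ Set.range c) ⊕ α := Sum.elim (fun x => Sum.inl ⟨x, Or.inl x.2⟩)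
    (Sum.elim Sum.inr fun b => Sum.inl ⟨c b, Or.inr ⟨b, rfl⟩⟩)
  refine Set.definable_iff_exists_formula_sum.2 ⟨φ.relabel f, ?_⟩
  ext v
  simp only [Set.mem_ofPred_eq, Formula.realize_relabel]
  refine iff_of_eq (congrArg φ.Realize ?_)
  funext x
  rcases x with x | a | b <;> simp [f]

theorem Definable.exists_family_singleton {c : N} {S : Set (α → N)}
    (h : (A ∪ {c}).Definable L S) :
    ∃ S' : Set (α ⊕ Unit → N), A.Definable L S' ∧ S = {v | Sum.elim v (fun _ => c) ∈ S'} := by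
  refine Definable.exists_family (c := fun _ : Unit => c) ?_
  rwa [Set.range_const]

theorem Definable.exists_binary_family {c : N} {Y : Set N} (h : (A ∪ {c}).Definable₁ L Y) :
    ∃ Q : N → N → Prop, (∀ {α : Type} (i k : α), A.Definable L {u : α → N | Q (u i) (u k)}) ∧
      ∀ y, y ∈ Y ↔ Q y c := by
  obtain ⟨S, hS, hYS⟩ := Definable.exists_family_singleton h
  refine ⟨fun x z => Sum.elim (fun _ => x) (fun _ => z) ∈ S, fun {α} i k => ?_,
    fun y => Set.ext_iff.1 hYS fun _ => y⟩
  refine (congrArg (A.Definable L) ?_).mp (hS.preimage_comp (Sum.elim (fun _ => i) fun _ => k))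
  ext u
  refine iff_of_eq (congrArg (· ∈ S) ?_)
  funext t
  rcases t with t | t <;> rfl

theorem Definable.fiber_singleton {S' : Set (α ⊕ Unit → N)} (h : A.Definable L S') (c : N) :
    (A ∪ {c}).Definable L {v | Sum.elim v (fun _ => c) ∈ S'} := by
  have := Definable.fiber h (fun _ : Unit => c)
  rwa [Set.range_const] at this

theorem definable_of_formula {m : ℕ} (ψ : L.Formula (α ⊕ Fin m)) {b : Fin m → N}
    (hb : ∀ i, b i ∈ B) : B.Definable L {v | ψ.Realize (Sum.elim v b)} := by
  have h : (∅ : Set N).Definable L {w : α ⊕ Fin m → N | ψ.Realize w} :=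
    Set.empty_definable_iff.2 ⟨ψ, rfl⟩
  exact (Definable.fiber h b).mono
    (Set.union_subset (Set.empty_subset _) (Set.range_subset_iff.2 hb))

theorem Definable.exists_formula {S : Set (α → N)} (h : B.Definable L S) :
    ∃ (m : ℕ) (ψ : L.Formula (α ⊕ Fin m)) (b : Fin m → N),
      (∀ i, b i ∈ B) ∧ S = {v | ψ.Realize (Sum.elim v b)} := by
  obtain ⟨F, hF, hS⟩ := Set.definable_iff_finitely_definable.1 h
  let e := F.equivFin.symm
  have hr : Set.range (fun i => (e i : N)) = F := by
    ext x
    exact ⟨fun ⟨i, hi⟩ => hi ▸ (e i).2, fun hx => ⟨e.symm ⟨x, hx⟩, by simp⟩⟩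
  rw [← hr, ← Set.empty_union (Set.range _)] at hS
  obtain ⟨S', hS', rfl⟩ := Definable.exists_family hS
  obtain ⟨ψ, rfl⟩ := Set.empty_definable_iff.1 hS'
  exact ⟨_, ψ, _, fun i => hF (e i).2, rfl⟩

end Definability

section AlgebraicClosure

variable {N : Type} [SN : L.Structure N] {A B E : Set N} {b c x : N}

theorem mem_aclIn_iff :
    x ∈ aclIn L N SN B ↔ ∃ Y : Set N, B.Definable₁ L Y ∧ Y.Finite ∧ x ∈ Y := by
  have key (v : Fin 1 → N) : (fun _ => v 0) = v := funext fun i => congrArg v (Subsingleton.elim _ _)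
  constructor
  · rintro ⟨m, ψ, b, hb, hx, hfin⟩
    refine ⟨_, ?_, hfin, hx⟩
    refine (congrArg (B.Definable L) ?_).mp (definable_of_formula ψ hb)
    ext v
    simp only [Set.mem_ofPred_eq, key]
  · rintro ⟨Y, hY, hfin, hx⟩
    obtain ⟨m, ψ, b, hb, hS⟩ := Definable.exists_formula hY
    have hmem (y : N) : y ∈ Y ↔ ψ.Realize (Sum.elim (fun _ => y) b) :=
      Set.ext_iff.1 hS fun _ => y
    refine ⟨m, ψ, b, hb, (hmem x).1 hx, ?_⟩
    exact hfin.subset fun y hy => (hmem y).2 hy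

theorem aclIn_mono (h : A ⊆ B) : aclIn L N SN A ⊆ aclIn L N SN B := by
  rintro x ⟨m, ψ, b, hb, hx⟩
  exact ⟨m, ψ, b, fun i => h (hb i), hx⟩

theorem exists_finset_of_mem_aclIn_union (h : x ∈ aclIn L N SN (A ∪ E)) :
    ∃ F : Finset N, (F : Set N) ⊆ E ∧ x ∈ aclIn L N SN (A ∪ F) := by
  classical
  obtain ⟨m, ψ, b, hb, hx⟩ := h
  refine ⟨(Finset.univ.image b).filter (· ∈ E), fun y hy => (Finset.mem_filter.1 hy).2, m, ψ, b,
    fun i => ?_, hx⟩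
  exact (hb i).imp id fun h => by simpa using h

theorem mem_aclIn_of_mem_aclIn_union_singleton (hc : c ∈ aclIn L N SN B)
    (hx : x ∈ aclIn L N SN (B ∪ {c})) : x ∈ aclIn L N SN B := by
  obtain ⟨Z, hZ, hZfin, hcZ⟩ := mem_aclIn_iff.1 hc
  obtain ⟨Y, hY, hYfin, hxY⟩ := mem_aclIn_iff.1 hx
  obtain ⟨Q, hQ, hYQ⟩ := Definable.exists_binary_family hY
  have hcard : {y | Q y c}.encard ≤ (Y.ncard : ℕ∞) :=
    (Set.encard_le_encard fun y hy => (hYQ y).2 hy).trans hYfin.cast_ncard_eq.ge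
  rw [mem_aclIn_iff]
  refine ⟨{y | ∃ z, z ∈ Z ∧ Q y z ∧ {y | Q y z}.encard ≤ (Y.ncard : ℕ∞)}, ?_, ?_,
    c, hcZ, (hYQ x).1 hxY, hcard⟩
  · refine definable_exists
      (p := fun v z => z ∈ Z ∧ Q (v 0) z ∧ {y | Q y z}.encard ≤ (Y.ncard : ℕ∞)) ?_
    exact (hZ.preimage_comp fun _ => Sum.inr ()).inter ((hQ _ _).inter
      (definable_encard_le (p := fun u y => Q y (u (Sum.inr ()))) _ (hQ _ _)))
  · refine (hZfin.biUnion (t := fun z => {y | Q y z ∧ {y | Q y z}.encard ≤ (Y.ncard : ℕ∞)})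
      fun z _ => ?_).subset ?_
    · by_cases hz : {y | Q y z}.encard ≤ (Y.ncard : ℕ∞)
      · exact (Set.finite_of_encard_le_coe hz).subset fun y hy => hy.1
      · simp [hz]
    · rintro y ⟨z, hz, h⟩
      exact Set.mem_biUnion hz h

theorem aclIn_union_subset (hE : E ⊆ aclIn L N SN B) :
    aclIn L N SN (B ∪ E) ⊆ aclIn L N SN B := by
  classical
  intro x hx
  obtain ⟨F, hF, hxF⟩ := exists_finset_of_mem_aclIn_union hx
  induction F using Finset.induction_on with
  | empty => simpa using hxF
  | insert c F _ ih =>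
    rw [Finset.coe_insert] at hF hxF
    refine ih (fun y hy => hF (Or.inr hy)) (mem_aclIn_of_mem_aclIn_union_singleton (c := c) ?_ ?_)
    · exact aclIn_mono Set.subset_union_left (hE (hF (Or.inl rfl)))
    · rwa [Set.union_assoc, Set.union_singleton]

end AlgebraicClosure

section StronglyMinimal

variable {N : Type} [SN : L.Structure N] {A B C D : Set N} {b c x : N}

/-- There is an `A`-definable relation on `D × C` with uniformly bounded fibers over `D` whose
projection to `C` is infinite. -/
def BoundedCorrespondence (L : FirstOrder.Language) {N : Type} [L.Structure N]
    (A D C : Set N) : Prop :=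
  ∃ (l : ℕ) (P : N → N → Prop), A.Definable L {v : Fin 2 → N | P (v 0) (v 1)} ∧
    (∀ x, {y | P x y}.encard ≤ l) ∧ (∀ x y, P x y → x ∈ D ∧ y ∈ C) ∧ {y | ∃ x, P x y}.Infinite

theorem encard_exists_mem_le {M : Type*} {Z : Set M} (hZ : Z.Finite) {R : M → M → Prop} {l : ℕ}
    (h : ∀ z ∈ Z, {y | R z y}.encard ≤ l) : {y | ∃ z ∈ Z, R z y}.encard ≤ (Z.ncard * l : ℕ) := by
  induction Z, hZ using Set.Finite.induction_on with
  | empty => simp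
  | @insert a Z ha hZ ih =>
    rw [Set.ncard_insert_of_notMem ha hZ]
    have : {y | ∃ z ∈ insert a Z, R z y} = {y | R a y} ∪ {y | ∃ z ∈ Z, R z y} := by
      ext y; simp
    rw [this]
    refine (Set.encard_union_le _ _).trans ?_
    have h1 := add_le_add (h a (Or.inl rfl)) (ih fun z hz => h z (Or.inr hz))
    refine h1.trans (le_of_eq ?_)
    push_cast
    ring

theorem BoundedCorrespondence.of_union_singleton (hD : A.Definable₁ L D) (hC : A.Definable₁ L C)
    (hmin : ∀ Y : Set N, Set.univ.Definable₁ L Y → Y ⊆ C → Y.Finite ∨ (C \ Y).Finite)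
    (hCA : (C ∩ A).Infinite) (hc : c ∈ C) (h : BoundedCorrespondence L (A ∪ {c}) D C) :
    BoundedCorrespondence L A D C := by
  obtain ⟨l, P, hP, hPl, hPDC, hPinf⟩ := h
  obtain ⟨S, hS, hPS⟩ := Definable.exists_family_singleton hP
  let Q (x y z : N) : Prop := Sum.elim ![x, y] (fun _ => z) ∈ S ∧ x ∈ D ∧ y ∈ C
  have hQ {α : Type} (i k m : α) : A.Definable L {u : α → N | Q (u i) (u k) (u m)} := by
    refine Set.Definable.inter ?_
      ((hD.preimage_comp fun _ => i).inter (hC.preimage_comp fun _ => k))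
    refine (congrArg (A.Definable L) ?_).mp (hS.preimage_comp (Sum.elim ![i, k] fun _ => m))
    ext u
    refine iff_of_eq (congrArg (· ∈ S) ?_)
    funext t
    rcases t with t | t
    · fin_cases t <;> rfl
    · rfl
  have hPQ (x y : N) : P x y ↔ Q x y c :=
    ⟨fun h => ⟨(Set.ext_iff.1 hPS ![x, y]).1 h, hPDC x y h⟩,
      fun h => (Set.ext_iff.1 hPS ![x, y]).2 h.1⟩
  have hQex {α : Type} (k m : α) : A.Definable L {u : α → N | ∃ x, Q x (u k) (u m)} :=
    definable_exists (p := fun u x => Q x (u k) (u m)) (hQ _ _ _)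
  have hQex' (z : N) : Set.univ.Definable₁ L {y | ∃ x, Q x y z} :=
    (Definable.fiber_singleton (hQex (α := Fin 1 ⊕ Unit) (Sum.inl 0) (Sum.inr ())) z).mono
      (Set.subset_univ _)
  have hQC (z : N) : {y | ∃ x, Q x y z} ⊆ C := fun y ⟨x, hx⟩ => hx.2.2
  obtain ⟨n, hn⟩ : ∃ n : ℕ, (C \ {y | ∃ x, Q x y c}).encard ≤ n := by
    have : {y | ∃ x, Q x y c}.Infinite := by simpa only [hPQ] using hPinf
    have hfin := (hmin _ (hQex' c) (hQC c)).resolve_left this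
    exact ⟨_, hfin.cast_ncard_eq.ge⟩
  let Z : Set N := {z | z ∈ C ∧ (∀ x, {y | Q x y z}.encard ≤ l) ∧
    (C \ {y | ∃ x, Q x y z}).encard ≤ n}
  have hcZ : c ∈ Z := ⟨hc, fun x => by simpa only [hPQ] using hPl x, hn⟩
  have hZ : A.Definable₁ L Z := by
    refine Set.Definable.inter hC (Set.Definable.inter ?_ ?_)
    · refine definable_forall (p := fun v x => {y | Q x y (v 0)}.encard ≤ l) ?_
      exact definable_encard_le (p := fun u y => Q (u (Sum.inr ())) y (u (Sum.inl 0))) l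
        (hQ _ _ _)
    · exact definable_encard_le (p := fun u y => y ∈ C ∧ ¬ ∃ x, Q x y (u 0)) n
        ((hC.preimage_comp fun _ => Sum.inr ()).inter (hQex _ _).compl)
  have hZinf {z : N} (hz : z ∈ Z) : {y | ∃ x, Q x y z}.Infinite := fun hfin =>
    hCA ((hfin.union (Set.finite_of_encard_le_coe hz.2.2)).subset fun y hy => by
      by_cases h : y ∈ {y | ∃ x, Q x y z}
      exacts [Or.inl h, Or.inr ⟨hy.1, h⟩])
  rcases hmin Z (hZ.mono (Set.subset_univ _)) fun z hz => hz.1 with hfin | hcofin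
  · refine ⟨Z.ncard * l, fun x y => ∃ z ∈ Z, Q x y z, ?_, fun x => ?_, ?_, ?_⟩
    · exact definable_exists (p := fun v z => z ∈ Z ∧ Q (v 0) (v 1) z)
        ((hZ.preimage_comp fun _ => Sum.inr ()).inter (hQ _ _ _))
    · exact encard_exists_mem_le hfin (R := fun z y => Q x y z) fun z hz => hz.2.1 x
    · rintro x y ⟨z, -, hz⟩
      exact hz.2
    · refine (hZinf hcZ).mono ?_
      rintro y ⟨x, hx⟩
      exact ⟨x, c, hcZ, hx⟩
  · obtain ⟨z, ⟨hzC, hzA⟩, hz⟩ := (hCA.sdiff hcofin).nonempty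
    have hzZ : z ∈ Z := by_contra fun h => hz ⟨hzC, h⟩
    refine ⟨l, fun x y => Q x y z, ?_, hzZ.2.1, fun x y h => h.2, hZinf hzZ⟩
    refine (Definable.fiber_singleton
      (hQ (α := Fin 2 ⊕ Unit) (Sum.inl 0) (Sum.inl 1) (Sum.inr ())) z).mono ?_
    exact Set.union_subset subset_rfl (Set.singleton_subset_iff.2 hzA)

theorem BoundedCorrespondence.of_mem_aclIn (hD : A.Definable₁ L D) (hC : A.Definable₁ L C)
    (hmin : ∀ Y : Set N, Set.univ.Definable₁ L Y → Y ⊆ C → Y.Finite ∨ (C \ Y).Finite)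
    (hCinf : C.Infinite) (hc : c ∈ C) (hbD : b ∈ D) (hb : b ∈ aclIn L N SN (A ∪ {c}))
    (hbA : b ∉ aclIn L N SN A) : BoundedCorrespondence L A D C := by
  obtain ⟨Y, hY, hYfin, hbY⟩ := mem_aclIn_iff.1 hb
  obtain ⟨Q₀, hQ₀, hYQ⟩ := Definable.exists_binary_family hY
  let Q (x z : N) : Prop := Q₀ x z ∧ x ∈ D ∧ z ∈ C ∧ {y | Q₀ y z}.encard ≤ (Y.ncard : ℕ∞)
  have hQ {α : Type} (i k : α) : A.Definable L {u : α → N | Q (u i) (u k)} :=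
    (hQ₀ i k).inter ((hD.preimage_comp fun _ => i).inter ((hC.preimage_comp fun _ => k).inter
      (definable_encard_le (p := fun u y => Q₀ y (u k)) _ (hQ₀ _ _))))
  have hQbc : Q b c := by
    exact ⟨(hYQ b).1 hbY, hbD, hc,
      (Set.encard_le_encard fun y hy => (hYQ y).2 hy).trans hYfin.cast_ncard_eq.ge⟩
  have hQcard (z : N) (hz : {y | Q y z}.Nonempty) : {y | Q y z}.encard ≤ (Y.ncard : ℕ∞) := by
    obtain ⟨y, hy⟩ := hz
    exact (Set.encard_le_encard fun y hy => hy.1).trans hy.2.2.2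
  have hfib : {z | Q b z}.Finite := by
    have hdef : Set.univ.Definable₁ L {z | Q b z} :=
      (Definable.fiber_singleton (hQ (α := Fin 1 ⊕ Unit) (Sum.inr ()) (Sum.inl 0)) b).mono
        (Set.subset_univ _)
    refine (hmin _ hdef fun z hz => hz.2.2.1).resolve_right fun hcofin => ?_
    let G : Set N := {x | (C \ {z | Q x z}).encard ≤ ((C \ {z | Q b z}).ncard : ℕ∞)}
    have hG : A.Definable₁ L G :=
      definable_encard_le (p := fun u z => z ∈ C ∧ ¬ Q (u 0) z) _
        ((hC.preimage_comp fun _ => Sum.inr ()).inter (hQ _ _).compl)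
    have hbG : b ∈ G := hcofin.cast_ncard_eq.ge
    have hGinf : G.Infinite := fun h => hbA (mem_aclIn_iff.2 ⟨G, hG, h, hbG⟩)
    obtain ⟨w, hw, hwG⟩ := not_encard_le_iff.1
      (show ¬ G.encard ≤ (Y.ncard : ℕ∞) by simp [hGinf.encard_eq])
    have hbad : (⋃ i, C \ {z | Q (w i) z}).Finite :=
      Set.finite_iUnion fun i => Set.finite_of_encard_le_coe (hwG i)
    obtain ⟨z, hzC, hz⟩ := (hCinf.sdiff hbad).nonempty
    have hz' (i) : Q (w i) z := by_contra fun h => hz (Set.mem_iUnion.2 ⟨i, hzC, h⟩)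
    exact not_encard_le_iff.2 ⟨w, hw, hz'⟩ (hQcard z ⟨w 0, hz' 0⟩)
  let l := {z | Q b z}.ncard
  let P (x z : N) : Prop := Q x z ∧ {y | Q x y}.encard ≤ (l : ℕ∞)
  have hP {α : Type} (i k : α) : A.Definable L {u : α → N | P (u i) (u k)} :=
    (hQ i k).inter (definable_encard_le (p := fun u y => Q (u i) y) _ (hQ _ _))
  have hPbc : P b c := ⟨hQbc, hfib.cast_ncard_eq.ge⟩
  refine ⟨l, P, hP 0 1, fun x => ?_, fun x y h => ⟨h.1.2.1, h.1.2.2.1⟩, fun hfin => hbA ?_⟩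
  · by_cases hx : {y | Q x y}.encard ≤ (l : ℕ∞)
    · exact (Set.encard_le_encard fun y hy => hy.1).trans hx
    · simp [P, hx]
  · refine mem_aclIn_iff.2 ⟨{x | ∃ z, P x z}, ?_, ?_, c, hPbc⟩
    · exact definable_exists (p := fun v z => P (v 0) z) (hP _ _)
    · refine (hfin.biUnion (t := fun z => {x | Q x z}) ?_).subset ?_
      · rintro z ⟨x, hx⟩
        exact Set.finite_of_encard_le_coe (hQcard z ⟨x, hx.1⟩)
      · rintro x ⟨z, hz⟩
        exact Set.mem_biUnion (x := z) ⟨x, hz⟩ hz.1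

theorem BoundedCorrespondence.of_mem_aclIn_finset
    (hmin : ∀ Y : Set N, Set.univ.Definable₁ L Y → Y ⊆ C → Y.Finite ∨ (C \ Y).Finite)
    (F : Finset N) (hF : (F : Set N) ⊆ C) (hD : A.Definable₁ L D) (hC : A.Definable₁ L C)
    (hCA : (C ∩ A).Infinite) (hbD : b ∈ D) (hb : b ∈ aclIn L N SN (A ∪ F))
    (hbA : b ∉ aclIn L N SN A) : BoundedCorrespondence L A D C := by
  classical
  induction F using Finset.induction_on generalizing A with
  | empty => exact absurd (by simpa using hb) hbA
  | insert c F _ ih =>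
    rw [Finset.coe_insert] at hF hb
    have hc : c ∈ C := hF (Or.inl rfl)
    by_cases hbc : b ∈ aclIn L N SN (A ∪ {c})
    · exact .of_mem_aclIn hD hC hmin (hCA.mono Set.inter_subset_left) hc hbD hbc hbA
    · refine .of_union_singleton hD hC hmin hCA hc ?_
      have hA : A ⊆ A ∪ {c} := Set.subset_union_left
      refine ih (fun y hy => hF (Or.inr hy)) (hD.mono hA) (hC.mono hA)
        (hCA.mono (Set.inter_subset_inter_right _ hA)) ?_ hbc
      rwa [Set.union_assoc, Set.singleton_union]

theorem BoundedCorrespondence.subset_aclIn (hC : A.Definable₁ L C)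
    (hmin : ∀ Y : Set N, Set.univ.Definable₁ L Y → Y ⊆ C → Y.Finite ∨ (C \ Y).Finite)
    (h : BoundedCorrespondence L A D C) : C ⊆ aclIn L N SN (A ∪ D) := by
  obtain ⟨l, P, hP, hPl, hPDC, hPinf⟩ := h
  intro c hc
  have hproj : A.Definable₁ L {y | ∃ x, P x y} :=
    definable_exists (p := fun v x => P x (v 0))
      (hP.preimage_comp ![Sum.inr (), Sum.inl 0])
  by_cases hcP : ∃ x, P x c
  · obtain ⟨x, hx⟩ := hcP
    have hdef : (A ∪ {x}).Definable₁ L {y | P x y} := Definable.fiber_singleton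
      (hP.preimage_comp (![Sum.inr (), Sum.inl 0] : Fin 2 → Fin 1 ⊕ Unit)) x
    refine mem_aclIn_iff.2 ⟨{y | P x y}, hdef.mono ?_, Set.finite_of_encard_le_coe (hPl x), hx⟩
    exact Set.union_subset_union_right _ (Set.singleton_subset_iff.2 (hPDC x c hx).1)
  · refine mem_aclIn_iff.2 ⟨C \ {y | ∃ x, P x y}, (hC.sdiff hproj).mono Set.subset_union_left,
      (hmin _ (hproj.mono (Set.subset_univ _)) ?_).resolve_left hPinf, hc, hcP⟩
    rintro y ⟨x, hx⟩
    exact (hPDC x y hx).2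

end StronglyMinimal

theorem EEmb.realize_iff {L : FirstOrder.Language} {M N : Type} {SM : L.Structure M}
    {SN : L.Structure N} (j : EEmb L M SM N SN) {α : Type} (φ : L.Formula α) (v : α → M) :
    φ.Realize (j.fn ∘ v) ↔ φ.Realize v :=
  @ElementaryEmbedding.map_formula L M N SM SN j α φ v

/-- **Infinite definable sets recover the model**: if `M = acl(M₀ ∪ C)` for the strongly
minimal set `C = φ(M, m̄₀)`, then any infinite definable `X` not trapped in the algebraic
closure of its parameters recovers `C`, and hence all of `M`. -/
theorem infinite_definable_recovers_model
    (L : FirstOrder.Language) (g : GoedelCoding L)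
    (T : L.Theory) (hcomp : T.IsComplete)
    (M₀ : CodedStructure L) (hdec : ArithDecidable g M₀) (hM₀ : M₀.Models T)
    (k : ℕ) (φ : L.Formula (Fin 1 ⊕ Fin k)) (m₀ : Fin k → ↥M₀.carrier)
    (hsm : StronglyMinimalOver T M₀ φ m₀)
    (N : Type) (SN : L.Structure N) (hN : ModelsT L T N SN)
    (j : EEmb L ↥M₀.carrier M₀.struc N SN)
    (hgen : aclIn L N SN
        (Set.range j.fn ∪ smSet L N SN φ (fun i => j.fn (m₀ i))) = Set.univ)
    (r s : ℕ) (a : Fin s → N) (X : Set (Fin r → N)) (hXinf : X.Infinite)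
    (hXdef : DefinableOverT L N SN (Set.range j.fn ∪ Set.range a) X)
    (hXnotacl : ¬ ∀ v ∈ X, ∀ i, v i ∈ aclIn L N SN (Set.range j.fn ∪ Set.range a)) :
    smSet L N SN φ (fun i => j.fn (m₀ i)) ⊆
      aclIn L N SN (Set.range j.fn ∪ Set.range a ∪ coordSet X) ∧
    aclIn L N SN (Set.range j.fn ∪ Set.range a ∪ coordSet X) = Set.univ := by
  set C := smSet L N SN φ (fun i => j.fn (m₀ i)) with hCdef
  set A := Set.range j.fn ∪ Set.range a with hA
  have hC : A.Definable₁ L C := by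
    refine (congrArg (A.Definable L) ?_).mp
      (definable_of_formula φ (b := fun i => j.fn (m₀ i)) fun i => Or.inl ⟨m₀ i, rfl⟩)
    ext v
    have key : (fun _ => v 0) = v := funext fun i => congrArg v (Subsingleton.elim _ _)
    change _ ↔ φ.Realize (Sum.elim (fun _ => v 0) _)
    rw [key]
    rfl
  have hmin (Y : Set N) (hY : Set.univ.Definable₁ L Y) (hYC : Y ⊆ C) :
      Y.Finite ∨ (C \ Y).Finite := by
    refine hsm.2 N SN hN j Y ?_ hYC
    obtain ⟨m, ψ, b, -, hS⟩ := Definable.exists_formula hY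
    exact ⟨m, ψ, b, Set.ext fun y => Set.ext_iff.1 hS fun _ => y⟩
  have hCA : (C ∩ A).Infinite := by
    have hinj : Function.Injective j.fn :=
      @ElementaryEmbedding.injective L _ N M₀.struc SN j
    refine (hsm.1.image hinj.injOn).mono ?_
    rintro _ ⟨x, hx, rfl⟩
    refine ⟨?_, Or.inl ⟨x, rfl⟩⟩
    have := (j.realize_iff φ (Sum.elim (fun _ => x) m₀)).2 hx
    rw [Sum.comp_elim] at this
    exact this
  have hsub : C ⊆ aclIn L N SN (A ∪ coordSet X) := by
    push Not at hXnotacl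
    obtain ⟨v, hv, i, hvi⟩ := hXnotacl
    let D : Set N := {x | ∃ v ∈ X, v i = x}
    have hD : A.Definable₁ L D := by
      obtain ⟨m, ψ, b, hb, hX⟩ := hXdef
      have hX' : A.Definable L X := hX ▸ definable_of_formula ψ hb
      refine (congrArg (A.Definable L) ?_).mp (hX'.image_comp fun _ : Fin 1 => i)
      ext w
      constructor
      · rintro ⟨v, hv, rfl⟩
        exact ⟨v, hv, rfl⟩
      · rintro ⟨v, hv, h⟩
        exact ⟨v, hv, funext fun t => (Subsingleton.elim t 0) ▸ h⟩
    obtain ⟨F, hF, hvF⟩ := exists_finset_of_mem_aclIn_union (hgen.ge (Set.mem_univ (v i)))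
    have hcorr : BoundedCorrespondence L A D C :=
      .of_mem_aclIn_finset hmin F hF hD hC hCA ⟨v, hv, rfl⟩
        (aclIn_mono (Set.union_subset_union_left _ Set.subset_union_left) hvF) hvi
    refine (hcorr.subset_aclIn hC hmin).trans (aclIn_mono (Set.union_subset_union_right _ ?_))
    rintro _ ⟨v, hv, rfl⟩
    exact ⟨v, hv, i, rfl⟩
  refine ⟨hsub, Set.eq_univ_of_univ_subset ?_⟩
  rw [← hgen]
  refine (aclIn_mono ?_).trans (aclIn_union_subset hsub)
  exact Set.union_subset_union_left _ (Set.subset_union_left.trans Set.subset_union_left)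

end ArMorley
end
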